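/- Let ℓ ∈ {2, 3, 5} and let k be an odd integer with either k > 2ℓ + 2, or (ℓ, k) = (2, 5). There exists N such that for every integer n > N the following holds: let q be a positive integer with n = 2(q^ℓ + q^{ℓ−1} + ⋯ + q + 1). If there exists a bipartite (q+1)-regular graph on n vertices containing no cycle of length 2m for any 2 ≤ m ≤ ℓ, then ex(n, 𝓒_{2ℓ} ∪ {C_k}) = z(n, 𝓒_{2ℓ}) = (q+1)n/2. -/

import Mathlib

open SimpleGraph

/-- `G` contains a cycle of length `m` (as a subgraph). -/
def HasCycleLength {V : Type*} (G : SimpleGraph V) (m : ℕ) : Prop :=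
  ∃ (v : V) (w : G.Walk v v), w.IsCycle ∧ w.length = m

/-- `G` is `𝓒_{2ℓ}`-free: it contains no cycle of length `2m` for any `2 ≤ m ≤ ℓ`. -/
def EvenCycleFree {V : Type*} (G : SimpleGraph V) (ℓ : ℕ) : Prop :=
  ∀ m, 2 ≤ m → m ≤ ℓ → ¬ HasCycleLength G (2 * m)

/-- `ex(n, 𝓒_{2ℓ} ∪ {C_k})`. -/
noncomputable def exTuran (n ℓ k : ℕ) : ℕ :=
  sSup {e | ∃ G : SimpleGraph (Fin n),
    EvenCycleFree G ℓ ∧ ¬ HasCycleLength G k ∧ G.edgeSet.ncard = e}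

/-- `z(n, 𝓒_{2ℓ})`. -/
noncomputable def zZar (n ℓ : ℕ) : ℕ :=
  sSup {e | ∃ G : SimpleGraph (Fin n),
    EvenCycleFree G ℓ ∧ G.Colorable 2 ∧ G.edgeSet.ncard = e}

/-- There is a path of length `m` from `u` to `v` whose vertices lie in `S`. -/
def PP {V : Type*} (G : SimpleGraph V) (u v : V) (m : ℕ) (S : Set V) : Prop :=
  ∃ p : G.Walk u v, p.IsPath ∧ p.length = m ∧ ∀ z ∈ p.support, z ∈ S

theorem PP.mono {V : Type*} {G : SimpleGraph V} {u v : V} {m : ℕ} {S T : Set V}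
    (h : PP G u v m S) (hST : S ⊆ T) : PP G u v m T := by
  obtain ⟨p, h1, h2, h3⟩ := h
  exact ⟨p, h1, h2, fun z hz => hST (h3 z hz)⟩

theorem PP.mono_graph {V : Type*} {G H : SimpleGraph V} {u v : V} {m : ℕ} {S : Set V}
    (h : PP G u v m S) (hGH : G ≤ H) : PP H u v m S := by
  obtain ⟨p, h1, h2, h3⟩ := h
  exact ⟨p.mapLe hGH, by simpa using h1, by simpa using h2, by simpa using h3⟩

theorem PP.symm {V : Type*} {G : SimpleGraph V} {u v : V} {m : ℕ} {S : Set V}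
    (h : PP G u v m S) : PP G v u m S := by
  obtain ⟨p, h1, h2, h3⟩ := h
  exact ⟨p.reverse, h1.reverse, by simpa using h2, by simpa using h3⟩

theorem PP.append {V : Type*} {G : SimpleGraph V} {u v w : V} {m m' : ℕ} {S T : Set V}
    (h : PP G u v m S) (h' : PP G v w m' T) (hST : ∀ z ∈ S, z ∈ T → z = v) :
    PP G u w (m + m') (S ∪ T) := by
  obtain ⟨p, h1, h2, h3⟩ := h
  obtain ⟨q, k1, k2, k3⟩ := h'
  refine ⟨p.append q, ?_, by simp [h2, k2], ?_⟩
  · rw [Walk.isPath_def, Walk.support_append, List.nodup_append]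
    have hq := k1.support_nodup
    rw [← Walk.cons_tail_support, List.nodup_cons] at hq
    refine ⟨h1.support_nodup, hq.2, ?_⟩
    intro a ha b hb hab
    subst hab
    have := hST a (h3 a ha) (k3 a (List.mem_of_mem_tail hb))
    subst this
    exact hq.1 hb
  · intro z hz
    rw [Walk.mem_support_append_iff] at hz
    rcases hz with hz | hz
    · exact Or.inl (h3 z hz)
    · exact Or.inr (k3 z hz)

theorem PP.single {V : Type*} {G : SimpleGraph V} {u v : V} (h : G.Adj u v) :
    PP G u v 1 {u, v} := by
  refine ⟨h.toWalk, h.isPath_toWalk, by simp, ?_⟩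
  intro z hz
  simpa using hz

theorem PP.refl {V : Type*} {G : SimpleGraph V} (u : V) : PP G u u 0 {u} :=
  ⟨Walk.nil, Walk.IsPath.nil, rfl, by simp⟩

theorem PP.cycle {V : Type*} {G : SimpleGraph V} {u v : V} {m : ℕ} {S : Set V}
    (h : PP G u v m S) (hm : 2 ≤ m) (huv : G.Adj v u) : HasCycleLength G (m + 1) := by
  obtain ⟨p, h1, h2, -⟩ := h
  refine ⟨v, Walk.cons huv p, ?_, by simp [h2]⟩
  rw [Walk.cons_isCycle_iff]
  refine ⟨h1, fun he => ?_⟩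
  rw [Sym2.eq_swap] at he
  have := h1.length_eq_one_of_mem_edges he
  omega

theorem seqPP {V : Type*} {G : SimpleGraph V} (a : ℕ → V) (m : ℕ)
    (hadj : ∀ i < m, G.Adj (a i) (a (i + 1)))
    (hinj : ∀ i ≤ m, ∀ j ≤ m, a i = a j → i = j) :
    PP G (a 0) (a m) m {z | ∃ i ≤ m, z = a i} := by
  induction m with
  | zero => exact (PP.refl (a 0)).mono (by rintro z rfl; exact ⟨0, le_rfl, rfl⟩)
  | succ m ih =>
    have h1 := ih (fun i hi => hadj i (by omega))
      (fun i hi j hj => hinj i (by omega) j (by omega))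
    refine (h1.append (PP.single (hadj m (by omega))) ?_).mono ?_
    · rintro z ⟨i, hi, rfl⟩ hz
      rcases hz with hz | hz
      · exact hz
      · have := hinj i (by omega) (m+1) le_rfl hz
        omega
    · rintro z (⟨i, hi, rfl⟩ | (rfl | rfl))
      · exact ⟨i, by omega, rfl⟩
      · exact ⟨m, by omega, rfl⟩
      · exact ⟨m+1, by omega, rfl⟩

/-- Two parallel paths with the same ends coincide in a graph without short even cycles. -/
theorem core_unique {V : Type*} {G : SimpleGraph V} {ℓ : ℕ} (hG : EvenCycleFree G ℓ) :
    ∀ (m : ℕ), m ≤ ℓ → ∀ (a b : ℕ → V)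
    (_ : ∀ i < m, G.Adj (a i) (a (i + 1))) (_ : ∀ i < m, G.Adj (b i) (b (i + 1)))
    (_ : a 0 = b 0) (_ : a m = b m)
    (_ : ∀ i ≤ m, ∀ j ≤ m, a i = a j → i = j) (_ : ∀ i ≤ m, ∀ j ≤ m, b i = b j → i = j)
    (_ : ∀ i ≤ m, ∀ j ≤ m, a i = b j → i = j), ∀ i ≤ m, a i = b i := by
  intro m
  induction m using Nat.strong_induction_on with
  | _ m ih =>
    intro hm a b ha hb h0 hm' hai hbi hab
    by_cases hex : ∃ i, 0 < i ∧ i < m ∧ a i = b i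
    · obtain ⟨i, hi0, him, hi⟩ := hex
      have h1 := ih i him (by omega) a b (fun j hj => ha j (by omega)) (fun j hj => hb j (by omega))
        h0 hi (fun j hj j' hj' => hai j (by omega) j' (by omega))
        (fun j hj j' hj' => hbi j (by omega) j' (by omega))
        (fun j hj j' hj' => hab j (by omega) j' (by omega))
      have h2 := ih (m - i) (by omega) (by omega) (fun j => a (i + j)) (fun j => b (i + j))
        (fun j hj => ha (i+j) (by omega)) (fun j hj => hb (i+j) (by omega))
        (by simpa using hi) (by simp only [show i + (m - i) = m by omega]; exact hm')
        (fun j hj j' hj' h => by have := hai (i+j) (by omega) (i+j') (by omega) h; omega)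
        (fun j hj j' hj' h => by have := hbi (i+j) (by omega) (i+j') (by omega) h; omega)
        (fun j hj j' hj' h => by have := hab (i+j) (by omega) (i+j') (by omega) h; omega)
      intro j hj
      by_cases hji : j ≤ i
      · exact h1 j hji
      · have := h2 (j - i) (by omega)
        simpa [show i + (j - i) = j by omega] using this
    · push Not at hex
      intro i hi
      by_cases hi0 : i = 0
      · subst hi0; exact h0
      by_cases him : i = m
      · subst him; exact hm'
      exfalso
      have hm2 : 2 ≤ m := by omega
      have p1 := seqPP a m ha hai
      have p2 := (seqPP (fun j => b (j + 1)) (m - 1) (fun j hj => hb (j+1) (by omega))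
        (fun j hj j' hj' h => by have := hbi (j+1) (by omega) (j'+1) (by omega) h; omega)).symm
      simp only [show m - 1 + 1 = m by omega, Nat.zero_add] at p2
      rw [hm'] at p1
      have p3 := p1.append p2 (by
        rintro z ⟨i, hi, rfl⟩ ⟨j, hj, h⟩
        have h3 := hab i hi (j+1) (by omega) h
        by_contra hne
        have : i ≠ m := by rintro rfl; exact hne hm'
        exact hex i (by omega) (by omega) (by rw [h, ← h3]))
      have hc := p3.cycle (by omega) (by rw [h0]; exact (hb 0 (by omega)).symm)
      rw [show m + (m - 1) + 1 = 2 * m by omega] at hc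
      exact hG m hm2 hm hc

/-- `a` is a geodesic of length `i` from `v` to `x`. -/
def Geo {V : Type*} (G : SimpleGraph V) (v x : V) (i : ℕ) (a : ℕ → V) : Prop :=
  a 0 = v ∧ a i = x ∧ (∀ j < i, G.Adj (a j) (a (j + 1))) ∧ ∀ j ≤ i, G.edist v (a j) = j

theorem exists_geo {V : Type*} {G : SimpleGraph V} {v x : V} {i : ℕ}
    (h : G.edist v x = i) : ∃ a, Geo G v x i a := by
  obtain ⟨p, hp⟩ := exists_walk_of_edist_eq_coe h
  refine ⟨p.getVert, p.getVert_zero, by rw [← hp]; exact p.getVert_length, ?_, ?_⟩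
  · intro j hj
    exact p.adj_getVert_succ (by omega)
  · intro j hj
    have h1 := edist_le (p.take j)
    have h2 := edist_le (p.drop j)
    have h3 := G.edist_triangle (u := v) (v := p.getVert j) (w := x)
    rw [h] at h3
    rw [Walk.take_length] at h1
    rw [Walk.drop_length, hp] at h2
    rw [hp, min_eq_left hj] at h1
    have hne : G.edist v (p.getVert j) ≠ ⊤ := fun ht => by simp [ht] at h1
    lift G.edist v (p.getVert j) to ℕ using hne with e
    have hne2 : G.edist (p.getVert j) x ≠ ⊤ := fun ht => by simp [ht] at h2
    lift G.edist (p.getVert j) x to ℕ using hne2 with e2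
    norm_cast at *
    omega

theorem Geo.inj {V : Type*} {G : SimpleGraph V} {v x y : V} {i i' : ℕ} {a b : ℕ → V}
    (ha : Geo G v x i a) (hb : Geo G v y i' b) {j j' : ℕ} (hj : j ≤ i) (hj' : j' ≤ i')
    (h : a j = b j') : j = j' := by
  have h1 := ha.2.2.2 j hj
  have h2 := hb.2.2.2 j' hj'
  rw [h, h2] at h1
  exact_mod_cast h1.symm

theorem Geo.pp {V : Type*} {G : SimpleGraph V} {v x : V} {i : ℕ} {a : ℕ → V}
    (ha : Geo G v x i a) : PP G v x i {z | ∃ j ≤ i, z = a j} := by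
  have := seqPP a i ha.2.2.1 (fun j hj j' hj' h => ha.inj ha hj hj' h)
  rwa [ha.1, ha.2.1] at this

theorem Geo.trunc {V : Type*} {G : SimpleGraph V} {v x : V} {i : ℕ} {a : ℕ → V}
    (ha : Geo G v x i a) {j : ℕ} (hj : j ≤ i) : Geo G v (a j) j a :=
  ⟨ha.1, rfl, fun t ht => ha.2.2.1 t (by omega), fun t ht => ha.2.2.2 t (by omega)⟩

theorem Geo.unique {V : Type*} {G : SimpleGraph V} {ℓ : ℕ} (hG : EvenCycleFree G ℓ)
    {v x : V} {i : ℕ} {a b : ℕ → V} (hi : i ≤ ℓ)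
    (ha : Geo G v x i a) (hb : Geo G v x i b) : ∀ j ≤ i, a j = b j :=
  core_unique hG i hi a b ha.2.2.1 hb.2.2.1 (ha.1.trans hb.1.symm) (ha.2.1.trans hb.2.1.symm)
    (fun _ hj _ hj' h => ha.inj ha hj hj' h) (fun _ hj _ hj' h => hb.inj hb hj hj' h)
    (fun _ hj _ hj' h => ha.inj hb hj hj' h)

/-- A vertex `w` of level at least `i` has at most one neighbour of level `i` below a
given vertex of level `j`, where `i - j + 1 ≤ ℓ`. -/
theorem Geo.unique_below {V : Type*} {G : SimpleGraph V} {ℓ : ℕ} (hG : EvenCycleFree G ℓ)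
    {v x y w : V} {i j : ℕ} {a b : ℕ → V} (hij : i + 1 ≤ ℓ + j) (hj : j ≤ i)
    (ha : Geo G v x i a) (hb : Geo G v y i b) (hab : a j = b j)
    (hw : (i : ℕ∞) ≤ G.edist v w) (hxw : G.Adj x w) (hyw : G.Adj y w) : x = y := by
  have hwa : ∀ t ≤ i, a t ≠ w := by
    intro t ht h
    have h1 := ha.2.2.2 t ht
    rw [h] at h1
    rw [h1] at hw
    have : i ≤ t := by exact_mod_cast hw
    have : t = i := by omega
    subst this
    rw [ha.2.1] at h
    exact hxw.ne h
  have hwb : ∀ t ≤ i, b t ≠ w := by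
    intro t ht h
    have h1 := hb.2.2.2 t ht
    rw [h] at h1
    rw [h1] at hw
    have : i ≤ t := by exact_mod_cast hw
    have : t = i := by omega
    subst this
    rw [hb.2.1] at h
    exact hyw.ne h
  have key := core_unique hG (i - j + 1) (by omega)
    (fun t => if t ≤ i - j then a (j + t) else w) (fun t => if t ≤ i - j then b (j + t) else w)
    ?_ ?_ (by simpa using hab) (by simp) ?_ ?_ ?_ (i - j) (by omega)
  · simp only [le_refl, if_true, show j + (i - j) = i by omega] at key
    rw [ha.2.1, hb.2.1] at key
    exact key
  · intro t ht
    by_cases h : t = i - j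
    · subst h
      simp [show j + (i - j) = i by omega, ha.2.1, hxw]
    · simp only [show t ≤ i - j by omega, show t + 1 ≤ i - j by omega, if_true]
      exact ha.2.2.1 (j + t) (by omega)
  · intro t ht
    by_cases h : t = i - j
    · subst h
      simp [show j + (i - j) = i by omega, hb.2.1, hyw]
    · simp only [show t ≤ i - j by omega, show t + 1 ≤ i - j by omega, if_true]
      exact hb.2.2.1 (j + t) (by omega)
  · intro t ht t' ht' h
    split_ifs at h with h1 h2 h2
    · have := ha.inj ha (by omega) (by omega) h; omega
    · exact absurd h (hwa _ (by omega))
    · exact absurd h.symm (hwa _ (by omega))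
    · omega
  · intro t ht t' ht' h
    split_ifs at h with h1 h2 h2
    · have := hb.inj hb (by omega) (by omega) h; omega
    · exact absurd h (hwb _ (by omega))
    · exact absurd h.symm (hwb _ (by omega))
    · omega
  · intro t ht t' ht' h
    split_ifs at h with h1 h2 h2
    · have := ha.inj hb (by omega) (by omega) h; omega
    · exact absurd h (hwa _ (by omega))
    · exact absurd h.symm (hwb _ (by omega))
    · omega

/-- A vertex `w` of level at least `i` has at most one neighbour of level `i < ℓ`. -/
theorem unique_nbr {V : Type*} {G : SimpleGraph V} {ℓ : ℕ} (hG : EvenCycleFree G ℓ)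
    {v x y w : V} {i : ℕ} (hi : i + 1 ≤ ℓ) (hx : G.edist v x = i) (hy : G.edist v y = i)
    (hw : (i : ℕ∞) ≤ G.edist v w) (hxw : G.Adj x w) (hyw : G.Adj y w) : x = y := by
  obtain ⟨a, ha⟩ := exists_geo hx
  obtain ⟨b, hb⟩ := exists_geo hy
  exact Geo.unique_below hG (j := 0) (by omega) (by omega) ha hb (by rw [ha.1, hb.1]) hw hxw hyw

theorem edist_adj_le {V : Type*} {G : SimpleGraph V} {v x y : V} {i : ℕ}
    (hx : G.edist v x = i) (h : G.Adj x y) : ∃ j : ℕ, G.edist v y = j ∧ j ≤ i + 1 ∧ i ≤ j + 1 := by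
  have h1 := G.edist_triangle (u := v) (v := x) (w := y)
  have h2 := G.edist_triangle (u := v) (v := y) (w := x)
  rw [edist_eq_one_iff_adj.2 h, hx] at h1
  rw [edist_eq_one_iff_adj.2 h.symm, hx] at h2
  have hne : G.edist v y ≠ ⊤ := fun ht => by
    rw [ht] at h1
    exact absurd h1 (by simp)
  lift G.edist v y to ℕ using hne with e
  refine ⟨e, rfl, ?_, ?_⟩
  · exact_mod_cast h1
  · exact_mod_cast h2

theorem exists_parent {V : Type*} {G : SimpleGraph V} {v x : V} {i : ℕ}
    (hx : G.edist v x = (i + 1 : ℕ)) : ∃ y, G.edist v y = i ∧ G.Adj y x := by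
  obtain ⟨a, ha⟩ := exists_geo hx
  refine ⟨a i, ha.2.2.2 i (by omega), ?_⟩
  have := ha.2.2.1 i (by omega)
  rwa [ha.2.1] at this

theorem EvenCycleFree.mono {V : Type*} {G H : SimpleGraph V} {ℓ : ℕ} (hG : EvenCycleFree G ℓ)
    (h : H ≤ G) : EvenCycleFree H ℓ := by
  intro m h1 h2 ⟨v, w, hw, hl⟩
  exact hG m h1 h2 ⟨v, w.mapLe h, by simpa using hw, by simpa using hl⟩

open SimpleGraph

open Classical in
/-- The neighbours of `v`. -/
noncomputable def nb {V : Type*} [Fintype V] (G : SimpleGraph V) (v : V) : Finset V :=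
  Finset.univ.filter (fun w => G.Adj v w)

open Classical in
/-- The vertices at distance `i` from `v`. -/
noncomputable def lvl {V : Type*} [Fintype V] (G : SimpleGraph V) (v : V) (i : ℕ) : Finset V :=
  Finset.univ.filter (fun w => G.edist v w = i)

open Classical in
/-- The adjacency matrix. -/
noncomputable def AM {V : Type*} (G : SimpleGraph V) : Matrix V V ℝ :=
  fun u w => if G.Adj u w then 1 else 0

open Classical in
/-- The distance-`i` matrix. -/
noncomputable def DM {V : Type*} (G : SimpleGraph V) (i : ℕ) : Matrix V V ℝ :=
  fun u w => if G.edist u w = i then 1 else 0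

section
set_option linter.unusedSectionVars false
set_option linter.unusedDecidableInType false
variable {V : Type*} [Fintype V] [DecidableEq V] {G : SimpleGraph V}

theorem mem_nb {v w : V} : w ∈ nb G v ↔ G.Adj v w := by simp [nb]
theorem mem_lvl {v w : V} {i : ℕ} : w ∈ lvl G v i ↔ G.edist v w = i := by simp [lvl]

theorem lvl_zero (v : V) : lvl G v 0 = {v} := by
  ext w
  rw [mem_lvl, Finset.mem_singleton, Nat.cast_zero, edist_eq_zero_iff, eq_comm]

theorem lvl_one (v : V) : lvl G v 1 = nb G v := by
  ext w
  rw [mem_lvl, mem_nb, ← edist_eq_one_iff_adj]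
  simp

theorem sum_AM (v : V) : ∑ w, AM G v w = (nb G v).card := by
  classical
  simp [AM, nb]

theorem sum_DM (v : V) (i : ℕ) : ∑ w, DM G i v w = (lvl G v i).card := by
  classical
  simp [DM, lvl]

theorem AM_symm (u v : V) : AM G u v = AM G v u := by
  classical
  unfold AM; split_ifs with h1 h2 h2
  · rfl
  · exact absurd h1.symm h2
  · exact absurd h2.symm h1
  · rfl

theorem DM_symm (i : ℕ) (u v : V) : DM G i u v = DM G i v u := by
  simp [DM, edist_comm]

theorem AM_nonneg (u v : V) : 0 ≤ AM G u v := by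
  unfold AM; split_ifs <;> norm_num

theorem DM_nonneg (i : ℕ) (u v : V) : 0 ≤ DM G i u v := by
  unfold DM; split_ifs <;> norm_num

theorem DM_mul_AM_apply (i : ℕ) (u w : V) :
    (DM G i * AM G) u w = (lvl G u i ∩ nb G w).card := by
  classical
  rw [Matrix.mul_apply]
  have : ∀ x, DM G i u x * AM G x w = if x ∈ lvl G u i ∩ nb G w then 1 else 0 := by
    intro x
    simp only [DM, AM, Finset.mem_inter, mem_lvl, mem_nb, G.adj_comm x w]
    split_ifs <;> simp_all
  simp only [this]
  rw [Finset.sum_boole, Finset.filter_mem_eq_inter, Finset.univ_inter]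

theorem sum_DM_mul_AM (i : ℕ) (u : V) :
    ∑ w, (DM G i * AM G) u w = ∑ x ∈ lvl G u i, ((nb G x).card : ℝ) := by
  classical
  simp only [Matrix.mul_apply]
  rw [Finset.sum_comm]
  simp only [← Finset.mul_sum, sum_AM]
  rw [lvl, Finset.sum_filter]
  refine Finset.sum_congr rfl fun x _ => ?_
  simp only [DM]
  split_ifs <;> simp

theorem up_one {ℓ : ℕ} (hG : EvenCycleFree G ℓ) {u w : V} {i : ℕ} (hi : i + 1 ≤ ℓ)
    (hw : w ∈ lvl G u (i + 1)) : (lvl G u i ∩ nb G w).card = 1 := by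
  classical
  rw [mem_lvl] at hw
  obtain ⟨y, hy, hyw⟩ := exists_parent hw
  rw [Finset.card_eq_one]
  refine ⟨y, ?_⟩
  ext x
  simp only [Finset.mem_inter, mem_lvl, mem_nb, Finset.mem_singleton]
  constructor
  · rintro ⟨h1, h2⟩
    exact unique_nbr hG hi h1 hy (by rw [hw]; exact_mod_cast Nat.le_succ i) h2.symm hyw
  · rintro rfl
    exact ⟨hy, hyw.symm⟩

theorem down_two {ℓ : ℕ} (hG : EvenCycleFree G ℓ) {u x : V} {i : ℕ} (hi : i + 1 ≤ ℓ)
    (hx : x ∈ lvl G u i) : (nb G x \ lvl G u (i + 1)).card ≤ 2 := by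
  classical
  rw [mem_lvl] at hx
  have h1 : (nb G x ∩ lvl G u i).card ≤ 1 := by
    rw [Finset.card_le_one]
    intro a ha b hb
    simp only [Finset.mem_inter, mem_lvl, mem_nb] at ha hb
    exact unique_nbr hG hi ha.2 hb.2 hx.ge ha.1.symm hb.1.symm
  have h2 : (nb G x ∩ lvl G u (i - 1)).card ≤ 1 ∨ i = 0 := by
    by_cases h0 : i = 0
    · exact Or.inr h0
    left
    rw [Finset.card_le_one]
    intro a ha b hb
    simp only [Finset.mem_inter, mem_lvl, mem_nb] at ha hb
    exact unique_nbr hG (i := i - 1) (by omega) ha.2 hb.2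
      (by rw [hx]; exact_mod_cast Nat.sub_le i 1) ha.1.symm hb.1.symm
  rcases h2 with h2 | h2
  · have : nb G x \ lvl G u (i + 1) ⊆ (nb G x ∩ lvl G u i) ∪ (nb G x ∩ lvl G u (i - 1)) := by
      intro y hy
      simp only [Finset.mem_sdiff, Finset.mem_union, Finset.mem_inter, mem_lvl, mem_nb] at hy ⊢
      obtain ⟨j, hj, hj1, hj2⟩ := edist_adj_le hx hy.1
      have : j ≠ i + 1 := by rintro rfl; exact hy.2 hj
      rcases (by omega : j = i ∨ j = i - 1) with rfl | rfl
      · exact Or.inl ⟨hy.1, hj⟩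
      · exact Or.inr ⟨hy.1, hj⟩
    have := Finset.card_le_card this
    have := Finset.card_union_le (nb G x ∩ lvl G u i) (nb G x ∩ lvl G u (i - 1))
    omega
  · subst h2
    have : nb G x \ lvl G u (0 + 1) ⊆ nb G x ∩ lvl G u 0 := by
      intro y hy
      simp only [Finset.mem_sdiff, Finset.mem_inter, mem_lvl, mem_nb] at hy ⊢
      obtain ⟨j, hj, hj1, hj2⟩ := edist_adj_le hx hy.1
      have : j ≠ 0 + 1 := by rintro rfl; exact hy.2 hj
      have : j = 0 := by omega
      subst this
      exact ⟨hy.1, hj⟩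
    have := Finset.card_le_card this
    omega

/-- The error matrix. -/
noncomputable def EM (G : SimpleGraph V) (i : ℕ) : Matrix V V ℝ := DM G i * AM G - DM G (i + 1)

theorem EM_nonneg {ℓ : ℕ} (hG : EvenCycleFree G ℓ) {i : ℕ} (hi : i + 1 ≤ ℓ) (u w : V) :
    0 ≤ EM G i u w := by
  simp only [EM, Matrix.sub_apply, DM_mul_AM_apply]
  by_cases hw : w ∈ lvl G u (i + 1)
  · rw [up_one hG hi hw]
    rw [mem_lvl] at hw
    simp only [DM, hw]
    norm_num
  · rw [mem_lvl] at hw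
    simp only [DM, if_neg hw]
    simp

theorem sum_EM_le {ℓ : ℕ} (hG : EvenCycleFree G ℓ) {i : ℕ} (hi : i + 1 ≤ ℓ) (u : V) :
    ∑ w, EM G i u w ≤ 2 * (lvl G u i).card := by
  classical
  have h1 : ∀ w, EM G i u w = ∑ x ∈ lvl G u i, if w ∈ nb G x \ lvl G u (i+1) then (1:ℝ) else 0 := by
    intro w
    simp only [EM, Matrix.sub_apply, DM_mul_AM_apply]
    by_cases hw : w ∈ lvl G u (i + 1)
    · rw [up_one hG hi hw]
      have : ∀ x, w ∉ nb G x \ lvl G u (i+1) := fun x hx => (Finset.mem_sdiff.1 hx).2 hw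
      simp only [this]
      rw [mem_lvl] at hw
      simp only [DM, hw]
      norm_num
    · have h2 : ∀ x, (w ∈ nb G x \ lvl G u (i+1)) ↔ x ∈ nb G w := by
        intro x; simp [hw, mem_nb, G.adj_comm]
      simp only [h2]
      rw [mem_lvl] at hw
      simp only [DM, if_neg hw, Finset.sum_boole, Finset.filter_mem_eq_inter, sub_zero]
  simp only [h1]
  rw [Finset.sum_comm]
  have h3 : ∀ x ∈ lvl G u i, (∑ w, if w ∈ nb G x \ lvl G u (i+1) then (1:ℝ) else 0) ≤ 2 := by
    intro x hx
    have := down_two hG hi hx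
    rw [Finset.sum_boole, Finset.filter_mem_eq_inter, Finset.univ_inter]
    exact_mod_cast this
  calc _ ≤ ∑ x ∈ lvl G u i, (2:ℝ) := Finset.sum_le_sum h3
    _ = _ := by simp [mul_comm]

theorem sum_nb_le {ℓ : ℕ} (hG : EvenCycleFree G ℓ) {i : ℕ} (hi : i + 1 ≤ ℓ) (u : V) :
    ∑ x ∈ lvl G u i, ((nb G x).card : ℝ) ≤ (lvl G u (i+1)).card + 2 * (lvl G u i).card := by
  have h := sum_EM_le hG hi u
  simp only [EM, Matrix.sub_apply, Finset.sum_sub_distrib] at h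
  rw [sum_DM_mul_AM, sum_DM] at h
  linarith

theorem lvl_succ_le {ℓ : ℕ} (hG : EvenCycleFree G ℓ) {i : ℕ} (hi : i + 1 ≤ ℓ) (u : V) :
    ((lvl G u (i+1)).card : ℝ) ≤ ∑ x ∈ lvl G u i, ((nb G x).card : ℝ) := by
  have h : 0 ≤ ∑ w, EM G i u w := Finset.sum_nonneg fun w _ => EM_nonneg hG hi u w
  simp only [EM, Matrix.sub_apply, Finset.sum_sub_distrib] at h
  rw [sum_DM_mul_AM, sum_DM] at h
  linarith

theorem lvl_card_le {ℓ : ℕ} (hG : EvenCycleFree G ℓ) {Δ : ℝ} (hΔ : ∀ x, ((nb G x).card : ℝ) ≤ Δ)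
    (u : V) : ∀ i ≤ ℓ, ((lvl G u i).card : ℝ) ≤ Δ ^ i := by
  have hΔ0 : 0 ≤ Δ := le_trans (by positivity) (hΔ u)
  intro i
  induction i with
  | zero => intro _; simp [lvl_zero]
  | succ i ih =>
    intro hi
    calc _ ≤ _ := lvl_succ_le hG hi u
      _ ≤ ∑ x ∈ lvl G u i, Δ := Finset.sum_le_sum fun x _ => hΔ x
      _ = (lvl G u i).card * Δ := by simp
      _ ≤ Δ ^ i * Δ := by gcongr; exact ih (by omega)
      _ = _ := by ring

theorem lvl_card_ge {ℓ : ℕ} (hG : EvenCycleFree G ℓ) {δ : ℝ} (hδ2 : 0 ≤ δ) (u : V)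
    (hδ : ∀ i < ℓ, ∀ x ∈ lvl G u i, δ + 2 ≤ ((nb G x).card : ℝ)) :
    ∀ i, i + 1 ≤ ℓ → ((nb G u).card : ℝ) * δ ^ i ≤ ((lvl G u (i+1)).card : ℝ) := by
  intro i
  induction i with
  | zero => intro _; simp [lvl_one]
  | succ i ih =>
    intro hi
    have h1 := sum_nb_le hG hi u
    have h2 : ∑ x ∈ lvl G u (i+1), (δ + 2) ≤ ∑ x ∈ lvl G u (i+1), ((nb G x).card : ℝ) :=
      Finset.sum_le_sum fun x hx => hδ (i+1) (by omega) x hx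
    simp only [Finset.sum_const, nsmul_eq_mul] at h2
    have h3 := ih (by omega)
    calc _ = ((nb G u).card : ℝ) * δ ^ i * δ := by ring
      _ ≤ (lvl G u (i+1)).card * δ := by gcongr
      _ ≤ _ := by linarith

/-- `A^i = M_i + F_i`, where `F_i` is nonnegative with small row sums. -/
theorem FM_facts {ℓ : ℕ} (hG : EvenCycleFree G ℓ) {Δ : ℝ} (hΔ : ∀ x, ((nb G x).card : ℝ) ≤ Δ)
    : ∀ i ≤ ℓ, (∀ u w, 0 ≤ (AM G ^ i - DM G i) u w) ∧
      ∀ u, ∑ w, (AM G ^ i - DM G i) u w ≤ 2 * i * Δ ^ (i - 1) := by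
  intro i
  induction i with
  | zero =>
    intro _
    have : AM G ^ 0 - DM G 0 = 0 := by
      ext u w
      simp [DM, Matrix.one_apply]
    rw [this]
    simp
  | succ i ih =>
    intro hi
    obtain ⟨h1, h2⟩ := ih (by omega)
    have key : AM G ^ (i+1) - DM G (i+1) = (AM G ^ i - DM G i) * AM G + EM G i := by
      rw [EM, pow_succ, sub_mul]; abel
    rw [key]
    constructor
    · intro u w
      rw [Matrix.add_apply, Matrix.mul_apply]
      exact add_nonneg (Finset.sum_nonneg fun x _ => mul_nonneg (h1 _ _) (AM_nonneg _ _))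
        (EM_nonneg hG hi u w)
    · intro u
      have hΔ0 : 0 ≤ Δ := le_trans (by positivity) (hΔ u)
      have e1 := sum_EM_le hG hi u
      have e2 := lvl_card_le hG hΔ u i (by omega)
      generalize AM G ^ i - DM G i = F at *
      have e0 : ∑ w, (F * AM G + EM G i) u w = ∑ w, (F * AM G) u w + ∑ w, EM G i u w := by
        rw [← Finset.sum_add_distrib]; rfl
      rw [e0]
      have e3 : ∑ w, (F * AM G) u w ≤ 2 * i * Δ ^ (i-1) * Δ := by
        have e5 : ∑ w, (F * AM G) u w = ∑ x, F u x * (nb G x).card := by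
          simp only [← sum_AM, Finset.mul_sum]
          rw [Finset.sum_comm]
          exact Finset.sum_congr rfl fun w _ => Matrix.mul_apply
        rw [e5]
        calc _ ≤ ∑ x, F u x * Δ :=
              Finset.sum_le_sum fun x _ => mul_le_mul_of_nonneg_left (hΔ x) (h1 _ _)
          _ = (∑ x, F u x) * Δ := by rw [Finset.sum_mul]
          _ ≤ _ := mul_le_mul_of_nonneg_right (h2 u) hΔ0
      have e4 : 2 * (i:ℝ) * Δ ^ (i-1) * Δ = 2 * i * Δ ^ i := by
        rcases i with _ | i
        · simp
        · simp only [Nat.add_sub_cancel]; ring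
      have e6 : 2 * ((i + 1 : ℕ) : ℝ) * Δ ^ (i + 1 - 1) = 2 * i * Δ ^ i + 2 * Δ ^ i := by
        rw [Nat.add_sub_cancel]; push_cast; ring
      rw [e6]
      linarith
end

open SimpleGraph

section
set_option linter.unusedSectionVars false
set_option linter.unusedDecidableInType false
variable {V : Type*} [Fintype V] [DecidableEq V] {G : SimpleGraph V}

/-- Twice the number of edges inside `U`. -/
noncomputable def E2 (G : SimpleGraph V) (U : Finset V) : ℝ := ∑ x ∈ U, ∑ y ∈ U, AM G x y

theorem AM_self (x : V) : AM G x x = 0 := by simp [AM]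

theorem sum_AM_inter (x : V) (U : Finset V) : ∑ y ∈ U, AM G x y = (nb G x ∩ U).card := by
  classical
  simp only [AM, Finset.sum_boole]
  congr 2
  ext y
  simp [mem_nb, and_comm]

theorem E2_erase {U : Finset V} {x : V} (hx : x ∈ U) :
    E2 G (U.erase x) = E2 G U - 2 * (nb G x ∩ U).card := by
  have h1 : ∀ f : V → ℝ, ∑ y ∈ U, f y = f x + ∑ y ∈ U.erase x, f y := fun f =>
    (Finset.add_sum_erase U f hx).symm
  rw [← sum_AM_inter, E2, E2, h1 (fun z => ∑ y ∈ U, AM G z y)]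
  simp only [h1 (fun y => AM G _ y), Finset.sum_add_distrib, AM_self, AM_symm _ x]
  ring

theorem exists_maximizer (A : Finset V) (hA : A.Nonempty) (g : ℕ → ℝ) :
    ∃ U ⊆ A, U.Nonempty ∧ E2 G A - g A.card ≤ E2 G U - g U.card ∧
      ∀ x ∈ U, (U.erase x).Nonempty → g U.card - g (U.card - 1) ≤ 2 * (nb G x ∩ U).card := by
  classical
  obtain ⟨U, hU, hmax⟩ := Finset.exists_max_image (A.powerset.filter (·.Nonempty))
    (fun U => E2 G U - g U.card) ⟨A, by simp [hA]⟩
  simp only [Finset.mem_filter, Finset.mem_powerset] at hU hmax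
  refine ⟨U, hU.1, hU.2, hmax A ⟨subset_rfl, hA⟩, ?_⟩
  intro x hx hne
  have := hmax (U.erase x) ⟨(Finset.erase_subset _ _).trans hU.1, hne⟩
  rw [E2_erase hx, Finset.card_erase_of_mem hx] at this
  linarith

theorem E2_le_single {U : Finset V} (h : U.card ≤ 1) : E2 G U = 0 := by
  rcases isEmpty_or_nonempty V with hV | hV
  · simp [E2, Finset.eq_empty_of_isEmpty U]
  · obtain ⟨x, hx⟩ := Finset.card_le_one_iff_subset_singleton.1 h
    rcases Finset.subset_singleton_iff.1 hx with rfl | rfl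
    · simp [E2]
    · simp [E2, AM_self]

/-- Greedy path inside a set of large minimum degree. -/
theorem greedy {U : Finset V} {K : ℕ} (hU : ∀ x ∈ U, K ≤ (nb G x ∩ U).card) {c : V} (hc : c ∈ U) :
    ∀ p < K, ∃ z ∈ U, ∃ S : Finset V, S ⊆ U ∧ S.card ≤ p + 1 ∧ c ∈ S ∧ z ∈ S ∧
      PP G c z p ↑S := by
  intro p
  induction p with
  | zero => 
    intro _
    exact ⟨c, hc, {c}, by simpa using hc, by simp, by simp, by simp, by simpa using PP.refl c⟩
  | succ p ih =>
    intro hp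
    obtain ⟨z, hz, S, hSU, hS, hcS, hzS, hP⟩ := ih (by omega)
    have h1 : ((nb G z ∩ U) \ (S.erase z)).Nonempty := by
      rw [← Finset.card_pos]
      have := Finset.le_card_sdiff (S.erase z) (nb G z ∩ U)
      have h2 := hU z hz
      have h3 := Finset.card_erase_of_mem hzS
      omega
    obtain ⟨y, hy⟩ := h1
    simp only [Finset.mem_sdiff, Finset.mem_inter, mem_nb, Finset.mem_erase] at hy
    have hyz : y ≠ z := hy.1.1.ne.symm
    have hyS : y ∉ S := fun h => hy.2 ⟨hyz, h⟩
    refine ⟨y, hy.1.2, insert y S, ?_, ?_, by simp [hcS], by simp, ?_⟩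
    · intro t ht
      rcases Finset.mem_insert.1 ht with rfl | ht
      · exact hy.1.2
      · exact hSU ht
    · rw [Finset.card_insert_of_notMem hyS]; omega
    · refine (hP.append (PP.single hy.1.1) ?_).mono ?_
      · intro t ht ht'
        rcases ht' with rfl | ht'
        · rfl
        · simp only [Set.mem_singleton_iff] at ht'
          subst ht'
          exact absurd ht hyS
      · intro t ht
        simp only [Set.mem_union, Finset.mem_coe, Set.mem_insert_iff, Set.mem_singleton_iff,
          Finset.coe_insert] at ht ⊢
        rcases ht with h | rfl | rfl
        · exact Or.inr h
        · exact Or.inr hzS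
        · exact Or.inl rfl

/-- Few edges inside level `ℓ`. -/
theorem few_edges {ℓ k : ℕ} (hG : EvenCycleFree G ℓ) (hℓ : 2 ≤ ℓ) (hk : 2 * ℓ + 1 ≤ k)
    (hC : ¬ HasCycleLength G k) (v : V) :
    E2 G (lvl G v ℓ) ≤ 2 * k * Fintype.card V := by
  by_contra hcon
  push Not at hcon
  have hN : ((lvl G v ℓ).card : ℝ) ≤ Fintype.card V := by exact_mod_cast Finset.card_le_univ _
  have hk0 : (0:ℝ) < k := by exact_mod_cast (by omega : 0 < k)
  have hpos : 0 < E2 G (lvl G v ℓ) := lt_of_le_of_lt (by positivity) hcon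
  have hne : (lvl G v ℓ).Nonempty := by
    by_contra h
    rw [Finset.not_nonempty_iff_eq_empty] at h
    rw [h] at hpos
    simp [E2] at hpos
  obtain ⟨U, hUA, hUne, hE, hdeg⟩ := exists_maximizer (G := G) (lvl G v ℓ) hne (fun m => 2 * k * m)
  have hE2 : 0 < E2 G U - 2 * k * U.card := by
    refine lt_of_lt_of_le ?_ hE
    have : 2 * (k:ℝ) * (lvl G v ℓ).card ≤ 2 * k * Fintype.card V := by gcongr
    linarith
  have hU2 : 1 < U.card := by
    by_contra h
    rw [E2_le_single (by omega)] at hE2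
    have : 0 ≤ 2 * (k:ℝ) * U.card := by positivity
    linarith
  have hmin : ∀ x ∈ U, k ≤ (nb G x ∩ U).card := by
    intro x hx
    have h1 := hdeg x hx (by rw [← Finset.card_pos, Finset.card_erase_of_mem hx]; omega)
    rw [Nat.cast_sub (by omega)] at h1
    have h2 : (k:ℝ) ≤ (nb G x ∩ U).card := by push_cast at h1; linarith
    exact_mod_cast h2
  obtain ⟨c, hc⟩ := hUne
  obtain ⟨z, hz, S, hSU, hS, hcS, hzS, hP⟩ := greedy hmin hc (k - 2 * ℓ - 1) (by omega)
  have hcl := mem_lvl.1 (hUA hc)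
  obtain ⟨a, ha⟩ := exists_geo hcl
  -- choose last vertex
  have hlast : ∃ y ∈ nb G z ∩ U, y ∉ S ∧ ∀ b, Geo G v y ℓ b → a 1 ≠ b 1 := by
    by_contra hno
    push Not at hno
    have hle : ((nb G z ∩ U) \ S.erase z).card ≤ 1 := by
      rw [Finset.card_le_one]
      intro x hx y hy
      have aux : ∀ x ∈ (nb G z ∩ U) \ S.erase z, ∃ b, Geo G v x ℓ b ∧ a 1 = b 1 ∧ G.Adj x z := by
        intro x hx
        rw [Finset.mem_sdiff] at hx
        have h1 : G.Adj z x := mem_nb.1 (Finset.mem_inter.1 hx.1).1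
        obtain ⟨b, hb, hb'⟩ := hno x hx.1 (fun h => hx.2 (Finset.mem_erase.2 ⟨h1.ne.symm, h⟩))
        exact ⟨b, hb, hb', h1.symm⟩
      obtain ⟨b, hb, hb1, hbz⟩ := aux x hx
      obtain ⟨b', hb', hb1', hbz'⟩ := aux y hy
      exact Geo.unique_below hG le_rfl (by omega : 1 ≤ ℓ) hb hb' (hb1.symm.trans hb1')
        (mem_lvl.1 (hUA hz)).ge hbz hbz'
    have h1 := Finset.le_card_sdiff (S.erase z) (nb G z ∩ U)
    have h2 := hmin z hz
    have h3 := Finset.card_erase_of_mem hzS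
    omega
  obtain ⟨y, hy, hyS, hyb⟩ := hlast
  rw [Finset.mem_inter, mem_nb] at hy
  obtain ⟨b, hb⟩ := exists_geo (mem_lvl.1 (hUA hy.2))
  have hab := hyb b hb
  have hlev : ∀ t ∈ S, G.edist v t = ℓ := fun t ht => mem_lvl.1 (hUA (hSU ht))
  -- path: v -> c -> z, then z-y, y -> v
  have p1 := ha.pp.append hP (by
    rintro t ⟨j, hj, rfl⟩ ht
    have h1 := ha.2.2.2 j hj
    rw [hlev _ ht] at h1
    have : ℓ = j := by exact_mod_cast h1
    rw [← this, ha.2.1])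
  have hq := hb.trunc (j := 1) (by omega)
  -- path from b 1 to y
  have p2 : PP G y (b 1) (ℓ - 1) {t | ∃ j, 1 ≤ j ∧ j ≤ ℓ ∧ t = b j} := by
    have := seqPP (G := G) (fun j => b (j + 1)) (ℓ - 1) (fun i hi => hb.2.2.1 (i+1) (by omega))
      (fun i hi j hj h => by have := hb.inj hb (by omega) (by omega) h; omega)
    simp only [zero_add] at this
    rw [Nat.sub_add_cancel (by omega), hb.2.1] at this
    refine this.symm.mono ?_
    rintro t ⟨i, hi, rfl⟩
    exact ⟨i+1, by omega, by omega, rfl⟩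
  have hbS : ∀ j, 1 ≤ j → j ≤ ℓ → b j ∉ S := by
    intro j h1 h2 h3
    have h4 := hb.2.2.2 j h2
    rw [hlev _ h3] at h4
    have : ℓ = j := by exact_mod_cast h4
    rw [← this, hb.2.1] at h3
    exact hyS h3
  have hba : ∀ j, 1 ≤ j → j ≤ ℓ → ∀ i ≤ ℓ, b j ≠ a i := by
    intro j h1 h2 i hi h
    have h3 := hb.inj ha h2 hi h
    subst h3
    have h4 := hb.trunc h2
    rw [h] at h4
    exact hab (Geo.unique hG h2 (ha.trunc hi) h4 1 h1)
  have hyset : ∀ t, (t ∈ ({t | ∃ j ≤ ℓ, t = a j} ∪ (↑S : Set V))) → ∀ j, 1 ≤ j → j ≤ ℓ → t ≠ b j := by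
    rintro t (⟨i, hi, rfl⟩ | ht) j h1 h2 h
    · exact hba j h1 h2 i hi h.symm
    · rw [h] at ht; exact hbS j h1 h2 ht
  have p3 := p1.append (PP.single hy.1) (by
    intro t ht ht'
    rcases ht' with rfl | ht'
    · rfl
    · simp only [Set.mem_singleton_iff] at ht'
      rw [ht', ← hb.2.1] at ht
      exact absurd rfl (hyset _ ht ℓ (by omega) le_rfl))
  have p4 := p3.append p2 (by
    rintro t ht ⟨j, h1, h2, rfl⟩
    rcases ht with ht | ht | ht
    · exact absurd rfl (hyset _ ht j h1 h2)
    · exact absurd hzS (by rw [← ht]; exact hbS j h1 h2)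
    · exact ht)
  have hadj : G.Adj (b 1) v := by
    have := hb.2.2.1 0 (by omega)
    rw [hb.1] at this
    exact this.symm
  have := p4.cycle (by omega) hadj
  have e : ℓ + (k - 2 * ℓ - 1) + 1 + (ℓ - 1) + 1 = k := by omega
  rw [e] at this
  exact hC this
end

open SimpleGraph

theorem jensen_log {ι : Type*} [Fintype ι] (w p : ι → ℝ) (hw : ∀ i, 0 ≤ w i)
    (hp : ∀ i, w i ≠ 0 → 0 < p i) (hR : 0 < ∑ i, w i) :
    0 < ∑ i, w i * p i ∧
    ∑ i, w i * Real.log (p i) ≤ (∑ i, w i) * Real.log ((∑ i, w i * p i) / ∑ i, w i) := by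
  have hP : 0 < ∑ i, w i * p i := by
    obtain ⟨i, hi, hi'⟩ := Finset.exists_lt_of_sum_lt (s := Finset.univ) (f := fun _ : ι => (0:ℝ))
      (g := w) (by simpa using hR)
    refine Finset.sum_pos' (fun j _ => ?_) ⟨i, hi, mul_pos hi' (hp i hi'.ne')⟩
    by_cases h : w j = 0
    · simp [h]
    · exact mul_nonneg (hw j) (hp j h).le
  refine ⟨hP, ?_⟩
  set R := ∑ i, w i with hRdef
  set P := ∑ i, w i * p i with hPdef
  have key : ∀ i, w i * Real.log (p i) ≤ w i * (Real.log (P / R)) + (w i * p i) * (R / P) - w i := by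
    intro i
    by_cases h : w i = 0
    · simp [h]
    have h1 := hp i h
    have h2 := Real.log_le_sub_one_of_pos (x := p i / (P / R)) (by positivity)
    rw [Real.log_div h1.ne' (by positivity)] at h2
    have h3 : p i / (P / R) = p i * (R / P) := by field_simp
    rw [h3] at h2
    have := mul_le_mul_of_nonneg_left h2 (hw i)
    linarith
  calc _ ≤ ∑ i, (w i * (Real.log (P / R)) + (w i * p i) * (R / P) - w i) :=
        Finset.sum_le_sum fun i _ => key i
    _ = R * Real.log (P / R) + P * (R / P) - R := by
        rw [Finset.sum_sub_distrib, Finset.sum_add_distrib, ← Finset.sum_mul, ← Finset.sum_mul]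
    _ = _ := by field_simp; ring

/-- Iterates of a nonnegative operator on the constant function. -/
noncomputable def Wit {D : Type*} [Fintype D] (t : D → D → ℝ) : ℕ → D → ℝ
  | 0, _ => 1
  | i + 1, e => ∑ e', t e e' * Wit t i e'

theorem log_trick {D : Type*} [Fintype D] (t : D → D → ℝ) (μ r : D → ℝ)
    (ht : ∀ e e', 0 ≤ t e e') (hμ : ∀ e, 0 ≤ μ e) (hr : ∀ e, r e = ∑ e', t e e')
    (hr0 : ∀ e, μ e ≠ 0 → 0 < r e) (hcl : ∀ e e', μ e ≠ 0 → t e e' ≠ 0 → μ e' ≠ 0)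
    (hst : ∀ e', ∑ e, μ e * (t e e' / r e) = μ e') (hM : 0 < ∑ e, μ e) (i : ℕ) :
    (∑ e, μ e) * Real.exp (i * ((∑ e, μ e * Real.log (r e)) / ∑ e, μ e)) ≤ ∑ e, μ e * Wit t i e := by
  have main : ∀ i : ℕ, (∀ e, μ e ≠ 0 → 0 < Wit t i e) ∧
      i * ∑ e, μ e * Real.log (r e) ≤ ∑ e, μ e * Real.log (Wit t i e) := by
    intro i
    induction i with
    | zero => simp [Wit]
    | succ i ih =>
      obtain ⟨ih1, ih2⟩ := ih
      have J : ∀ e, μ e ≠ 0 → _ := fun e he => jensen_log (t e) (Wit t i) (ht e)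
        (fun e' h => ih1 e' (hcl e e' he h)) (by rw [← hr]; exact hr0 e he)
      refine ⟨fun e he => (J e he).1, ?_⟩
      have step : ∀ e, μ e * Real.log (r e) + ∑ e', μ e * (t e e' / r e) * Real.log (Wit t i e') ≤
          μ e * Real.log (Wit t (i+1) e) := by
        intro e
        by_cases he : μ e = 0
        · simp [he]
        have h1 := (J e he).2
        have h0 := (J e he).1
        have hre := hr0 e he
        rw [← hr] at h1
        change _ ≤ r e * Real.log (Wit t (i+1) e / r e) at h1
        change 0 < Wit t (i+1) e at h0
        rw [Real.log_div h0.ne' hre.ne'] at h1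
        have h2 : ∑ e', μ e * (t e e' / r e) * Real.log (Wit t i e') =
            μ e / r e * ∑ e', t e e' * Real.log (Wit t i e') := by
          rw [Finset.mul_sum]
          refine Finset.sum_congr rfl fun e' _ => by ring
        rw [h2]
        have h3 := mul_le_mul_of_nonneg_left h1 (div_nonneg (hμ e) hre.le)
        have h4 : μ e / r e * (r e * (Real.log (Wit t (i+1) e) - Real.log (r e))) =
          μ e * (Real.log (Wit t (i+1) e) - Real.log (r e)) := by field_simp
        rw [h4] at h3
        linarith
      have := Finset.sum_le_sum fun e (_ : e ∈ Finset.univ) => step e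
      rw [Finset.sum_add_distrib, Finset.sum_comm] at this
      simp only [← Finset.sum_mul, hst] at this
      push_cast
      linarith
  obtain ⟨h1, h2⟩ := main i
  obtain ⟨j0, j1⟩ := jensen_log μ (Wit t i) hμ h1 hM
  have h3 : i * ((∑ e, μ e * Real.log (r e)) / ∑ e, μ e) ≤
      Real.log ((∑ e, μ e * Wit t i e) / ∑ e, μ e) := by
    rw [← mul_div_assoc, div_le_iff₀ hM]
    linarith
  have h4 := Real.exp_le_exp.2 h3
  rw [Real.exp_log (by positivity), le_div_iff₀ hM] at h4
  linarith

theorem tang1 {y e : ℝ} (hy : 0 < y) (he : 0 < e) :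
    e * Real.log e + (Real.log e + 1) * (y - e) ≤ y * Real.log y := by
  have h := Real.log_le_sub_one_of_pos (x := e / y) (by positivity)
  rw [Real.log_div he.ne' hy.ne'] at h
  have := mul_le_mul_of_nonneg_left h hy.le
  have h2 : y * (e / y - 1) = e - y := by field_simp
  rw [h2] at this
  linarith

theorem tang2 {y e : ℝ} (hy : 1 ≤ y) (he : 1 ≤ e) :
    (e + 1) * Real.log e + (Real.log e + 1 + 1 / e) * (y - e) ≤ (y + 1) * Real.log y := by
  have hy0 : 0 < y := by linarith
  have he0 : 0 < e := by linarith
  obtain ⟨s, hs, rfl⟩ : ∃ s, 0 < s ∧ y = e * s := ⟨y / e, by positivity, by field_simp⟩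
  rw [Real.log_mul he0.ne' hs.ne']
  suffices h : (e + 1) * (s - 1) ≤ (e * s + 1) * Real.log s by
    have : (Real.log e + 1 + 1 / e) * (e * s - e) = Real.log e * (e * s - e) + (e + 1) * (s - 1) := by
      field_simp; ring
    rw [this]
    linarith
  rcases le_total 1 s with h1 | h1
  · have h2 := Real.le_log_one_add_of_nonneg (x := s - 1) (by linarith)
    rw [show 1 + (s - 1) = s by ring, div_le_iff₀ (by linarith)] at h2
    have h0 : 0 ≤ Real.log s := Real.log_nonneg h1
    have h3 : s - 1 ≤ s * Real.log s := by nlinarith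
    nlinarith
  · have h2 : 2 * Real.log s + 1 / s - s ≥ 0 := by
      have hs' : 0 ≤ Real.log (1 / s) := Real.log_nonneg (by rw [le_div_iff₀ hs]; linarith)
      have h3 := Real.self_le_sinh_iff.2 hs'
      rw [Real.sinh_log (by positivity), Real.log_div one_ne_zero hs.ne', Real.log_one] at h3
      simp only [one_div, inv_inv] at h3 ⊢
      linarith
    have h3 : 0 ≤ s * Real.log s - (s - 1) := by
      have := tang1 hs one_pos
      simp at this; linarith
    have h4 : 1 ≤ e * s := hy
    have h5 : s * (2 * Real.log s + 1 / s - s) = 2 * s * Real.log s + 1 - s * s := by field_simp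
    have h6 : 0 ≤ s * (2 * Real.log s + 1 / s - s) := mul_nonneg hs.le h2
    rw [h5] at h6
    -- e * A + B ≥ 0 with A = s log s - (s-1) ≥ 0, e ≥ 1/s
    have h7 : 0 ≤ (e * s - 1) * (s * Real.log s - (s - 1)) := mul_nonneg (by linarith) h3
    have h8 : 0 ≤ s * ((e * s + 1) * Real.log s - (e + 1) * (s - 1)) := by nlinarith
    have := nonneg_of_mul_nonneg_right h8 hs
    linarith

theorem avg_aux {ι : Type*} [Fintype ι] [Nonempty ι] (f : ι → ℝ) (hf : ∀ v, 0 < f v) (i : ℕ) :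
    (Fintype.card ι : ℝ) * ((∑ v, f v) / Fintype.card ι) ^ (i + 1) ≤
      (∑ v, f v) * Real.exp (i * ((∑ v, f v * Real.log (f v)) / ∑ v, f v)) := by
  have hN : (0:ℝ) < Fintype.card ι := by exact_mod_cast Fintype.card_pos
  have hM : 0 < ∑ v, f v := Finset.sum_pos (fun v _ => hf v) Finset.univ_nonempty
  obtain ⟨M, hMe⟩ : ∃ M, M = ∑ v, f v := ⟨_, rfl⟩
  obtain ⟨N, hNe⟩ : ∃ N : ℝ, N = Fintype.card ι := ⟨_, rfl⟩
  rw [← hMe, ← hNe]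
  rw [← hMe] at hM
  rw [← hNe] at hN
  have hd : 0 < M / N := div_pos hM hN
  have e2 : M * Real.log (M / N) ≤ ∑ v, f v * Real.log (f v) := by
    have := Finset.sum_le_sum fun v (_ : v ∈ Finset.univ) => tang1 (hf v) hd
    refine le_trans (le_of_eq ?_) this
    simp only [Finset.sum_add_distrib, ← Finset.mul_sum, Finset.sum_sub_distrib,
      Finset.sum_const, Finset.card_univ, nsmul_eq_mul]
    rw [← hMe, ← hNe]
    field_simp
    ring
  have e3 : Real.log (M/N) ≤ (∑ v, f v * Real.log (f v)) / M := by
    rw [le_div_iff₀ hM]; linarith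
  have e4 : (M / N) ^ i ≤ Real.exp (i * ((∑ v, f v * Real.log (f v)) / M)) := by
    have e5 : (M / N) ^ i = Real.exp (i * Real.log (M / N)) := by
      rw [Real.exp_nat_mul, Real.exp_log hd]
    rw [e5]
    gcongr
  calc N * (M / N) ^ (i+1) = M * (M/N)^i := by rw [pow_succ]; field_simp
    _ ≤ _ := by gcongr

section
set_option linter.unusedSectionVars false
set_option linter.unusedDecidableInType false
variable {V : Type*} [Fintype V] [DecidableEq V] {G : SimpleGraph V}

theorem Wit_AM (i : ℕ) (v : V) : Wit (AM G) i v = ∑ w, (AM G ^ i) v w := by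
  induction i generalizing v with
  | zero => simp [Wit, Matrix.one_apply]
  | succ i ih =>
    simp only [Wit, ih, pow_succ']
    simp only [Finset.mul_sum]
    rw [Finset.sum_comm]
    exact Finset.sum_congr rfl fun w _ => Matrix.mul_apply.symm

theorem walk_count [Nonempty V] (hdeg : ∀ v, 0 < (nb G v).card) (i : ℕ) :
    (Fintype.card V : ℝ) * ((∑ v, ((nb G v).card : ℝ)) / Fintype.card V) ^ (i + 1) ≤
      ∑ v, ∑ w, (AM G ^ (i + 1)) v w := by
  have hdeg' : ∀ v, (0:ℝ) < (nb G v).card := fun v => by exact_mod_cast hdeg v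
  have hN : (0:ℝ) < Fintype.card V := by exact_mod_cast Fintype.card_pos
  have hM : 0 < ∑ v, ((nb G v).card : ℝ) := Finset.sum_pos (fun v _ => hdeg' v) Finset.univ_nonempty
  have h := log_trick (AM G) (fun v => ((nb G v).card : ℝ)) (fun v => ((nb G v).card : ℝ))
    (fun _ _ => AM_nonneg _ _) (fun v => (hdeg' v).le) (fun v => (sum_AM v).symm)
    (fun v _ => hdeg' v) (fun _ e' _ _ => (hdeg' e').ne')
    (fun e' => by
      have : ∀ e, ((nb G e).card : ℝ) * (AM G e e' / (nb G e).card) = AM G e' e := by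
        intro e
        have := hdeg' e
        rw [AM_symm e' e]
        field_simp
      simp only [this, sum_AM]) hM i
  have e1 : ∑ v, ∑ w, (AM G ^ (i + 1)) v w = ∑ e, ((nb G e).card : ℝ) * Wit (AM G) i e := by
    have : ∀ v, ∑ w, (AM G ^ (i + 1)) v w = Wit (AM G) (i+1) v := fun v => (Wit_AM _ _).symm
    simp only [this, Wit]
    rw [Finset.sum_comm]
    simp only [← Finset.sum_mul]
    refine Finset.sum_congr rfl fun v _ => ?_
    rw [← sum_AM]
    congr 1
    exact Finset.sum_congr rfl fun w _ => AM_symm _ _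
  rw [e1]
  refine le_trans ?_ h
  exact avg_aux (fun v => ((nb G v).card : ℝ)) hdeg' i
end

open SimpleGraph

section
set_option linter.unusedSectionVars false
set_option linter.unusedDecidableInType false
variable {V : Type*} [Fintype V] [DecidableEq V] {G : SimpleGraph V}

open Classical in
/-- Nonbacktracking transition. -/
noncomputable def nbt (G : SimpleGraph V) (e e' : V × V) : ℝ :=
  if e'.1 = e.2 ∧ G.Adj e.2 e'.2 ∧ e'.2 ≠ e.1 then 1 else 0

open Classical in
/-- The vertices reached through `v` first. -/
noncomputable def SL (G : SimpleGraph V) (i : ℕ) (u v : V) : Finset V :=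
  Finset.univ.filter (fun x => G.edist v x = i ∧ G.edist u x = (i + 1 : ℕ))

theorem nbt_nonneg (e e' : V × V) : 0 ≤ nbt G e e' := by unfold nbt; split_ifs <;> norm_num

theorem sum_nbt (u v : V) (f : V × V → ℝ) :
    ∑ e', nbt G (u, v) e' * f e' = ∑ w ∈ (nb G v).erase u, f (v, w) := by
  classical
  rw [Fintype.sum_prod_type, Finset.sum_eq_single v]
  · rw [← Finset.sum_filter_add_sum_filter_not Finset.univ (fun w => w ∈ (nb G v).erase u)]
    rw [Finset.filter_mem_eq_inter, Finset.univ_inter]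
    rw [Finset.sum_eq_zero (s := Finset.univ.filter _), add_zero]
    · refine Finset.sum_congr rfl fun w hw => ?_
      rw [Finset.mem_erase, mem_nb] at hw
      simp [nbt, hw]
    · intro w hw
      simp only [Finset.mem_filter, Finset.mem_erase, mem_nb] at hw
      have : nbt G (u, v) (v, w) = 0 := by
        unfold nbt
        rw [if_neg]
        rintro ⟨-, h1, h2⟩
        exact hw.2 ⟨h2, h1⟩
      rw [this, zero_mul]
  · intro b _ hb
    refine Finset.sum_eq_zero fun w _ => ?_
    simp [nbt, hb]
  · simp

theorem edist_ne_of_adj (c : G.Coloring Bool) {u v x : V} (h : G.Adj u v) {i : ℕ}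
    (h1 : G.edist v x = i) : G.edist u x ≠ i := by
  intro h2
  obtain ⟨p, hp⟩ := exists_walk_of_edist_eq_coe h1
  obtain ⟨q, hq⟩ := exists_walk_of_edist_eq_coe h2
  have e1 := c.even_length_iff_congr p
  have e2 := c.even_length_iff_congr q
  rw [hp] at e1
  rw [hq] at e2
  have := c.valid h
  revert this
  generalize c u = a at *
  generalize c v = b at *
  generalize c x = d at *
  cases a <;> cases b <;> cases d <;> simp_all

theorem SL_step {ℓ : ℕ} (hG : EvenCycleFree G ℓ) (c : G.Coloring Bool) {i : ℕ} (hi : i + 1 ≤ ℓ)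
    {u v : V} (huv : G.Adj u v) :
    ∑ w ∈ (nb G v).erase u, (SL G i v w).card ≤ (SL G (i + 1) u v).card := by
  classical
  rw [← Finset.card_biUnion]
  · refine Finset.card_le_card ?_
    intro x hx
    simp only [Finset.mem_biUnion, Finset.mem_erase, mem_nb, SL, Finset.mem_filter,
      Finset.mem_univ, true_and] at hx ⊢
    obtain ⟨w, ⟨hwu, hvw⟩, h1, h2⟩ := hx
    refine ⟨h2, ?_⟩
    rw [edist_comm] at h1 h2
    obtain ⟨j, hj, hj1, hj2⟩ := edist_adj_le h2 huv.symm
    have h3 : j ≠ i + 1 := by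
      rintro rfl
      exact edist_ne_of_adj c huv (by rw [edist_comm]; exact h2) (by rw [edist_comm]; exact hj)
    have h4 : j ≠ i := by
      rintro rfl
      exact hwu (unique_nbr hG hi h1 hj (by rw [h2]; exact_mod_cast Nat.le_succ _) hvw.symm huv)
    have : j = i + 1 + 1 := by omega
    rw [edist_comm, hj, this]
  · intro w hw w' hw' hne
    rw [Function.onFun, Finset.disjoint_left]
    intro x hx hx'
    simp only [Finset.coe_erase, Set.mem_sdiff, Finset.mem_coe, mem_nb, SL, Finset.mem_filter,
      Finset.mem_univ, true_and] at hw hw' hx hx'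
    obtain ⟨h1, h2⟩ := hx
    obtain ⟨h1', -⟩ := hx'
    rw [edist_comm] at h1 h2 h1'
    exact hne (unique_nbr hG hi h1 h1' (by rw [h2]; exact_mod_cast Nat.le_succ _) hw.1.symm hw'.1.symm)

theorem Wit_le_SL {ℓ : ℕ} (hG : EvenCycleFree G ℓ) (c : G.Coloring Bool) (i : ℕ) (hi : i ≤ ℓ)
    {u v : V} (huv : G.Adj u v) : Wit (nbt G) i (u, v) ≤ (SL G i u v).card := by
  classical
  induction i generalizing u v with
  | zero =>
    have : v ∈ SL G 0 u v := by simp [SL, huv]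
    have := Finset.card_pos.2 ⟨v, this⟩
    simp only [Wit]
    exact_mod_cast this
  | succ i ih =>
    rw [Wit, sum_nbt]
    calc _ ≤ ∑ w ∈ (nb G v).erase u, ((SL G i v w).card : ℝ) :=
          Finset.sum_le_sum fun w hw => ih (by omega) (mem_nb.1 (Finset.mem_of_mem_erase hw))
      _ ≤ _ := by exact_mod_cast SL_step hG c hi huv

theorem SL_total {ℓ : ℕ} (u v : V) :
    ∑ i ∈ Finset.range (ℓ + 1), ((SL G i u v).card + (SL G i v u).card) ≤ Fintype.card V := by
  classical
  have h1 : ∀ x : V, ∑ i ∈ Finset.range (ℓ + 1), ((if x ∈ SL G i u v then 1 else 0) +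
      (if x ∈ SL G i v u then 1 else 0)) ≤ 1 := by
    intro x
    by_cases h : ∃ i ∈ Finset.range (ℓ + 1), x ∈ SL G i u v ∨ x ∈ SL G i v u
    · obtain ⟨i, hi, h⟩ := h
      rw [Finset.sum_eq_single_of_mem i hi]
      · have : ¬ (x ∈ SL G i u v ∧ x ∈ SL G i v u) := by
          simp only [SL, Finset.mem_filter, Finset.mem_univ, true_and]
          rintro ⟨⟨h1, h2⟩, h3, h4⟩
          rw [h1] at h4
          have : i = i + 1 := by exact_mod_cast h4
          omega
        split_ifs <;> simp_all
      · intro j _ hj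
        simp only [SL, Finset.mem_filter, Finset.mem_univ, true_and] at h ⊢
        have aux : ∀ a b : ℕ, ((a:ℕ∞) = b) → a = b := fun a b h => by exact_mod_cast h
        have n1 : ¬ (G.edist v x = j ∧ G.edist u x = (j + 1 : ℕ)) := by
          rintro ⟨h3, h4⟩
          rcases h with ⟨h1, h2⟩ | ⟨h1, h2⟩
          · exact hj (aux _ _ (h3.symm.trans h1))
          · have e1 := aux _ _ (h1.symm.trans h4)
            have e2 := aux _ _ (h2.symm.trans h3)
            omega
        have n2 : ¬ (G.edist u x = j ∧ G.edist v x = (j + 1 : ℕ)) := by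
          rintro ⟨h3, h4⟩
          rcases h with ⟨h1, h2⟩ | ⟨h1, h2⟩
          · have e1 := aux _ _ (h1.symm.trans h4)
            have e2 := aux _ _ (h2.symm.trans h3)
            omega
          · exact hj (aux _ _ (h3.symm.trans h1))
        simp only [if_neg n1, if_neg n2, add_zero]
    · push Not at h
      rw [Finset.sum_eq_zero]
      · norm_num
      · intro i hi
        simp [h i hi]
  have h2 := Finset.sum_le_sum fun x (_ : x ∈ Finset.univ) => h1 x
  rw [Finset.sum_comm] at h2
  simp only [Finset.sum_add_distrib, Finset.sum_boole, Finset.filter_mem_eq_inter,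
    Finset.univ_inter, Finset.sum_const, Finset.card_univ, smul_eq_mul, mul_one, Nat.cast_id] at h2
  rw [Finset.sum_add_distrib]
  exact h2

theorem avg_aux2 {ι : Type*} [Fintype ι] [Nonempty ι] (f : ι → ℝ) (hf : ∀ v, 2 ≤ f v) (i : ℕ) :
    ((∑ v, f v) / Fintype.card ι - 1) ^ i ≤
      Real.exp (i * ((∑ v, f v * Real.log (f v - 1)) / ∑ v, f v)) := by
  have hN : (0:ℝ) < Fintype.card ι := by exact_mod_cast Fintype.card_pos
  have hM : 2 * (Fintype.card ι : ℝ) ≤ ∑ v, f v := by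
    have := Finset.sum_le_sum fun v (_ : v ∈ Finset.univ) => hf v
    simpa [mul_comm] using this
  obtain ⟨M, hMe⟩ : ∃ M, M = ∑ v, f v := ⟨_, rfl⟩
  obtain ⟨N, hNe⟩ : ∃ N : ℝ, N = Fintype.card ι := ⟨_, rfl⟩
  rw [← hMe, ← hNe]
  rw [← hMe, ← hNe] at hM
  rw [← hNe] at hN
  have hM0 : 0 < M := by linarith
  have hd : 1 ≤ M / N - 1 := by
    have : 2 ≤ M / N := by rw [le_div_iff₀ hN]; exact hM
    linarith
  have e2 : M * Real.log (M / N - 1) ≤ ∑ v, f v * Real.log (f v - 1) := by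
    have := Finset.sum_le_sum fun v (_ : v ∈ Finset.univ) => tang2 (y := f v - 1) (by linarith [hf v]) hd
    have e : ∀ v, (f v - 1 + 1) * Real.log (f v - 1) = f v * Real.log (f v - 1) := fun v => by ring
    simp only [e] at this
    refine le_trans (le_of_eq ?_) this
    simp only [Finset.sum_add_distrib, ← Finset.mul_sum, Finset.sum_sub_distrib,
      Finset.sum_const, Finset.card_univ, nsmul_eq_mul]
    rw [← hMe, ← hNe]
    have : M - N * 1 - (N * (M / N) - N * 1) = 0 := by field_simp; ring
    rw [this]
    field_simp
    ring
  have e3 : Real.log (M/N - 1) ≤ (∑ v, f v * Real.log (f v - 1)) / M := by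
    rw [le_div_iff₀ hM0]; linarith
  have e5 : (M / N - 1) ^ i = Real.exp (i * Real.log (M / N - 1)) := by
    rw [Real.exp_nat_mul, Real.exp_log (by linarith)]
  rw [e5]
  gcongr

theorem moore [Nonempty V] {ℓ : ℕ} (hG : EvenCycleFree G ℓ) (c : G.Coloring Bool)
    (hdeg : ∀ v, 2 ≤ (nb G v).card) :
    2 * ∑ i ∈ Finset.range (ℓ + 1), ((∑ v, ((nb G v).card : ℝ)) / Fintype.card V - 1) ^ i ≤
      Fintype.card V := by
  classical
  have hdeg' : ∀ v, (2:ℝ) ≤ (nb G v).card := fun v => by exact_mod_cast hdeg v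
  set μ : V × V → ℝ := fun e => AM G e.1 e.2 with hμ
  set r : V × V → ℝ := fun e => ∑ e', nbt G e e' with hr
  have hμ0 : ∀ e, μ e ≠ 0 → G.Adj e.1 e.2 := by
    intro e he
    by_contra h
    exact he (by simp [hμ, AM, h])
  have hr1 : ∀ u v, r (u, v) = ((nb G v).erase u).card := by
    intro u v
    have := sum_nbt (G := G) u v (fun _ => 1)
    simpa using this
  have hr2 : ∀ u v, G.Adj u v → r (u, v) = (nb G v).card - 1 := by
    intro u v h
    rw [hr1, Finset.card_erase_of_mem (mem_nb.2 h.symm), Nat.cast_sub (by linarith [hdeg v])]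
    simp
  have hsumμ : ∀ f : V × V → ℝ, ∑ e, μ e * f e = ∑ v, ∑ u, AM G v u * f (u, v) := by
    intro f
    rw [Fintype.sum_prod_type, Finset.sum_comm]
    refine Finset.sum_congr rfl fun v _ => Finset.sum_congr rfl fun u _ => ?_
    simp only [hμ]
    rw [AM_symm]
  have hMM : ∑ e, μ e = ∑ v, ((nb G v).card : ℝ) := by
    have := hsumμ (fun _ => 1)
    simp only [mul_one, sum_AM] at this
    exact this
  have hM : 0 < ∑ e, μ e := by
    rw [hMM]
    exact Finset.sum_pos (fun v _ => by linarith [hdeg' v]) Finset.univ_nonempty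
  have hst : ∀ e', ∑ e, μ e * (nbt G e e' / r e) = μ e' := by
    rintro ⟨v', w⟩
    rw [hsumμ (fun e => nbt G e (v', w) / r e), Finset.sum_eq_single v']
    · by_cases hvw : G.Adj v' w
      · have h1 : ∀ u, AM G v' u * (nbt G (u, v') (v', w) / r (u, v')) =
            (if u ∈ (nb G v').erase w then 1 else 0) * (1 / ((nb G v').card - 1)) := by
          intro u
          by_cases hu : G.Adj v' u
          · rw [hr2 u v' hu.symm]
            by_cases huw : u = w
            · simp [nbt, huw]
            · have : u ∈ (nb G v').erase w := by simp [mem_nb, hu, huw]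
              have huw' : w ≠ u := fun h => huw h.symm
              simp [nbt, this, AM, hu, hvw, huw']
          · simp [AM, hu, mem_nb]
        simp only [h1, ← Finset.sum_mul]
        rw [Finset.sum_boole, Finset.filter_mem_eq_inter, Finset.univ_inter,
          Finset.card_erase_of_mem (mem_nb.2 hvw), Nat.cast_sub (by linarith [hdeg v'])]
        have : ((nb G v').card : ℝ) - 1 ≠ 0 := by linarith [hdeg' v']
        simp only [hμ, AM, if_pos hvw]
        push_cast
        field_simp
      · simp [nbt, hvw, hμ, AM]
    · intro v _ hv
      refine Finset.sum_eq_zero fun u _ => ?_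
      have : nbt G (u, v) (v', w) = 0 := by simp [nbt, hv.symm]
      rw [this]; simp
    · simp
  have key := fun i => log_trick (nbt G) μ r nbt_nonneg (fun e => AM_nonneg _ _) (fun e => rfl)
    (fun e he => by
      have := hr2 e.1 e.2 (hμ0 e he)
      rw [show r e = r (e.1, e.2) from rfl, this]
      linarith [hdeg' e.2])
    (fun e e' _ h => by
      have : G.Adj e'.1 e'.2 := by
        by_contra hn
        apply h
        unfold nbt
        rw [if_neg]
        rintro ⟨h1, h2, -⟩
        rw [← h1] at h2
        exact hn h2
      simp [hμ, AM, this]) hst hM i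
  have hlog : ∑ e, μ e * Real.log (r e) = ∑ v, ((nb G v).card : ℝ) * Real.log ((nb G v).card - 1) := by
    rw [hsumμ]
    refine Finset.sum_congr rfl fun v _ => ?_
    rw [← sum_AM, Finset.sum_mul]
    refine Finset.sum_congr rfl fun u _ => ?_
    by_cases h : G.Adj v u
    · rw [hr2 u v h.symm, sum_AM]
    · simp [AM, h]
  rw [hlog, hMM] at key
  have k2 : ∀ i ∈ Finset.range (ℓ + 1), (∑ v, ((nb G v).card : ℝ)) *
      ((∑ v, ((nb G v).card : ℝ)) / Fintype.card V - 1) ^ i ≤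
      ∑ e : V × V, AM G e.1 e.2 * (SL G i e.1 e.2).card := by
    intro i hi
    refine le_trans (mul_le_mul_of_nonneg_left (avg_aux2 _ hdeg' i)
      (Finset.sum_nonneg fun v _ => Nat.cast_nonneg _)) ?_
    refine le_trans (key i) ?_
    refine Finset.sum_le_sum fun e _ => ?_
    by_cases h : G.Adj e.1 e.2
    · refine mul_le_mul_of_nonneg_left ?_ (AM_nonneg _ _)
      exact Wit_le_SL hG c i (by rw [Finset.mem_range] at hi; omega) h
    · simp [hμ, AM, h]
  have k3 := Finset.sum_le_sum k2
  have k4 : 2 * ∑ i ∈ Finset.range (ℓ + 1), ∑ e : V × V, AM G e.1 e.2 * ((SL G i e.1 e.2).card : ℝ) ≤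
      (∑ v, ((nb G v).card : ℝ)) * Fintype.card V := by
    have sw : ∀ i, ∑ e : V × V, AM G e.1 e.2 * ((SL G i e.1 e.2).card : ℝ) =
        ∑ e : V × V, AM G e.1 e.2 * ((SL G i e.2 e.1).card : ℝ) := by
      intro i
      have := hsumμ (fun e => ((SL G i e.1 e.2).card : ℝ))
      rw [Fintype.sum_prod_type (f := fun e : V × V => AM G e.1 e.2 * ((SL G i e.2 e.1).card : ℝ))]
      exact this
    rw [two_mul]
    nth_rewrite 2 [Finset.sum_congr rfl fun i _ => sw i]
    rw [← Finset.sum_add_distrib]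
    simp only [← Finset.sum_add_distrib, ← mul_add]
    rw [Finset.sum_comm, ← hMM, Finset.sum_mul]
    refine Finset.sum_le_sum fun e _ => ?_
    rw [← Finset.mul_sum]
    refine mul_le_mul_of_nonneg_left ?_ (AM_nonneg _ _)
    exact_mod_cast SL_total e.1 e.2
  rw [← Finset.mul_sum] at k3
  rw [hMM] at hM
  have k5 : (∑ v, ((nb G v).card : ℝ)) *
      (2 * ∑ i ∈ Finset.range (ℓ + 1), ((∑ v, ((nb G v).card : ℝ)) / Fintype.card V - 1) ^ i) ≤
      (∑ v, ((nb G v).card : ℝ)) * Fintype.card V := by linarith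
  exact le_of_mul_le_mul_left k5 hM
end

open SimpleGraph

section
set_option linter.unusedSectionVars false
set_option linter.unusedDecidableInType false
variable {V : Type*} [Fintype V] [DecidableEq V] {G : SimpleGraph V}

/-- Induced subgraph on a finset. -/
abbrev ind (G : SimpleGraph V) (U : Finset V) : SimpleGraph {x // x ∈ U} := G.comap Subtype.val

theorem ind_cycle {U : Finset V} {m : ℕ} (h : HasCycleLength (ind G U) m) : HasCycleLength G m := by
  obtain ⟨v, w, hw, hl⟩ := h
  let f : ind G U →g G := ⟨Subtype.val, fun h => h⟩
  have hf : Function.Injective f := Subtype.val_injective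
  exact ⟨f v, w.map f, hw.map hf, by simpa using hl⟩

theorem ind_ecf {U : Finset V} {ℓ : ℕ} (h : EvenCycleFree G ℓ) : EvenCycleFree (ind G U) ℓ :=
  fun m h1 h2 h3 => h m h1 h2 (ind_cycle h3)

theorem ind_nb {U : Finset V} (x : {x // x ∈ U}) : (nb (ind G U) x).card = (nb G x ∩ U).card := by
  rw [← Finset.card_map (Function.Embedding.subtype _)]
  congr 1
  ext y
  simp only [Finset.mem_map, mem_nb, Finset.mem_inter, Function.Embedding.coe_subtype]
  constructor
  · rintro ⟨z, hz, rfl⟩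
    exact ⟨hz, z.2⟩
  · rintro ⟨h1, h2⟩
    exact ⟨⟨y, h2⟩, h1, rfl⟩

theorem ind_E2 {U : Finset V} : ∑ x, ((nb (ind G U) x).card : ℝ) = E2 G U := by
  simp only [ind_nb, E2, sum_AM_inter]
  exact Finset.sum_coe_sort U (fun x => ((nb G x ∩ U).card : ℝ))

theorem E2_univ : E2 G Finset.univ = ∑ v, ((nb G v).card : ℝ) := by
  simp only [E2, sum_AM]

theorem moore' [Nonempty V] {ℓ : ℕ} (hG : EvenCycleFree G ℓ) (c : G.Coloring Bool) {D : ℝ}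
    (hD : 4 ≤ D) (h : D * Fintype.card V ≤ ∑ v, ((nb G v).card : ℝ)) :
    2 * ∑ i ∈ Finset.range (ℓ + 1), (D - 1) ^ i ≤ Fintype.card V := by
  obtain ⟨U, -, hUne, hE, hdeg⟩ := exists_maximizer (G := G) Finset.univ Finset.univ_nonempty
    (fun m => D * m)
  have hE' : D * U.card ≤ E2 G U := by
    rw [E2_univ] at hE
    rw [Finset.card_univ] at hE
    linarith
  have hpos : (0:ℝ) < U.card := by exact_mod_cast hUne.card_pos
  have hU2 : 1 < U.card := by
    by_contra hh
    rw [E2_le_single (by omega)] at hE'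
    nlinarith
  have hmin : ∀ x ∈ U, 2 ≤ (nb G x ∩ U).card := by
    intro x hx
    have h1 := hdeg x hx (by rw [← Finset.card_pos, Finset.card_erase_of_mem hx]; omega)
    rw [Nat.cast_sub (by omega)] at h1
    have h2 : (2:ℝ) ≤ (nb G x ∩ U).card := by push_cast at h1; linarith
    exact_mod_cast h2
  haveI : Nonempty {x // x ∈ U} := hUne.to_subtype
  let c' : (ind G U).Coloring Bool := Coloring.mk (fun x => c x.1) (fun {a b} hab => c.valid hab)
  have hm := moore (ind_ecf (U := U) hG) c' (fun v => by rw [ind_nb]; exact hmin v v.2)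
  rw [ind_E2, Fintype.card_coe] at hm
  have hd : D ≤ E2 G U / U.card := by rw [le_div_iff₀ hpos]; exact hE'
  calc 2 * ∑ i ∈ Finset.range (ℓ + 1), (D - 1) ^ i ≤ 
      2 * ∑ i ∈ Finset.range (ℓ + 1), (E2 G U / U.card - 1) ^ i := by
        gcongr with i hi
        linarith
    _ ≤ U.card := hm
    _ ≤ _ := by exact_mod_cast Finset.card_le_univ _
end

open SimpleGraph

section
set_option linter.unusedSectionVars false
set_option linter.unusedDecidableInType false
variable {V : Type*} [Fintype V] [DecidableEq V] {G : SimpleGraph V}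

/-- The main setting. -/
structure MS (G : SimpleGraph V) (ℓ k : ℕ) (c D : ℝ) : Prop where
  ecf : EvenCycleFree G ℓ
  nock : ¬ HasCycleLength G k
  two : 2 ≤ ℓ
  hk : 2 * ℓ + 1 ≤ k
  mindeg : ∀ v, c * D ≤ ((nb G v).card : ℝ)
  avg : D * Fintype.card V ≤ ∑ v, ((nb G v).card : ℝ)
  card : (Fintype.card V : ℝ) ≤ 2 * D ^ ℓ
  ne : Nonempty V

/-- Twice the number of edges inside the parts. -/
noncomputable def InS (G : SimpleGraph V) (σ : V → Bool) : ℝ :=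
  ∑ x, ∑ y, if σ x = σ y then AM G x y else 0

/-- Edges between parts. -/
def Bp (G : SimpleGraph V) (σ : V → Bool) : SimpleGraph V where
  Adj x y := G.Adj x y ∧ σ x ≠ σ y
  symm := ⟨fun _ _ h => ⟨h.1.symm, h.2.symm⟩⟩
  loopless := ⟨fun _ h => h.2 rfl⟩

theorem Bp_le (σ : V → Bool) : Bp G σ ≤ G := fun _ _ h => h.1

/-- The colouring of `Bp`. -/
def Bpc (G : SimpleGraph V) (σ : V → Bool) : (Bp G σ).Coloring Bool :=
  Coloring.mk σ (fun h => h.2)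

theorem AM_Bp (σ : V → Bool) (x y : V) :
    AM (Bp G σ) x y = AM G x y - if σ x = σ y then AM G x y else 0 := by
  classical
  by_cases h : G.Adj x y <;> by_cases h2 : σ x = σ y <;> simp [AM, Bp, h, h2]

theorem sum_deg_Bp (σ : V → Bool) :
    ∑ v, ((nb (Bp G σ) v).card : ℝ) = ∑ v, ((nb G v).card : ℝ) - InS G σ := by
  simp only [← sum_AM, AM_Bp, Finset.sum_sub_distrib, InS]

theorem MS.Dpos {ℓ k : ℕ} {c D : ℝ} (_h : MS G ℓ k c D) (hc : 0 < c) (hD : 4 ≤ c * D) : 0 < D := by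
  by_contra hh
  push Not at hh
  nlinarith

theorem MS.maxdeg {ℓ k : ℕ} {c D : ℝ} (h : MS G ℓ k c D) (hc : 0 < c) (hD : 4 ≤ c * D) (v : V) :
    ((nb G v).card : ℝ) ≤ 2 * (2 / c) ^ (ℓ - 1) * D := by
  have hD0 := h.Dpos hc hD
  have h2 := h.two
  have h1 := lvl_card_ge h.ecf (δ := c * D / 2) (by positivity) v
    (fun i _ x _ => by linarith [h.mindeg x]) (ℓ - 1) (by omega)
  have h3 : ((lvl G v (ℓ - 1 + 1)).card : ℝ) ≤ 2 * D ^ ℓ :=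
    le_trans (by exact_mod_cast Finset.card_le_univ _) h.card
  have h4 := h1.trans h3
  have h5 : (0:ℝ) < (c * D / 2) ^ (ℓ - 1) := by positivity
  rw [← le_div_iff₀ h5] at h4
  refine h4.trans (le_of_eq ?_)
  rw [div_eq_iff h5.ne']
  have : D ^ ℓ = D ^ (ℓ - 1) * D := by rw [← pow_succ]; congr 1; omega
  rw [this]
  have e : (2 / c) ^ (ℓ - 1) * (c * D / 2) ^ (ℓ - 1) = D ^ (ℓ - 1) := by
    rw [← mul_pow]; congr 1; field_simp
  calc _ = 2 * D ^ (ℓ - 1) * D := by ring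
    _ = _ := by rw [← e]; ring

theorem InS_indicator (A : Finset V) :
    InS G (fun x => decide (x ∈ A)) =
      ∑ v, ((nb G v).card : ℝ) - 2 * (∑ x ∈ A, ((nb G x).card : ℝ) - E2 G A) := by
  have h1 : ∀ x y : V, (if decide (x ∈ A) = decide (y ∈ A) then AM G x y else 0) =
      AM G x y - (if x ∈ A then AM G x y else 0) - (if y ∈ A then AM G x y else 0)
        + 2 * (if x ∈ A then (if y ∈ A then AM G x y else 0) else 0) := by
    intro x y
    by_cases hx : x ∈ A <;> by_cases hy : y ∈ A <;> simp [hx, hy]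
    ring
  have h2 : ∑ x, ∑ y, (if x ∈ A then AM G x y else 0) = ∑ x ∈ A, ((nb G x).card : ℝ) := by
    have : ∀ x, ∑ y, (if x ∈ A then AM G x y else 0) = if x ∈ A then ((nb G x).card : ℝ) else 0 := by
      intro x
      split_ifs
      · exact sum_AM x
      · simp
    simp only [this]
    simp [Finset.sum_ite_mem]
  have h3 : ∑ x, ∑ y, (if y ∈ A then AM G x y else 0) = ∑ x ∈ A, ((nb G x).card : ℝ) := by
    rw [← h2, Finset.sum_comm]
    refine Finset.sum_congr rfl fun x _ => Finset.sum_congr rfl fun y _ => ?_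
    rw [AM_symm]
  have h4 : ∑ x, ∑ y, (if x ∈ A then (if y ∈ A then AM G x y else 0) else 0) = E2 G A := by
    have : ∀ x, ∑ y, (if x ∈ A then (if y ∈ A then AM G x y else 0) else 0) =
        if x ∈ A then ∑ y ∈ A, AM G x y else 0 := by
      intro x
      split_ifs
      · simp [Finset.sum_ite_mem]
      · simp
    simp only [this]
    simp [Finset.sum_ite_mem, E2]
  simp only [InS, h1, Finset.sum_add_distrib, Finset.sum_sub_distrib, ← Finset.mul_sum, h2, h3, h4,
    sum_AM]
  ring

/-- Good level. -/
theorem MS.exists_cut {ℓ k : ℕ} {c D C : ℝ} (h : MS G ℓ k c D) (hc : 0 < c) (hD : 4 ≤ c * D)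
    (hC : ∀ v, ((nb G v).card : ℝ) ≤ C * D) (hC1 : 1 ≤ C) :
    ∃ σ, InS G σ ≤ ∑ v, ((nb G v).card : ℝ) -
      2 * (((∑ v, ((nb G v).card : ℝ)) / Fintype.card V) ^ (ℓ + 1)
        - (2 * ℓ * C ^ ℓ + 4 * k) * D ^ ℓ) := by
  have hD0 := h.Dpos hc hD
  have hne := h.ne
  have hN : (0:ℝ) < Fintype.card V := by exact_mod_cast Fintype.card_pos
  have hdeg : ∀ v, 0 < (nb G v).card := fun v => by
    have h1 := h.mindeg v
    have h2 : (0:ℝ) < (nb G v).card := by linarith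
    exact_mod_cast h2
  have h1 := walk_count hdeg ℓ
  obtain ⟨F0, F1⟩ := FM_facts h.ecf hC ℓ le_rfl
  have hA : ∑ v, ∑ w, (AM G ^ (ℓ + 1)) v w ≤ ∑ v, (∑ x ∈ lvl G v ℓ, ((nb G x).card : ℝ) + 2 * ℓ * C ^ ℓ * D ^ ℓ) := by
    refine Finset.sum_le_sum fun v _ => ?_
    rw [← sum_DM_mul_AM]
    have e : AM G ^ (ℓ + 1) = DM G ℓ * AM G + (AM G ^ ℓ - DM G ℓ) * AM G := by
      rw [pow_succ, sub_mul]; abel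
    have F0v := F0 v
    have F1v := F1 v
    rw [e]
    generalize AM G ^ ℓ - DM G ℓ = F at *
    have e0 : ∑ w, (DM G ℓ * AM G + F * AM G) v w = ∑ w, (DM G ℓ * AM G) v w + ∑ w, (F * AM G) v w := by
      rw [← Finset.sum_add_distrib]; rfl
    have e5 : ∑ w, (F * AM G) v w = ∑ x, F v x * (nb G x).card := by
      simp only [← sum_AM, Finset.mul_sum]
      rw [Finset.sum_comm]
      exact Finset.sum_congr rfl fun w _ => Matrix.mul_apply
    rw [e0, e5]
    have e6 : ∑ x, F v x * ((nb G x).card : ℝ) ≤ (∑ x, F v x) * (C * D) := by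
      rw [Finset.sum_mul]
      exact Finset.sum_le_sum fun x _ => mul_le_mul_of_nonneg_left (hC x) (F0v x)
    have e7 : (∑ x, F v x) * (C * D) ≤ 2 * ℓ * (C * D) ^ (ℓ - 1) * (C * D) :=
      mul_le_mul_of_nonneg_right F1v (by positivity)
    have e8 : 2 * ℓ * (C * D) ^ (ℓ - 1) * (C * D) = 2 * ℓ * C ^ ℓ * D ^ ℓ := by
      have : (C * D) ^ ℓ = (C * D) ^ (ℓ - 1) * (C * D) := by
        rw [← pow_succ]; congr 1; have := h.two; omega
      rw [mul_assoc, ← this, mul_pow]; ring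
    linarith
  have hex : ∃ v, ((∑ v, ((nb G v).card : ℝ)) / Fintype.card V) ^ (ℓ + 1) ≤
      ∑ x ∈ lvl G v ℓ, ((nb G x).card : ℝ) + 2 * ℓ * C ^ ℓ * D ^ ℓ := by
    have h3 := h1.trans hA
    obtain ⟨v, -, hv⟩ := Finset.exists_le_of_sum_le (s := Finset.univ)
      (f := fun _ : V => ((∑ v, ((nb G v).card : ℝ)) / Fintype.card V) ^ (ℓ + 1))
      (g := fun v => ∑ x ∈ lvl G v ℓ, ((nb G x).card : ℝ) + 2 * ℓ * C ^ ℓ * D ^ ℓ)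
      Finset.univ_nonempty (by
        rw [Finset.sum_const, Finset.card_univ, nsmul_eq_mul]
        exact h3)
    exact ⟨v, hv⟩
  obtain ⟨v, hv⟩ := hex
  refine ⟨fun x => decide (x ∈ lvl G v ℓ), ?_⟩
  rw [InS_indicator]
  have h4 := few_edges h.ecf h.two h.hk h.nock v
  have h5 : 2 * (k:ℝ) * Fintype.card V ≤ 2 * k * (2 * D ^ ℓ) := by
    have := h.card
    gcongr
  linarith

theorem InS_flip (σ : V → Bool) (x : V) :
    InS G (Function.update σ x (!σ x)) = InS G σ -
      2 * (∑ y, if σ x = σ y then AM G x y else 0) +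
      2 * (∑ y, if σ x = σ y then 0 else AM G x y) := by
  have h1 : ∀ f : V → ℝ, ∑ y, f y = f x + ∑ y ∈ Finset.univ.erase x, f y := fun f =>
    (Finset.add_sum_erase Finset.univ f (Finset.mem_univ x)).symm
  have h2 : ∀ τ : V → Bool, InS G τ = 2 * (∑ y ∈ Finset.univ.erase x, if τ x = τ y then AM G x y else 0)
      + ∑ z ∈ Finset.univ.erase x, ∑ y ∈ Finset.univ.erase x, if τ z = τ y then AM G z y else 0 := by
    intro τ
    rw [InS, h1]
    simp only [h1 (fun y => if τ _ = τ y then AM G _ y else 0), AM_self, Finset.sum_add_distrib]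
    have : ∑ z ∈ Finset.univ.erase x, (if τ z = τ x then AM G z x else 0) =
        ∑ y ∈ Finset.univ.erase x, if τ x = τ y then AM G x y else 0 := by
      refine Finset.sum_congr rfl fun z _ => ?_
      rw [AM_symm z x]
      simp only [eq_comm]
    rw [this]
    simp
    ring
  rw [h2, h2 σ, h1 (fun y => if σ x = σ y then AM G x y else 0),
    h1 (fun y => if σ x = σ y then 0 else AM G x y)]
  have e1 : ∀ y ∈ Finset.univ.erase x, Function.update σ x (!σ x) y = σ y := by
    intro y hy
    exact Function.update_of_ne (Finset.ne_of_mem_erase hy) _ _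
  have e2 : ∑ y ∈ Finset.univ.erase x,
      (if Function.update σ x (!σ x) x = Function.update σ x (!σ x) y then AM G x y else 0) =
      ∑ y ∈ Finset.univ.erase x, if σ x = σ y then 0 else AM G x y := by
    refine Finset.sum_congr rfl fun y hy => ?_
    rw [e1 y hy, Function.update_self]
    cases σ x <;> cases σ y <;> simp
  have e3 : ∑ z ∈ Finset.univ.erase x, ∑ y ∈ Finset.univ.erase x,
      (if Function.update σ x (!σ x) z = Function.update σ x (!σ x) y then AM G z y else 0) =
      ∑ z ∈ Finset.univ.erase x, ∑ y ∈ Finset.univ.erase x, if σ z = σ y then AM G z y else 0 := by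
    refine Finset.sum_congr rfl fun z hz => Finset.sum_congr rfl fun y hy => ?_
    rw [e1 y hy, e1 z hz]
  rw [e2, e3]
  simp [AM_self]
  ring

/-- The consequences, with a good bipartition. -/
structure MS2 (G : SimpleGraph V) (ℓ : ℕ) (D K : ℝ) (σ : V → Bool) : Prop where
  maxdeg : ∀ v, ((nb G v).card : ℝ) ≤ K * D
  ins : InS G σ ≤ K * D ^ ℓ
  loc : ∀ v, ((nb G v).card : ℝ) ≤ 2 * (nb (Bp G σ) v).card
  card : 2 * D ^ ℓ - K * D ^ (ℓ - 1) ≤ Fintype.card V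
  K1 : 1 ≤ K

theorem MS.ms2 (ℓ k : ℕ) (c : ℝ) (hc : 0 < c) : ∃ K D0 : ℝ, 1 ≤ D0 ∧ ∀ (V : Type) [Fintype V]
    [DecidableEq V] (G : SimpleGraph V) (D : ℝ), MS G ℓ k c D → D0 ≤ D → ∃ σ, MS2 G ℓ D K σ := by
  set C : ℝ := max 1 (2 * (2 / c) ^ (ℓ - 1)) with hCdef
  have hC1 : 1 ≤ C := le_max_left _ _
  set K2 : ℝ := 2 * ℓ * C ^ ℓ + 4 * k with hK2
  have hK20 : 0 ≤ K2 := by positivity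
  refine ⟨max C (max (2 * K2) (2 * ℓ * (K2 + 1))), max (max 1 (4 / c)) (K2 + 5), by simp, ?_⟩
  intro V _ _ G D h hD
  simp only [max_le_iff] at hD
  obtain ⟨⟨hD1, hDc⟩, hDK⟩ := hD
  have hD4 : 4 ≤ c * D := by rw [div_le_iff₀ hc] at hDc; linarith
  have hdegC : ∀ v, ((nb G v).card : ℝ) ≤ C * D := fun v => (h.maxdeg hc hD4 v).trans
    (mul_le_mul_of_nonneg_right (le_max_right _ _) (by linarith))
  have hne := h.ne
  have hN : (0:ℝ) < Fintype.card V := by exact_mod_cast Fintype.card_pos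
  obtain ⟨σ0, hσ0⟩ := h.exists_cut hc hD4 hdegC hC1
  obtain ⟨σ, -, hσ⟩ := Finset.exists_min_image (Finset.univ : Finset (V → Bool)) (InS G)
    Finset.univ_nonempty
  have hcut := (hσ σ0 (Finset.mem_univ _)).trans hσ0
  obtain ⟨d, hd⟩ : ∃ d, d = (∑ v, ((nb G v).card : ℝ)) / Fintype.card V := ⟨_, rfl⟩
  have hdN : ∑ v, ((nb G v).card : ℝ) = d * Fintype.card V := by
    rw [hd, div_mul_cancel₀ _ hN.ne']
  have hDd : D ≤ d := by rw [hd, le_div_iff₀ hN]; exact h.avg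
  rw [← hd, ← hK2, hdN] at hcut
  have hpow : D ^ ℓ ≤ d ^ ℓ := pow_le_pow_left₀ (by linarith) hDd ℓ
  have hcard := h.card
  -- Moore
  have hm := moore' (h.ecf.mono (Bp_le σ)) (Bpc G σ) (D := d - K2) (by linarith) (by
    rw [sum_deg_Bp, hdN]
    have e1 : (d - K2) * Fintype.card V ≤ (d - K2) * (2 * d ^ ℓ) :=
      mul_le_mul_of_nonneg_left (by linarith) (by linarith)
    have e2 : K2 * D ^ ℓ ≤ K2 * d ^ ℓ := by gcongr
    have e3 : d ^ (ℓ + 1) = d ^ ℓ * d := pow_succ _ _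
    nlinarith)
  have hm2 : 2 * (d - K2 - 1) ^ ℓ ≤ Fintype.card V := by
    refine le_trans ?_ hm
    gcongr
    refine Finset.single_le_sum (f := fun i => (d - K2 - 1) ^ i) (fun i _ => ?_) (by simp)
    exact pow_nonneg (by linarith) i
  have hm3 : 2 * (D - K2 - 1) ^ ℓ ≤ Fintype.card V := by
    refine le_trans ?_ hm2
    gcongr
    linarith
  refine ⟨σ, ?_, ?_, ?_, ?_, ?_⟩
  · intro v
    exact (hdegC v).trans (mul_le_mul_of_nonneg_right (le_max_left _ _) (by linarith))
  · have : InS G σ ≤ 2 * K2 * D ^ ℓ := by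
      have e1 : d * Fintype.card V ≤ d * (2 * D ^ ℓ) := mul_le_mul_of_nonneg_left hcard (by linarith)
      have e3 : d ^ (ℓ + 1) = d ^ ℓ * d := pow_succ _ _
      have e4 : D ^ ℓ * d ≤ d ^ ℓ * d := mul_le_mul_of_nonneg_right hpow (by linarith)
      linarith
    refine this.trans (mul_le_mul_of_nonneg_right ?_ (by positivity))
    exact (le_max_left _ _).trans (le_max_right _ _)
  · intro v
    have h1 := hσ (Function.update σ v (!σ v)) (Finset.mem_univ _)
    rw [InS_flip] at h1
    have h2 : ((nb (Bp G σ) v).card : ℝ) = ∑ y, if σ v = σ y then 0 else AM G v y := by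
      rw [← sum_AM]
      refine Finset.sum_congr rfl fun y _ => ?_
      rw [AM_Bp]
      split_ifs <;> simp
    have h3 : ((nb G v).card : ℝ) = (∑ y, if σ v = σ y then AM G v y else 0) +
        ∑ y, if σ v = σ y then 0 else AM G v y := by
      rw [← sum_AM, ← Finset.sum_add_distrib]
      refine Finset.sum_congr rfl fun y _ => ?_
      split_ifs <;> simp
    linarith
  · refine le_trans ?_ hm3
    have hb := one_add_mul_le_pow (a := -((K2 + 1) / D)) (by
      have : (K2 + 1) / D ≤ 1 := by rw [div_le_one (by linarith)]; linarith
      linarith) ℓ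
    have e1 : (D - K2 - 1) ^ ℓ = D ^ ℓ * (1 + -((K2 + 1) / D)) ^ ℓ := by
      rw [← mul_pow]; congr 1
      have : D ≠ 0 := by linarith
      field_simp; ring
    have e2 : D ^ ℓ = D ^ (ℓ - 1) * D := by
      rw [← pow_succ]; congr 1; have := h.two; omega
    have e3 : D ^ ℓ * (1 + ℓ * -((K2 + 1) / D)) = D ^ ℓ - ℓ * (K2 + 1) * D ^ (ℓ - 1) := by
      rw [e2]
      have : D ≠ 0 := by linarith
      field_simp
      ring
    have e4 := mul_le_mul_of_nonneg_left hb (by positivity : 0 ≤ D ^ ℓ)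
    rw [e3] at e4
    rw [e1]
    have e5 : 2 * ℓ * (K2 + 1) * D ^ (ℓ - 1) ≤
        max C (max (2 * K2) (2 * ℓ * (K2 + 1))) * D ^ (ℓ - 1) :=
      mul_le_mul_of_nonneg_right ((le_max_right _ _).trans (le_max_right _ _)) (by positivity)
    linarith
  · exact hC1.trans (le_max_left _ _)
end

open SimpleGraph

theorem schur {V : Type*} [Fintype V] (F : V → V → ℝ) (h0 : ∀ u w, 0 ≤ F u w)
    (hs : ∀ u w, F u w = F w u) {ρ : ℝ} (hρ : ∀ u, ∑ w, F u w ≤ ρ) (g : V → ℝ) :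
    ∑ u, (∑ w, F u w * g w) ^ 2 ≤ ρ ^ 2 * ∑ w, g w ^ 2 := by
  rcases isEmpty_or_nonempty V with hV | ⟨⟨v⟩⟩
  · simp
  have hρ0 : 0 ≤ ρ := le_trans (Finset.sum_nonneg fun w _ => h0 v w) (hρ v)
  have h1 : ∀ u, (∑ w, F u w * g w) ^ 2 ≤ ρ * ∑ w, F u w * g w ^ 2 := by
    intro u
    have := Finset.sum_mul_sq_le_sq_mul_sq Finset.univ (fun w => Real.sqrt (F u w))
      (fun w => Real.sqrt (F u w) * g w)
    have e1 : ∀ w, Real.sqrt (F u w) * (Real.sqrt (F u w) * g w) = F u w * g w := by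
      intro w
      rw [← mul_assoc, Real.mul_self_sqrt (h0 u w)]
    have e2 : ∀ w, (Real.sqrt (F u w) * g w) ^ 2 = F u w * g w ^ 2 := by
      intro w
      rw [mul_pow, Real.sq_sqrt (h0 u w)]
    have e3 : ∀ w, Real.sqrt (F u w) ^ 2 = F u w := fun w => Real.sq_sqrt (h0 u w)
    simp only [e1, e2, e3] at this
    refine this.trans (mul_le_mul_of_nonneg_right (hρ u) ?_)
    exact Finset.sum_nonneg fun w _ => mul_nonneg (h0 u w) (sq_nonneg _)
  calc _ ≤ ∑ u, ρ * ∑ w, F u w * g w ^ 2 := Finset.sum_le_sum fun u _ => h1 u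
    _ = ρ * ∑ w, (∑ u, F w u) * g w ^ 2 := by
      rw [← Finset.mul_sum, Finset.sum_comm]
      congr 1
      refine Finset.sum_congr rfl fun w _ => ?_
      rw [Finset.sum_mul]
      exact Finset.sum_congr rfl fun u _ => by rw [hs]
    _ ≤ ρ * ∑ w, ρ * g w ^ 2 := by
      gcongr with w _
      exact hρ w
    _ = _ := by rw [← Finset.mul_sum]; ring

theorem frob {V : Type*} [Fintype V] (F : V → V → ℝ) (g : V → ℝ) :
    ∑ u, (∑ w, F u w * g w) ^ 2 ≤ (∑ u, ∑ w, F u w ^ 2) * ∑ w, g w ^ 2 := by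
  rw [Finset.sum_mul]
  exact Finset.sum_le_sum fun u _ => Finset.sum_mul_sq_le_sq_mul_sq _ _ _

theorem logconvex (a : ℕ → ℝ) (h0 : ∀ j, 0 ≤ a j) (h : ∀ j, a (j+1) ^ 2 ≤ a j * a (j + 2)) (n : ℕ) :
    a 1 ^ (n + 1) ≤ a 0 ^ n * a (n + 1) := by
  have r : ∀ n, a n * a 1 ≤ a 0 * a (n + 1) := by
    intro n
    induction n with
    | zero => simp
    | succ n ih =>
      by_cases hn : a n = 0
      · have := h n
        rw [hn, zero_mul] at this
        have h1 : a (n+1) = 0 := by nlinarith [sq_nonneg (a (n+1))]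
        rw [h1, zero_mul]
        exact mul_nonneg (h0 _) (h0 _)
      · have hp : 0 < a n := lt_of_le_of_ne (h0 n) (Ne.symm hn)
        have h1 := mul_le_mul_of_nonneg_left ih (h0 (n+1))
        have h2 := mul_le_mul_of_nonneg_left (h n) (h0 0)
        have h3 : a n * (a (n+1) * a 1) ≤ a n * (a 0 * a (n + 1 + 1)) := by linarith
        exact le_of_mul_le_mul_left h3 hp
  induction n with
  | zero => simp
  | succ n ih =>
    calc a 1 ^ (n + 1 + 1) = a 1 ^ (n+1) * a 1 := pow_succ _ _
      _ ≤ a 0 ^ n * a (n+1) * a 1 := mul_le_mul_of_nonneg_right ih (h0 1)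
      _ = a 0 ^ n * (a (n+1) * a 1) := by ring
      _ ≤ a 0 ^ n * (a 0 * a (n+1+1)) := mul_le_mul_of_nonneg_left (r (n+1)) (pow_nonneg (h0 0) _)
      _ = _ := by ring

section
set_option linter.unusedSectionVars false
set_option linter.unusedDecidableInType false
variable {V : Type*} [Fintype V] [DecidableEq V] {G : SimpleGraph V}

/-- Apply the adjacency operator. -/
noncomputable def Aop (G : SimpleGraph V) (g : V → ℝ) : V → ℝ := fun u => ∑ w, AM G u w * g w

theorem Aop_adj (f g : V → ℝ) : ∑ u, f u * Aop G g u = ∑ u, Aop G f u * g u := by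
  simp only [Aop, Finset.mul_sum, Finset.sum_mul]
  rw [Finset.sum_comm]
  refine Finset.sum_congr rfl fun u _ => Finset.sum_congr rfl fun w _ => ?_
  rw [AM_symm]; ring

theorem Aop_pow (g : V → ℝ) (j : ℕ) (u : V) : (Aop G)^[j] g u = ∑ w, (AM G ^ j) u w * g w := by
  induction j generalizing u with
  | zero => simp [Matrix.one_apply]
  | succ j ih =>
    rw [Function.iterate_succ_apply', Aop]
    simp only [ih, pow_succ', Finset.mul_sum]
    rw [Finset.sum_comm]
    refine Finset.sum_congr rfl fun w _ => ?_
    have : (AM G * AM G ^ j) u w = ∑ x, AM G u x * (AM G ^ j) x w := Matrix.mul_apply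
    rw [this, Finset.sum_mul]
    exact Finset.sum_congr rfl fun x _ => by ring

theorem spec_aux (g : V → ℝ) (n : ℕ) :
    (∑ u, Aop G g u ^ 2) ^ (n + 1) ≤ (∑ u, g u ^ 2) ^ n *
      ∑ u, (∑ w, (AM G ^ (n+1)) u w * g w) ^ 2 := by
  have := logconvex (fun j => ∑ u, (Aop G)^[j] g u ^ 2)
    (fun j => Finset.sum_nonneg fun u _ => sq_nonneg _) (fun j => by
      have e : ∑ u, (Aop G)^[j+1] g u ^ 2 = ∑ u, (Aop G)^[j] g u * (Aop G)^[j+2] g u := by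
        rw [show (Aop G)^[j+2] g = Aop G ((Aop G)^[j+1] g) from Function.iterate_succ_apply' _ _ _]
        rw [Aop_adj, ← Function.iterate_succ_apply' (Aop G) j g]
        exact Finset.sum_congr rfl fun u _ => by ring
      simp only [e]
      exact Finset.sum_mul_sq_le_sq_mul_sq _ _ _) n
  simpa only [Aop_pow g (n+1), Function.iterate_one, Function.iterate_zero, id] using this

/-- wrong parity indicator -/
noncomputable def bad (σ : V → Bool) (i : ℕ) (u w : V) : ℝ :=
  if (σ u = σ w ↔ Even i) then 0 else 1

theorem bad_nonneg (σ : V → Bool) (i : ℕ) (u w : V) : 0 ≤ bad σ i u w := by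
  unfold bad; split_ifs <;> norm_num

theorem bad_succ (σ : V → Bool) (i : ℕ) (u x w : V) :
    bad σ (i+1) u w ≤ bad σ i u x + if σ x = σ w then 1 else 0 := by
  unfold bad
  by_cases h : Even i <;> cases σ u <;> cases σ x <;> cases σ w <;> simp [h, Nat.even_add_one]

theorem wrong_bound {ℓ : ℕ} (hG : EvenCycleFree G ℓ) {Δ : ℝ} (hΔ0 : 0 ≤ Δ)
    (hΔ : ∀ x, ((nb G x).card : ℝ) ≤ Δ)
    (σ : V → Bool) : ∀ i ≤ ℓ, ∑ u, ∑ w, DM G i u w * bad σ i u w ≤ i * Δ ^ (i - 1) * InS G σ := by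
  have hI : 0 ≤ InS G σ := Finset.sum_nonneg fun x _ => Finset.sum_nonneg fun y _ => by
    split_ifs
    · exact AM_nonneg _ _
    · exact le_rfl
  intro i
  induction i with
  | zero =>
    intro _
    refine le_of_eq ?_
    simp only [Nat.cast_zero, zero_mul]
    refine Finset.sum_eq_zero fun u _ => Finset.sum_eq_zero fun w _ => ?_
    by_cases h : u = w
    · subst h; simp [bad]
    · simp [DM, h]
  | succ i ih =>
    intro hi
    have hle : ∀ u w, DM G (i+1) u w ≤ ∑ x, DM G i u x * AM G x w := by
      intro u w
      have := EM_nonneg hG hi u w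
      rw [EM, Matrix.sub_apply, Matrix.mul_apply] at this
      linarith
    have h1 : ∀ u w, DM G (i+1) u w * bad σ (i+1) u w ≤
        ∑ x, (DM G i u x * bad σ i u x * AM G x w +
          DM G i u x * (if σ x = σ w then AM G x w else 0)) := by
      intro u w
      refine (mul_le_mul_of_nonneg_right (hle u w) (bad_nonneg _ _ _ _)).trans ?_
      rw [Finset.sum_mul]
      refine Finset.sum_le_sum fun x _ => ?_
      have h2 := mul_le_mul_of_nonneg_left (bad_succ σ i u x w)
        (mul_nonneg (DM_nonneg (G := G) i u x) (AM_nonneg (G := G) x w))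
      refine h2.trans (le_of_eq ?_)
      split_ifs <;> ring
    have h3 : ∑ u, ∑ w, ∑ x, DM G i u x * bad σ i u x * AM G x w ≤
        Δ * ∑ u, ∑ w, DM G i u w * bad σ i u w := by
      rw [Finset.mul_sum]
      refine Finset.sum_le_sum fun u _ => ?_
      rw [Finset.sum_comm, Finset.mul_sum]
      refine Finset.sum_le_sum fun x _ => ?_
      rw [← Finset.mul_sum, sum_AM, mul_comm]
      exact mul_le_mul_of_nonneg_right (hΔ x) (mul_nonneg (DM_nonneg _ _ _) (bad_nonneg _ _ _ _))
    have h4 : ∑ u, ∑ w, ∑ x, DM G i u x * (if σ x = σ w then AM G x w else 0) ≤ Δ ^ i * InS G σ := by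
      have : ∑ u, ∑ w, ∑ x, DM G i u x * (if σ x = σ w then AM G x w else 0) =
          ∑ x, (∑ u, DM G i x u) * ∑ w, (if σ x = σ w then AM G x w else 0) := by
        have e : ∀ u, ∑ w, ∑ x, DM G i u x * (if σ x = σ w then AM G x w else 0) =
            ∑ x, DM G i u x * ∑ w, (if σ x = σ w then AM G x w else 0) := by
          intro u
          rw [Finset.sum_comm]
          exact Finset.sum_congr rfl fun x _ => by rw [Finset.mul_sum]
        simp only [e]
        rw [Finset.sum_comm]
        refine Finset.sum_congr rfl fun x _ => ?_
        rw [Finset.sum_mul]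
        exact Finset.sum_congr rfl fun u _ => by rw [DM_symm]
      rw [this, InS, Finset.mul_sum]
      refine Finset.sum_le_sum fun x _ => ?_
      rw [sum_DM]
      refine mul_le_mul_of_nonneg_right (lvl_card_le hG hΔ x i (by omega)) ?_
      refine Finset.sum_nonneg fun y _ => ?_
      split_ifs
      · exact AM_nonneg _ _
      · exact le_rfl
    have h5 : ∑ u, ∑ w, DM G (i+1) u w * bad σ (i+1) u w ≤
        Δ * ∑ u, ∑ w, DM G i u w * bad σ i u w + Δ ^ i * InS G σ := by
      refine (Finset.sum_le_sum fun u _ => Finset.sum_le_sum fun w _ => h1 u w).trans ?_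
      simp only [Finset.sum_add_distrib]
      exact add_le_add h3 h4
    have h6 := mul_le_mul_of_nonneg_left (ih (by omega)) hΔ0
    have h7 : Δ * (i * Δ ^ (i - 1) * InS G σ) = i * Δ ^ i * InS G σ := by
      rcases i with _ | i
      · simp
      · simp only [Nat.add_sub_cancel]; ring
    rw [h7] at h6
    simp only [Nat.add_sub_cancel]
    push_cast
    linarith

theorem frob_expand (σ : V → Bool) (ℓ : ℕ) :
    ∑ u, ∑ w, ((1 - bad σ ℓ u w) - DM G ℓ u w) ^ 2 = ∑ u, ∑ w, (1 - bad σ ℓ u w)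
      - ∑ u, ∑ w, DM G ℓ u w + 2 * ∑ u, ∑ w, DM G ℓ u w * bad σ ℓ u w := by
  simp only [Finset.mul_sum, ← Finset.sum_sub_distrib, ← Finset.sum_add_distrib]
  refine Finset.sum_congr rfl fun u _ => Finset.sum_congr rfl fun w _ => ?_
  have h1 : bad σ ℓ u w = 0 ∨ bad σ ℓ u w = 1 := by unfold bad; split_ifs <;> simp
  have h2 : DM G ℓ u w = 0 ∨ DM G ℓ u w = 1 := by unfold DM; split_ifs <;> simp
  rcases h1 with h1 | h1 <;> rcases h2 with h2 | h2 <;> rw [h1, h2] <;> norm_num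

theorem sum_J (σ : V → Bool) (ℓ : ℕ) :
    ∑ u, ∑ w, (1 - bad σ ℓ u w) =
      if Even ℓ then ((Finset.univ.filter (fun x => σ x = true)).card : ℝ) ^ 2
          + ((Finset.univ.filter (fun x => σ x = false)).card : ℝ) ^ 2
      else 2 * ((Finset.univ.filter (fun x => σ x = true)).card : ℝ)
          * (Finset.univ.filter (fun x => σ x = false)).card := by
  have h1 : ∀ f : V → ℝ, ∑ x, f x = ∑ x ∈ Finset.univ.filter (fun x => σ x = true), f x +
      ∑ x ∈ Finset.univ.filter (fun x => σ x = false), f x := by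
    intro f
    rw [← Finset.sum_filter_add_sum_filter_not Finset.univ (fun x => σ x = true)]
    simp
  have h2 : ∀ a b : Bool, ∑ u ∈ Finset.univ.filter (fun x => σ x = a),
      ∑ w ∈ Finset.univ.filter (fun x => σ x = b), (1 - bad σ ℓ u w) =
      (Finset.univ.filter (fun x => σ x = a)).card * (Finset.univ.filter (fun x => σ x = b)).card *
      (1 - if (a = b ↔ Even ℓ) then 0 else 1) := by
    intro a b
    have : ∀ u ∈ Finset.univ.filter (fun x => σ x = a), ∀ w ∈ Finset.univ.filter (fun x => σ x = b),
        (1 - bad σ ℓ u w) = (1 - if (a = b ↔ Even ℓ) then 0 else 1) := by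
      intro u hu w hw
      simp only [Finset.mem_filter, Finset.mem_univ, true_and] at hu hw
      rw [bad, hu, hw]
    rw [Finset.sum_congr rfl fun u hu => Finset.sum_congr rfl fun w hw => this u hu w hw]
    simp only [Finset.sum_const, nsmul_eq_mul]
    ring
  rw [h1]
  simp only [h1 (fun w => 1 - bad σ ℓ _ w), Finset.sum_add_distrib, h2]
  by_cases h : Even ℓ <;> simp [h] <;> ring
end

open SimpleGraph

section
set_option linter.unusedSectionVars false
set_option linter.unusedDecidableInType false
variable {V : Type*} [Fintype V] [DecidableEq V] {G : SimpleGraph V}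

/-- A side of the bipartition. -/
def side (σ : V → Bool) (b : Bool) : Finset V := Finset.univ.filter (fun x => σ x = b)

theorem mem_side {σ : V → Bool} {b : Bool} {x : V} : x ∈ side σ b ↔ σ x = b := by simp [side]

theorem sum_side (σ : V → Bool) (f : V → ℝ) :
    ∑ x, f x = ∑ x ∈ side σ true, f x + ∑ x ∈ side σ false, f x := by
  rw [← Finset.sum_filter_add_sum_filter_not Finset.univ (fun x => σ x = true)]
  simp [side]

theorem card_side (σ : V → Bool) :
    (Fintype.card V : ℝ) = (side σ true).card + (side σ false).card := by
  have := sum_side σ (fun _ => (1:ℝ))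
  simpa using this

theorem AM_Bp_same {σ : V → Bool} {x y : V} (h : σ x = σ y) : AM (Bp G σ) x y = 0 := by
  rw [AM_Bp, if_pos h]; ring

theorem deg_Bp_le (σ : V → Bool) (v : V) : (nb (Bp G σ) v).card ≤ (nb G v).card := by
  refine Finset.card_le_card fun x hx => ?_
  rw [mem_nb] at *
  exact hx.1

theorem side_lvl {σ : V → Bool} : ∀ (i : ℕ) {v w : V}, w ∈ lvl (Bp G σ) v i → (σ v = σ w ↔ Even i) := by
  intro i
  induction i with
  | zero =>
    intro v w h
    rw [lvl_zero, Finset.mem_singleton] at h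
    simp [h]
  | succ i ih =>
    intro v w h
    obtain ⟨x, hx, hxw⟩ := exists_parent (mem_lvl.1 h)
    have := ih (mem_lvl.2 hx)
    have h2 := hxw.2
    rw [Nat.even_add_one, ← this]
    revert h2
    cases σ v <;> cases σ x <;> cases σ w <;> simp

theorem deg_sum_side (σ : V → Bool) (b : Bool) :
    ∑ x ∈ side σ b, ((nb (Bp G σ) x).card : ℝ) = (∑ v, ((nb G v).card : ℝ) - InS G σ) / 2 := by
  have h1 : ∀ b, ∑ x ∈ side σ b, ((nb (Bp G σ) x).card : ℝ) =
      ∑ x ∈ side σ b, ∑ y ∈ side σ (!b), AM (Bp G σ) x y := by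
    intro b
    refine Finset.sum_congr rfl fun x hx => ?_
    rw [← sum_AM, sum_side σ]
    have : ∑ y ∈ side σ b, AM (Bp G σ) x y = 0 := Finset.sum_eq_zero fun y hy => by
      rw [mem_side] at hx hy
      exact AM_Bp_same (hx.trans hy.symm)
    cases b <;> simp [this]
  have h2 : ∑ x ∈ side σ true, ((nb (Bp G σ) x).card : ℝ) =
      ∑ x ∈ side σ false, ((nb (Bp G σ) x).card : ℝ) := by
    rw [h1, h1]
    refine (Finset.sum_comm (s := side σ true) (t := side σ false)
      (f := fun x y => AM (Bp G σ) x y)).trans ?_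
    exact Finset.sum_congr rfl fun y _ => Finset.sum_congr rfl fun x _ => AM_symm _ _
  have h3 := sum_deg_Bp (G := G) σ
  rw [sum_side σ] at h3
  cases b <;> linarith

theorem deg_sq_side {ℓ : ℕ} (hG : EvenCycleFree G ℓ) (h2 : 2 ≤ ℓ) {Δ : ℝ}
    (hΔ : ∀ x, ((nb G x).card : ℝ) ≤ Δ) (σ : V → Bool) (b : Bool) :
    ∑ y ∈ side σ (!b), ((nb (Bp G σ) y).card : ℝ) ^ 2 ≤
      (side σ b).card * ((side σ b).card + 2 * Δ) := by
  have hH := hG.mono (Bp_le (G := G) σ)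
  have h1 : ∑ y ∈ side σ (!b), ((nb (Bp G σ) y).card : ℝ) ^ 2 =
      ∑ x ∈ side σ b, ∑ y ∈ nb (Bp G σ) x, ((nb (Bp G σ) y).card : ℝ) := by
    have e1 : ∀ x ∈ side σ b, ∑ y ∈ nb (Bp G σ) x, ((nb (Bp G σ) y).card : ℝ) =
        ∑ y ∈ side σ (!b), AM (Bp G σ) x y * (nb (Bp G σ) y).card := by
      intro x hx
      have : nb (Bp G σ) x = (side σ (!b)).filter (fun y => y ∈ nb (Bp G σ) x) := by
        ext y
        simp only [Finset.mem_filter, mem_side, mem_nb]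
        refine ⟨fun h => ⟨?_, h⟩, fun h => h.2⟩
        rw [mem_side] at hx
        have := h.2
        rw [hx] at this
        exact Bool.eq_not_of_ne this.symm
      rw [this, Finset.sum_filter]
      refine Finset.sum_congr rfl fun y _ => ?_
      by_cases hy : (Bp G σ).Adj x y <;> simp [AM, mem_nb, hy]
    rw [Finset.sum_congr rfl e1, Finset.sum_comm]
    refine Finset.sum_congr rfl fun y hy => ?_
    rw [← Finset.sum_mul, sq]
    congr 1
    rw [← sum_AM, sum_side σ]
    have : ∑ x ∈ side σ (!b), AM (Bp G σ) y x = 0 := Finset.sum_eq_zero fun x hx => by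
      rw [mem_side] at hx hy
      exact AM_Bp_same (hy.trans hx.symm)
    have e3 : ∑ x ∈ side σ b, AM (Bp G σ) x y = ∑ x ∈ side σ b, AM (Bp G σ) y x :=
      Finset.sum_congr rfl fun x _ => AM_symm _ _
    rw [e3]
    cases b
    · simp only [Bool.not_false] at this; rw [this]; ring
    · simp only [Bool.not_true] at this; rw [this]; ring
  rw [h1]
  have h3 : ∀ x ∈ side σ b, ∑ y ∈ nb (Bp G σ) x, ((nb (Bp G σ) y).card : ℝ) ≤
      (side σ b).card + 2 * Δ := by
    intro x hx
    rw [← lvl_one]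
    refine (sum_nb_le hH (i := 1) (by omega) x).trans ?_
    have e1 : (lvl (Bp G σ) x (1+1)).card ≤ (side σ b).card := by
      refine Finset.card_le_card fun w hw => ?_
      have := (side_lvl _ hw).2 (by decide)
      rw [mem_side] at *
      rw [← this, hx]
    have e2 : ((lvl (Bp G σ) x 1).card : ℝ) ≤ Δ := by
      rw [lvl_one]
      exact le_trans (by exact_mod_cast deg_Bp_le σ x) (hΔ x)
    have e3 : ((lvl (Bp G σ) x (1+1)).card : ℝ) ≤ (side σ b).card := by exact_mod_cast e1
    linarith
  refine (Finset.sum_le_sum h3).trans (le_of_eq ?_)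
  rw [Finset.sum_const, nsmul_eq_mul]

theorem balance {k : ℕ} {c D K : ℝ} {σ : V → Bool} (h : MS G 2 k c D) (h2 : MS2 G 2 D K σ)
    (hD : K ≤ D) (hD1 : 1 ≤ D) :
    (((side σ true).card : ℝ) - (side σ false).card) ^ 2 ≤ 12 * K * D ^ 3 := by
  have q1 := deg_sq_side h.ecf le_rfl h2.maxdeg σ true
  have q2 := deg_sq_side h.ecf le_rfl h2.maxdeg σ false
  have s1 := deg_sum_side (G := G) σ true
  have s2 := deg_sum_side (G := G) σ false
  have c1 := Finset.sum_mul_sq_le_sq_mul_sq (side σ true) (fun _ => (1:ℝ))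
    (fun x => ((nb (Bp G σ) x).card : ℝ))
  have c2 := Finset.sum_mul_sq_le_sq_mul_sq (side σ false) (fun _ => (1:ℝ))
    (fun x => ((nb (Bp G σ) x).card : ℝ))
  have hN := card_side σ
  have hK := h2.K1
  have hc := h2.card
  have hc' := h.card
  have ha := h.avg
  have hi := h2.ins
  simp only [Bool.not_true, Bool.not_false] at q1 q2
  simp only [one_mul, one_pow, Finset.sum_const, nsmul_eq_mul, mul_one] at c1 c2
  rw [s1] at c1
  rw [s2] at c2
  have ha0 : (0:ℝ) ≤ (side σ true).card := Nat.cast_nonneg _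
  have hb0 : (0:ℝ) ≤ (side σ false).card := Nat.cast_nonneg _
  generalize ((side σ true).card : ℝ) = a at *
  generalize ((side σ false).card : ℝ) = b at *
  generalize (Fintype.card V : ℝ) = N at *
  generalize ∑ x ∈ side σ true, ((nb (Bp G σ) x).card : ℝ) ^ 2 = X2 at *
  generalize ∑ x ∈ side σ false, ((nb (Bp G σ) x).card : ℝ) ^ 2 = Y2 at *
  obtain ⟨e, he⟩ : ∃ e, e = (∑ v, ((nb G v).card : ℝ) - InS G σ) / 2 := ⟨_, rfl⟩
  rw [← he] at c1 c2
  have he1 : D * (N - K * D) ≤ 2 * e := by rw [he]; nlinarith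
  have hp1 : D ^ (2 - 1) = D := by norm_num
  rw [hp1] at hc
  have hNK : 0 ≤ N - K * D := by nlinarith
  have e1 : e ^ 2 ≤ a * (b * (b + 2 * (K * D))) := c1.trans (mul_le_mul_of_nonneg_left q2 ha0)
  have e2 : e ^ 2 ≤ b * (a * (a + 2 * (K * D))) := c2.trans (mul_le_mul_of_nonneg_left q1 hb0)
  have e3 : 2 * e ^ 2 ≤ a * b * (N + 4 * (K * D)) := by rw [hN]; nlinarith
  have e4 : (D * (N - K * D)) ^ 2 ≤ (2 * e) ^ 2 :=
    pow_le_pow_left₀ (mul_nonneg (by linarith) hNK) he1 2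
  obtain ⟨t, ht⟩ : ∃ t, t = K * D := ⟨_, rfl⟩
  rw [← ht] at hNK e1 e2 e3 e4
  have ht0 : 0 ≤ t := by rw [ht]; nlinarith
  have hN0 : 0 ≤ N := by linarith
  have e5 : N / 2 * (N - t) ^ 2 ≤ 2 * (a * b * (N + 4 * t)) := by
    have : N / 2 * (N - t) ^ 2 ≤ D ^ 2 * (N - t) ^ 2 :=
      mul_le_mul_of_nonneg_right (by linarith) (sq_nonneg _)
    nlinarith
  have e6 : 4 * (a * b) ≤ N ^ 2 := by rw [hN]; nlinarith [sq_nonneg (a - b)]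
  have e7 : N * (N ^ 2 - 6 * t * N) ≤ N * (4 * (a * b)) := by
    nlinarith [mul_le_mul_of_nonneg_right e6 ht0, mul_nonneg hN0 (sq_nonneg t)]
  have hNpos : 0 < N := by nlinarith
  have e8 := le_of_mul_le_mul_left e7 hNpos
  have e9 : (a - b) ^ 2 = N ^ 2 - 4 * (a * b) := by rw [hN]; ring
  rw [e9]
  have : 6 * t * N ≤ 6 * t * (2 * D ^ 2) := mul_le_mul_of_nonneg_left hc' (by linarith)
  have e10 : 6 * t * (2 * D ^ 2) = 12 * K * D ^ 3 := by rw [ht]; ring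
  linarith
end

open SimpleGraph

section
set_option linter.unusedSectionVars false
set_option linter.unusedDecidableInType false
variable {V : Type*} [Fintype V] [DecidableEq V] {G : SimpleGraph V}

theorem sum_DM_ge {ℓ k : ℕ} {c D K : ℝ} {σ : V → Bool} (h : MS G ℓ k c D) (h2 : MS2 G ℓ D K σ)
    (hc : 0 < c) (hD1 : 1 ≤ D) :
    (Fintype.card V : ℝ) ^ 2 / 2 - 4 * ℓ * K ^ (ℓ - 1) * D ^ (2 * ℓ - 1) ≤ ∑ u, ∑ w, DM G ℓ u w := by
  have hne := h.ne
  have hN : (0:ℝ) < Fintype.card V := by exact_mod_cast Fintype.card_pos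
  have hdeg : ∀ v, 0 < (nb G v).card := fun v => by
    have h1 := h.mindeg v
    have : 0 < c * D := by nlinarith
    have h2 : (0:ℝ) < (nb G v).card := by linarith
    exact_mod_cast h2
  have h1 := walk_count hdeg (ℓ - 1)
  have hl := h.two
  have e0 : ℓ - 1 + 1 = ℓ := by omega
  rw [e0] at h1
  obtain ⟨F0, F1⟩ := FM_facts h.ecf h2.maxdeg ℓ le_rfl
  have h3 : ∑ u, ∑ w, (AM G ^ ℓ) u w = ∑ u, ∑ w, DM G ℓ u w + ∑ u, ∑ w, (AM G ^ ℓ - DM G ℓ) u w := by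
    rw [← Finset.sum_add_distrib]
    refine Finset.sum_congr rfl fun u _ => ?_
    rw [← Finset.sum_add_distrib]
    refine Finset.sum_congr rfl fun w _ => ?_
    rw [Matrix.sub_apply]; ring
  have h4 : ∑ u, ∑ w, (AM G ^ ℓ - DM G ℓ) u w ≤ Fintype.card V * (2 * ℓ * (K * D) ^ (ℓ - 1)) := by
    refine (Finset.sum_le_sum fun u _ => F1 u).trans (le_of_eq ?_)
    rw [Finset.sum_const, nsmul_eq_mul, Finset.card_univ]
  have hDd : D ≤ (∑ v, ((nb G v).card : ℝ)) / Fintype.card V := by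
    rw [le_div_iff₀ hN]; exact h.avg
  have h5 : (Fintype.card V : ℝ) * D ^ ℓ ≤ Fintype.card V * ((∑ v, ((nb G v).card : ℝ)) / Fintype.card V) ^ ℓ := by
    gcongr
  have hcard := h.card
  have h6 : (Fintype.card V : ℝ) ^ 2 / 2 ≤ Fintype.card V * D ^ ℓ := by nlinarith
  have h7 : (Fintype.card V : ℝ) * (2 * ℓ * (K * D) ^ (ℓ - 1)) ≤ 4 * ℓ * K ^ (ℓ - 1) * D ^ (2 * ℓ - 1) := by
    have hK := h2.K1
    have : (Fintype.card V : ℝ) * (2 * ℓ * (K * D) ^ (ℓ - 1)) ≤ 2 * D ^ ℓ * (2 * ℓ * (K * D) ^ (ℓ - 1)) :=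
      mul_le_mul_of_nonneg_right hcard (by positivity)
    refine this.trans (le_of_eq ?_)
    have : D ^ (2 * ℓ - 1) = D ^ ℓ * D ^ (ℓ - 1) := by rw [← pow_add]; congr 1; omega
    rw [this, mul_pow]; ring
  linarith

theorem frob_le {ℓ k : ℕ} {c D K : ℝ} {σ : V → Bool} (h : MS G ℓ k c D) (h2 : MS2 G ℓ D K σ)
    (hc : 0 < c) (hD1 : 1 ≤ D) (hDK : K ≤ D) (hl : ℓ = 2 ∨ Odd ℓ) :
    ∑ u, ∑ w, ((1 - bad σ ℓ u w) - DM G ℓ u w) ^ 2 ≤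
      (6 * K + 4 * ℓ * K ^ (ℓ - 1) + 2 * ℓ * K ^ ℓ) * D ^ (2 * ℓ - 1) := by
  have hK := h2.K1
  have hl2 := h.two
  have h1 := sum_DM_ge h h2 hc hD1
  have h3 := wrong_bound h.ecf (Δ := K * D) (by positivity) h2.maxdeg σ ℓ le_rfl
  have h4 : ℓ * (K * D) ^ (ℓ - 1) * InS G σ ≤ ℓ * K ^ ℓ * D ^ (2 * ℓ - 1) := by
    have : ℓ * (K * D) ^ (ℓ - 1) * InS G σ ≤ ℓ * (K * D) ^ (ℓ - 1) * (K * D ^ ℓ) :=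
      mul_le_mul_of_nonneg_left h2.ins (by positivity)
    refine this.trans (le_of_eq ?_)
    have e1 : D ^ (2 * ℓ - 1) = D ^ ℓ * D ^ (ℓ - 1) := by rw [← pow_add]; congr 1; omega
    have e2 : K ^ ℓ = K ^ (ℓ - 1) * K := by rw [← pow_succ]; congr 1; omega
    rw [e1, e2, mul_pow]; ring
  have h5 : ∑ u, ∑ w, (1 - bad σ ℓ u w) ≤ (Fintype.card V : ℝ) ^ 2 / 2 + 6 * K * D ^ (2 * ℓ - 1) := by
    rw [sum_J]
    have hN := card_side σ
    rw [hN]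
    change (if Even ℓ then ((side σ true).card : ℝ) ^ 2 + ((side σ false).card : ℝ) ^ 2
      else 2 * ((side σ true).card : ℝ) * (side σ false).card) ≤ _
    rcases hl with rfl | hodd
    · have := balance h h2 hDK hD1
      rw [if_pos (by decide)]
      have e : D ^ (2 * 2 - 1) = D ^ 3 := by norm_num
      rw [e]
      nlinarith
    · rw [if_neg (by rwa [Nat.not_even_iff_odd])]
      have : 0 ≤ 6 * K * D ^ (2 * ℓ - 1) := by positivity
      nlinarith [sq_nonneg (((side σ true).card : ℝ) - (side σ false).card)]
  rw [frob_expand]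
  linarith

theorem spectral {ℓ k : ℕ} {c D K : ℝ} {σ : V → Bool} (h : MS G ℓ k c D) (h2 : MS2 G ℓ D K σ)
    (hc : 0 < c) (hD1 : 1 ≤ D) (hDK : K ≤ D) (hl : ℓ = 2 ∨ Odd ℓ) (g : V → ℝ)
    (hg : ∀ b, ∑ x ∈ side σ b, g x = 0) :
    ∑ u, (∑ w, (AM G ^ ℓ) u w * g w) ^ 2 ≤
      2 * ((2 * ℓ * K ^ (ℓ - 1)) ^ 2 + (6 * K + 4 * ℓ * K ^ (ℓ - 1) + 2 * ℓ * K ^ ℓ)) *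
        D ^ (2 * ℓ - 1) * ∑ w, g w ^ 2 := by
  have hK := h2.K1
  have hl2 := h.two
  obtain ⟨F0, F1⟩ := FM_facts h.ecf h2.maxdeg ℓ le_rfl
  have hJ : ∀ u, ∑ w, (1 - bad σ ℓ u w) * g w = 0 := by
    intro u
    rw [sum_side σ]
    have : ∀ b, ∑ x ∈ side σ b, (1 - bad σ ℓ u x) * g x = 0 := by
      intro b
      have e : ∀ x ∈ side σ b, (1 - bad σ ℓ u x) * g x =
          (1 - if (σ u = b ↔ Even ℓ) then 0 else 1) * g x := by
        intro x hx
        rw [mem_side] at hx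
        rw [bad, hx]
      rw [Finset.sum_congr rfl e, ← Finset.mul_sum, hg, mul_zero]
    rw [this, this, add_zero]
  have e1 : ∀ u, ∑ w, (AM G ^ ℓ) u w * g w = ∑ w, (AM G ^ ℓ - DM G ℓ) u w * g w
      - ∑ w, ((1 - bad σ ℓ u w) - DM G ℓ u w) * g w := by
    intro u
    have := hJ u
    have e : ∑ w, (AM G ^ ℓ) u w * g w = ∑ w, (AM G ^ ℓ - DM G ℓ) u w * g w
      - ∑ w, ((1 - bad σ ℓ u w) - DM G ℓ u w) * g w + ∑ w, (1 - bad σ ℓ u w) * g w := by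
      rw [← Finset.sum_sub_distrib, ← Finset.sum_add_distrib]
      refine Finset.sum_congr rfl fun w _ => ?_
      rw [Matrix.sub_apply]; ring
    rw [e, this, add_zero]
  have hs := schur (fun u w => (AM G ^ ℓ - DM G ℓ) u w) F0 (fun u w => by
    have t1 : (AM G).transpose = AM G := by ext i j; exact AM_symm _ _
    have t2 : (AM G ^ ℓ).transpose = AM G ^ ℓ := by rw [Matrix.transpose_pow, t1]
    have t3 : (AM G ^ ℓ) u w = (AM G ^ ℓ) w u := by
      conv_lhs => rw [← t2]
      rfl
    change (AM G ^ ℓ - DM G ℓ) u w = (AM G ^ ℓ - DM G ℓ) w u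
    rw [Matrix.sub_apply, Matrix.sub_apply, t3, DM_symm]) F1 g
  have hf := frob (fun u w => (1 - bad σ ℓ u w) - DM G ℓ u w) g
  have hg0 : 0 ≤ ∑ w, g w ^ 2 := Finset.sum_nonneg fun w _ => sq_nonneg _
  have hf2 := hf.trans (mul_le_mul_of_nonneg_right (frob_le h h2 hc hD1 hDK hl) hg0)
  have h5 : ∑ u, (∑ w, (AM G ^ ℓ) u w * g w) ^ 2 ≤
      2 * ∑ u, (∑ w, (AM G ^ ℓ - DM G ℓ) u w * g w) ^ 2 +
      2 * ∑ u, (∑ w, ((1 - bad σ ℓ u w) - DM G ℓ u w) * g w) ^ 2 := by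
    rw [Finset.mul_sum, Finset.mul_sum, ← Finset.sum_add_distrib]
    refine Finset.sum_le_sum fun u _ => ?_
    rw [e1]
    generalize ∑ w, (AM G ^ ℓ - DM G ℓ) u w * g w = x
    generalize ∑ w, ((1 - bad σ ℓ u w) - DM G ℓ u w) * g w = y
    nlinarith [sq_nonneg (x + y)]
  have h6 : (2 * ℓ * (K * D) ^ (ℓ - 1)) ^ 2 ≤ (2 * ℓ * K ^ (ℓ - 1)) ^ 2 * D ^ (2 * ℓ - 1) := by
    have : (2 * ℓ * (K * D) ^ (ℓ - 1)) ^ 2 = (2 * ℓ * K ^ (ℓ - 1)) ^ 2 * D ^ ((ℓ - 1) * 2) := by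
      rw [mul_pow K D, pow_mul]; ring
    rw [this]
    exact mul_le_mul_of_nonneg_left (pow_le_pow_right₀ hD1 (by omega)) (sq_nonneg _)
  have h7 := mul_le_mul_of_nonneg_right h6 hg0
  linarith

theorem spectral2 (ℓ : ℕ) (K η : ℝ) (hη : 0 < η) : ∃ D0 : ℝ, 1 ≤ D0 ∧ ∀ {V : Type} [Fintype V]
    [DecidableEq V] {G : SimpleGraph V} {k : ℕ} {c D : ℝ} {σ : V → Bool}, MS G ℓ k c D →
    MS2 G ℓ D K σ → 0 < c → D0 ≤ D → (ℓ = 2 ∨ Odd ℓ) → ∀ g : V → ℝ,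
    (∀ b, ∑ x ∈ side σ b, g x = 0) → ∑ u, Aop G g u ^ 2 ≤ η ^ 2 * D ^ 2 * ∑ w, g w ^ 2 := by
  obtain ⟨K3, hK3⟩ : ∃ K3, K3 = 2 * ((2 * ℓ * K ^ (ℓ - 1)) ^ 2 + (6 * K + 4 * ℓ * K ^ (ℓ - 1) + 2 * ℓ * K ^ ℓ)) := ⟨_, rfl⟩
  refine ⟨max (max 1 K) (K3 / η ^ (2 * ℓ)), by simp, ?_⟩
  intro V _ _ G k c D σ h h2 hc hD hl g hg
  simp only [max_le_iff] at hD
  obtain ⟨⟨hD1, hDK⟩, hD3⟩ := hD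
  have hs := spectral h h2 hc hD1 hDK hl g hg
  rw [← hK3] at hs
  have hl2 := h.two
  have hsp := spec_aux (G := G) g (ℓ - 1)
  have e0 : ℓ - 1 + 1 = ℓ := by omega
  rw [e0] at hsp
  have hg0 : 0 ≤ ∑ w, g w ^ 2 := Finset.sum_nonneg fun w _ => sq_nonneg _
  have ha0 : 0 ≤ ∑ u, Aop G g u ^ 2 := Finset.sum_nonneg fun w _ => sq_nonneg _
  rw [div_le_iff₀ (by positivity)] at hD3
  generalize ∑ u, Aop G g u ^ 2 = a at *
  generalize ∑ u, g u ^ 2 = b at *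
  have h5 : a ^ ℓ ≤ (η ^ 2 * D ^ 2 * b) ^ ℓ := by
    calc a ^ ℓ ≤ b ^ (ℓ - 1) * (K3 * D ^ (2 * ℓ - 1) * b) :=
          hsp.trans (mul_le_mul_of_nonneg_left hs (pow_nonneg hg0 _))
      _ ≤ b ^ (ℓ - 1) * (D * η ^ (2 * ℓ) * D ^ (2 * ℓ - 1) * b) := by gcongr
      _ = b ^ (ℓ - 1) * b * (D ^ (2 * ℓ - 1) * D) * η ^ (2 * ℓ) := by ring
      _ = _ := by
        rw [← pow_succ, ← pow_succ, e0, show 2 * ℓ - 1 + 1 = 2 * ℓ by omega, mul_pow, mul_pow,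
          ← pow_mul, ← pow_mul]
        ring
  exact le_of_pow_le_pow_left₀ (by omega) (by positivity) h5
end

open SimpleGraph

section
set_option linter.unusedSectionVars false
set_option linter.unusedDecidableInType false

/-- indicator -/
noncomputable def oneI {V : Type} [DecidableEq V] (S : Finset V) : V → ℝ := fun x => if x ∈ S then 1 else 0

theorem sum_oneI {V : Type} [DecidableEq V] [Fintype V] (S : Finset V) (f : V → ℝ) :
    ∑ x, oneI S x * f x = ∑ x ∈ S, f x := by
  simp [oneI]

theorem Aop_add {V : Type} [Fintype V] [DecidableEq V] {G : SimpleGraph V} (f g : V → ℝ) (r : ℝ) (u : V) :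
    Aop G (fun x => f x + r * g x) u = Aop G f u + r * Aop G g u := by
  simp only [Aop, Finset.mul_sum, ← Finset.sum_add_distrib]
  exact Finset.sum_congr rfl fun w _ => by ring

theorem PR_aux {V : Type} [Fintype V] [DecidableEq V] {G : SimpleGraph V} {η D : ℝ} (hη : 0 ≤ η)
    (hD : 0 ≤ D) (g h : V → ℝ) (hg : ∀ x, |g x| ≤ 1) (hh : ∀ x, |h x| ≤ 1)
    (hs : ∑ u, Aop G g u ^ 2 ≤ η ^ 2 * D ^ 2 * ∑ w, g w ^ 2) :
    |∑ u, h u * Aop G g u| ≤ η * D * Fintype.card V := by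
  have hN : ∀ f : V → ℝ, (∀ x, |f x| ≤ 1) → ∑ u, f u ^ 2 ≤ Fintype.card V := by
    intro f hf
    have : ∑ u, f u ^ 2 ≤ ∑ _u : V, (1:ℝ) := Finset.sum_le_sum fun u _ => by
      rw [← sq_abs]; exact pow_le_one₀ (abs_nonneg _) (hf u)
    simpa using this
  have h1 := Finset.sum_mul_sq_le_sq_mul_sq Finset.univ h (Aop G g)
  have h2 : (∑ u, h u ^ 2) * ∑ u, Aop G g u ^ 2 ≤
      Fintype.card V * (η ^ 2 * D ^ 2 * Fintype.card V) := by
    refine mul_le_mul (hN h hh) (hs.trans ?_) (Finset.sum_nonneg fun _ _ => sq_nonneg _) (by positivity)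
    exact mul_le_mul_of_nonneg_left (hN g hg) (by positivity)
  refine abs_le_of_sq_le_sq (h1.trans (h2.trans (le_of_eq (by ring)))) (by positivity)

theorem cut_ge {V : Type} [Fintype V] [DecidableEq V] {G : SimpleGraph V} {ℓ k : ℕ} {c D K : ℝ} {σ : V → Bool} (h : MS G ℓ k c D) (h2 : MS2 G ℓ D K σ)
    (hD : 3 * K ≤ D) (b : Bool) :
    D * Fintype.card V / 3 ≤ ∑ x ∈ side σ b, ((nb (Bp G σ) x).card : ℝ) := by
  rw [deg_sum_side]
  have hK := h2.K1
  have h1 := h.avg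
  have h3 := h2.ins
  have h4 := h2.card
  have e1 : D ^ ℓ = D ^ (ℓ - 1) * D := by rw [← pow_succ]; congr 1; have := h.two; omega
  have h5 : D ^ ℓ ≤ Fintype.card V := by
    have : 0 ≤ D ^ (ℓ - 1) := pow_nonneg (by linarith) _
    nlinarith
  have h6 : 0 ≤ D ^ ℓ := pow_nonneg (by linarith) _
  have h7 : 3 * (K * D ^ ℓ) ≤ D * Fintype.card V := by nlinarith
  linarith

theorem PR (ℓ : ℕ) (K α : ℝ) (hK : 1 ≤ K) (hα : 0 < α) : ∃ D0 : ℝ, 1 ≤ D0 ∧ ∀ {V : Type} [Fintype V]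
    [DecidableEq V] {G : SimpleGraph V} {k : ℕ} {c D : ℝ} {σ : V → Bool}, MS G ℓ k c D →
    MS2 G ℓ D K σ → 0 < c → D0 ≤ D → (ℓ = 2 ∨ Odd ℓ) → ∀ (b : Bool) (S T : Finset V),
    S ⊆ side σ b → T ⊆ side σ (!b) → α * Fintype.card V ≤ S.card → α * Fintype.card V ≤ T.card →
    α ^ 2 / 4 * D * Fintype.card V ≤ ∑ x ∈ S, ∑ y ∈ T, AM G x y := by
  obtain ⟨D1, hD1, hsp⟩ := spectral2 ℓ K (α ^ 2 / 24) (by positivity)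
  refine ⟨max D1 (3 * K), le_max_of_le_left hD1, ?_⟩
  intro V _ _ G k c D σ h h2 hc hD hl b S T hS hT hSc hTc
  simp only [max_le_iff] at hD
  obtain ⟨hDD, hDK⟩ := hD
  have hsp' := hsp h h2 hc hDD hl
  have hD0 : 0 ≤ D := by linarith
  have hne := h.ne
  have hN : (0:ℝ) < Fintype.card V := by exact_mod_cast Fintype.card_pos
  have hcut := cut_ge h h2 hDK b
  have hdisj : ∀ (b : Bool) x, x ∈ side σ b → x ∉ side σ (!b) := by
    intro b x hx hx2
    rw [mem_side] at hx hx2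
    rw [hx] at hx2
    cases b <;> simp at hx2
  -- generic facts
  have key : ∀ (b : Bool) (S : Finset V), S ⊆ side σ b → α * Fintype.card V ≤ S.card →
      ∃ r : ℝ, α ≤ r ∧ r ≤ 1 ∧ ∃ f : V → ℝ, (∀ x, |f x| ≤ 1) ∧ (∀ x, oneI S x = f x + r * oneI (side σ b) x) ∧
      ∑ u, Aop G f u ^ 2 ≤ (α ^ 2 / 24) ^ 2 * D ^ 2 * ∑ w, f w ^ 2 := by
    intro b S hS hSc
    have hs0 : (0:ℝ) < S.card := lt_of_lt_of_le (by positivity) hSc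
    have hle : (S.card : ℝ) ≤ (side σ b).card := by exact_mod_cast Finset.card_le_card hS
    have ha0 : (0:ℝ) < (side σ b).card := by linarith
    have haN : ((side σ b).card : ℝ) ≤ Fintype.card V := by exact_mod_cast Finset.card_le_univ _
    have hr1 : (S.card : ℝ) / (side σ b).card ≤ 1 := by rw [div_le_one ha0]; exact hle
    have hr0 : 0 ≤ (S.card : ℝ) / (side σ b).card := by positivity
    refine ⟨(S.card : ℝ) / (side σ b).card, ?_, hr1,
      fun x => oneI S x - (S.card : ℝ) / (side σ b).card * oneI (side σ b) x, ?_, ?_, ?_⟩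
    · rw [le_div_iff₀ ha0]
      refine le_trans ?_ hSc
      gcongr
    · intro x
      rw [abs_le]
      simp only [oneI]
      by_cases h1 : x ∈ S
      · rw [if_pos h1, if_pos (hS h1)]; constructor <;> linarith
      · rw [if_neg h1]
        split_ifs <;> constructor <;> linarith
    · intro x; ring
    · refine hsp' _ ?_
      intro b'
      rw [Finset.sum_sub_distrib, ← Finset.mul_sum]
      by_cases hb : b' = b
      · subst hb
        have e1 : ∑ x ∈ side σ b', oneI S x = S.card := by
          simp only [oneI, Finset.sum_boole, Finset.filter_mem_eq_inter]
          rw [Finset.inter_eq_right.2 hS]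
        have e2 : ∑ x ∈ side σ b', oneI (side σ b') x = (side σ b').card := by
          simp only [oneI, Finset.sum_boole, Finset.filter_mem_eq_inter]
          simp
        rw [e1, e2, div_mul_cancel₀ _ ha0.ne', sub_self]
      · have hb2 : b' = !b := Bool.eq_not_of_ne hb
        subst hb2
        have e1 : ∑ x ∈ side σ (!b), oneI S x = 0 := Finset.sum_eq_zero fun x hx => by
          have : x ∉ S := fun h1 => hdisj b x (hS h1) hx
          simp [oneI, this]
        have e2 : ∑ x ∈ side σ (!b), oneI (side σ b) x = 0 := Finset.sum_eq_zero fun x hx => by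
          have : x ∉ side σ b := fun h1 => hdisj b x h1 hx
          simp [oneI, this]
        rw [e1, e2]; ring
  obtain ⟨s, hs0, hs1, f, hf1, hfe, hfs⟩ := key b S hS hSc
  obtain ⟨t, ht0, ht1, g, hg1, hge, hgs⟩ := key (!b) T hT hTc
  have hone : ∀ (S : Finset V) x, |oneI S x| ≤ 1 := by
    intro S x; unfold oneI; split_ifs <;> simp
  have e1 : ∑ x ∈ S, ∑ y ∈ T, AM G x y = ∑ x, oneI S x * Aop G (oneI T) x := by
    rw [sum_oneI]
    refine Finset.sum_congr rfl fun x _ => ?_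
    rw [Aop]
    simp [oneI]
  have e2 : ∑ x, oneI S x * Aop G (oneI T) x = ∑ x, oneI S x * Aop G g x +
      t * ∑ x, oneI S x * Aop G (oneI (side σ (!b))) x := by
    rw [Finset.mul_sum, ← Finset.sum_add_distrib]
    refine Finset.sum_congr rfl fun x _ => ?_
    have : oneI T = fun x => g x + t * oneI (side σ (!b)) x := funext hge
    rw [this, Aop_add]; ring
  have e3 : ∑ x, oneI S x * Aop G (oneI (side σ (!b))) x = ∑ x, oneI (side σ (!b)) x * Aop G f x +
      s * ∑ x, oneI (side σ (!b)) x * Aop G (oneI (side σ b)) x := by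
    rw [Aop_adj, Finset.mul_sum, ← Finset.sum_add_distrib]
    refine Finset.sum_congr rfl fun x _ => ?_
    have : oneI S = fun x => f x + s * oneI (side σ b) x := funext hfe
    rw [this, Aop_add]; ring
  have e4 : ∑ x, oneI (side σ (!b)) x * Aop G (oneI (side σ b)) x =
      ∑ x ∈ side σ b, ((nb (Bp G σ) x).card : ℝ) := by
    rw [Aop_adj]
    rw [Finset.sum_congr rfl fun x _ => mul_comm _ _, sum_oneI]
    refine Finset.sum_congr rfl fun x hx => ?_
    rw [mem_side] at hx
    rw [← sum_AM, Aop]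
    refine Finset.sum_congr rfl fun y _ => ?_
    rw [AM_Bp, hx, oneI]
    by_cases hy : σ y = b
    · simp [mem_side, hy]
    · have := Bool.eq_not_of_ne hy
      simp [mem_side, this]
  have b1 := (abs_le.1 (PR_aux (G := G) (by positivity) hD0 g (oneI S) hg1 (hone S) hgs)).1
  have b2 := (abs_le.1 (PR_aux (G := G) (by positivity) hD0 f (oneI (side σ (!b))) hf1 (hone _) hfs)).1
  rw [e1, e2, e3, e4]
  have hDN : 0 ≤ D * Fintype.card V := by positivity
  have b3 : α * α ≤ t * s := mul_le_mul ht0 hs0 hα.le (by linarith)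
  have b4 : α ^ 2 * (D * Fintype.card V / 3) ≤ t * s * ∑ x ∈ side σ b, ((nb (Bp G σ) x).card : ℝ) := by
    rw [sq]
    exact mul_le_mul b3 hcut (by positivity) (by nlinarith)
  have b5 : -(α ^ 2 / 24 * D * Fintype.card V) ≤ t * ∑ x, oneI (side σ (!b)) x * Aop G f x := by
    have : 0 ≤ α ^ 2 / 24 * D * Fintype.card V := by positivity
    generalize ∑ x, oneI (side σ (!b)) x * Aop G f x = z at *
    nlinarith
  nlinarith
end

open SimpleGraph

section
set_option linter.unusedSectionVars false
set_option linter.unusedDecidableInType false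

/-- Delete the vertices of `F`. -/
def Del {V : Type} (G : SimpleGraph V) (F : Finset V) : SimpleGraph V where
  Adj x y := G.Adj x y ∧ x ∉ F ∧ y ∉ F
  symm := ⟨fun _ _ h => ⟨h.1.symm, h.2.2, h.2.1⟩⟩
  loopless := ⟨fun _ h => h.1.ne rfl⟩

variable {V : Type} [Fintype V] [DecidableEq V] {G : SimpleGraph V}

theorem BD_le (σ : V → Bool) (F : Finset V) : Bp (Del G F) σ ≤ G := fun _ _ h => h.1.1

theorem BD_deg {σ : V → Bool} {F : Finset V} {x : V} (hx : x ∉ F) :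
    ((nb (Bp G σ) x).card : ℝ) - F.card ≤ (nb (Bp (Del G F) σ) x).card := by
  have h1 : nb (Bp G σ) x \ F ⊆ nb (Bp (Del G F) σ) x := by
    intro y hy
    rw [Finset.mem_sdiff, mem_nb] at hy
    rw [mem_nb]
    exact ⟨⟨hy.1.1, hx, hy.2⟩, hy.1.2⟩
  have h2 := Finset.card_le_card h1
  have h3 := Finset.le_card_sdiff F (nb (Bp G σ) x)
  have h4 : (nb (Bp G σ) x).card ≤ (nb (Bp (Del G F) σ) x).card + F.card := by omega
  have : ((nb (Bp G σ) x).card : ℝ) ≤ (nb (Bp (Del G F) σ) x).card + F.card := by exact_mod_cast h4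
  linarith

theorem BD_lvl {σ : V → Bool} {F : Finset V} {a x : V} (ha : a ∉ F) {i : ℕ}
    (hx : x ∈ lvl (Bp (Del G F) σ) a i) : x ∉ F := by
  rcases i with _ | i
  · rw [lvl_zero, Finset.mem_singleton] at hx; rwa [hx]
  · obtain ⟨y, -, hy⟩ := exists_parent (mem_lvl.1 hx)
    exact hy.1.2.2

theorem BD_big {ℓ k : ℕ} {c D K : ℝ} {σ : V → Bool} (h : MS G ℓ k c D) (h2 : MS2 G ℓ D K σ)
    (hc : 0 < c) (hD1 : 1 ≤ D) (hD : k + 3 ≤ c / 4 * D) {F : Finset V} (hF : F.card ≤ k + 1) {a : V} (ha : a ∉ F) :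
    (c / 4) ^ ℓ / 2 * Fintype.card V ≤ (lvl (Bp (Del G F) σ) a ℓ).card := by
  have hl := h.two
  have hdeg : ∀ x, x ∉ F → c / 4 * D + 2 ≤ ((nb (Bp (Del G F) σ) x).card : ℝ) := by
    intro x hx
    have e1 := BD_deg (G := G) (σ := σ) hx
    have e2 := h.mindeg x
    have e3 := h2.loc x
    have e4 : (F.card : ℝ) ≤ k + 1 := by exact_mod_cast hF
    linarith
  have h1 := lvl_card_ge (h.ecf.mono (BD_le σ F)) (δ := c / 4 * D) (by positivity) a
    (fun i _ x hx => hdeg x (BD_lvl ha hx)) (ℓ - 1) (by omega)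
  have e0 : ℓ - 1 + 1 = ℓ := by omega
  rw [e0] at h1
  have h3 : (c / 4 * D) ^ ℓ ≤ (lvl (Bp (Del G F) σ) a ℓ).card := by
    refine le_trans ?_ h1
    have : (c / 4 * D) ^ ℓ = c / 4 * D * (c / 4 * D) ^ (ℓ - 1) := by
      rw [← pow_succ', e0]
    rw [this]
    refine mul_le_mul_of_nonneg_right ?_ (by positivity)
    linarith [hdeg a ha]
  refine le_trans ?_ h3
  have := h.card
  rw [mul_pow]
  have e5 : 0 ≤ (c / 4) ^ ℓ := by positivity
  nlinarith

theorem side_ge {ℓ k : ℕ} {c D K : ℝ} {σ : V → Bool} (h : MS G ℓ k c D) (h2 : MS2 G ℓ D K σ)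
    (hD : 3 * K ≤ D) (b : Bool) : 1 / (3 * K) * (Fintype.card V : ℝ) ≤ (side σ b).card := by
  have h1 := cut_ge h h2 hD b
  have hK := h2.K1
  have h3 : ∑ x ∈ side σ b, ((nb (Bp G σ) x).card : ℝ) ≤ ∑ x ∈ side σ b, K * D := by
    refine Finset.sum_le_sum fun x _ => le_trans ?_ (h2.maxdeg x)
    exact_mod_cast deg_Bp_le σ x
  rw [Finset.sum_const, nsmul_eq_mul] at h3
  have h4 : D * (Fintype.card V / 3) ≤ D * ((side σ b).card * K) := by linarith
  have h5 := le_of_mul_le_mul_left h4 (by linarith)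
  rw [div_mul_eq_mul_div, div_le_iff₀ (by linarith)]
  linarith

theorem low_levels {ℓ : ℕ} (hG : EvenCycleFree G ℓ) {Δ : ℝ} (hΔ1 : 1 ≤ Δ)
    (hΔ : ∀ x, ((nb G x).card : ℝ) ≤ Δ) {H : SimpleGraph V} (hH : H ≤ G) (a : V) :
    (((Finset.range ℓ).biUnion (lvl H a)).card : ℝ) ≤ ℓ * Δ ^ (ℓ - 1) := by
  have h1 : (((Finset.range ℓ).biUnion (lvl H a)).card : ℝ) ≤ ∑ i ∈ Finset.range ℓ, ((lvl H a i).card : ℝ) := by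
    exact_mod_cast Finset.card_biUnion_le
  have h2 : ∀ i ∈ Finset.range ℓ, ((lvl H a i).card : ℝ) ≤ Δ ^ (ℓ - 1) := by
    intro i hi
    rw [Finset.mem_range] at hi
    refine (lvl_card_le (hG.mono hH) (Δ := Δ) (fun x => le_trans ?_ (hΔ x)) a i hi.le).trans ?_
    · have : nb H x ⊆ nb G x := fun y hy => by rw [mem_nb] at *; exact hH hy
      exact_mod_cast Finset.card_le_card this
    · exact pow_le_pow_right₀ hΔ1 (by omega)
  have h3 := h1.trans (Finset.sum_le_sum h2)
  rw [Finset.sum_const, nsmul_eq_mul, Finset.card_range] at h3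
  exact h3

theorem not_low {H : SimpleGraph V} {a w : V} {ℓ : ℕ} (hw : w ∉ (Finset.range ℓ).biUnion (lvl H a)) :
    (ℓ : ℕ∞) ≤ H.edist a w := by
  by_contra hlt
  push Not at hlt
  obtain ⟨j, hj⟩ := ENat.ne_top_iff_exists.1 (ne_top_of_lt hlt)
  rw [← hj] at hlt
  refine hw (Finset.mem_biUnion.2 ⟨j, Finset.mem_range.2 (by exact_mod_cast hlt), mem_lvl.2 hj.symm⟩)

/-- joining the two trees at `w` -/
theorem join_trees {ℓ : ℕ} {σ : V → Bool} (hG : EvenCycleFree G ℓ) (hl : 1 ≤ ℓ) {F : Finset V} {a b w p : V}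
    (haF : a ∉ F) (hbF : b ∉ F) (hab : a ≠ b)
    (hp : p ∈ lvl (Bp (Del G (insert b F)) σ) a ℓ) (hpw : (Bp G σ).Adj p w) (hwF : w ∉ F)
    (hwa : w ∉ (Finset.range ℓ).biUnion (lvl (Bp (Del G (insert b F)) σ) a))
    (hwb : w ∉ (Finset.range ℓ).biUnion (lvl (Bp (Del G (insert a F)) σ) b))
    (hsd : ∀ x ∈ lvl (Bp (Del G (insert b F)) σ) a ℓ, σ x ≠ σ w)
    (hsd' : ∀ x ∈ lvl (Bp (Del G (insert a F)) σ) b ℓ, σ x ≠ σ w)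
    (hmany : ℓ + 2 ≤ (nb G w ∩ lvl (Bp (Del G (insert a F)) σ) b ℓ).card) :
    ∃ S : Set V, PP G a b (2 * ℓ + 2) S ∧ ∀ z ∈ S, z ∉ F := by
  have haF' : a ∉ insert b F := by simp [hab, haF]
  have hbF' : b ∉ insert a F := by simp [hab.symm, hbF]
  have hwa0 : w ≠ a := by
    rintro rfl
    exact hwa (Finset.mem_biUnion.2 ⟨0, by simp; omega, by rw [lvl_zero]; simp⟩)
  have hwb0 : w ≠ b := by
    rintro rfl
    exact hwb (Finset.mem_biUnion.2 ⟨0, by simp; omega, by rw [lvl_zero]; simp⟩)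
  obtain ⟨u, hu⟩ := exists_geo (mem_lvl.1 hp)
  -- the map killing
  have hgeo : ∀ x ∈ lvl (Bp (Del G (insert a F)) σ) b ℓ, ∃ v, Geo (Bp (Del G (insert a F)) σ) b x ℓ v :=
    fun x hx => exists_geo (mem_lvl.1 hx)
  choose! v hv using hgeo
  have hex : ∃ x ∈ nb G w ∩ lvl (Bp (Del G (insert a F)) σ) b ℓ, ∀ i ≤ ℓ, ∀ j ≤ ℓ, u i ≠ v x j := by
    by_contra hno
    push Not at hno
    choose! f hf j hj huv using hno
    have hmaps : ∀ x ∈ nb G w ∩ lvl (Bp (Del G (insert a F)) σ) b ℓ, f x ∈ Finset.range (ℓ + 1) := by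
      intro x hx
      rw [Finset.mem_range]
      have := hf x hx
      omega
    obtain ⟨x, hx, y, hy, hxy, hfxy⟩ := Finset.exists_ne_map_eq_of_card_lt_of_maps_to
      (s := nb G w ∩ lvl (Bp (Del G (insert a F)) σ) b ℓ) (t := Finset.range (ℓ + 1)) (f := f)
      (by rw [Finset.card_range]; omega) hmaps
    have hx2 := Finset.mem_inter.1 hx
    have hy2 := Finset.mem_inter.1 hy
    have hvx := hv x hx2.2
    have hvy := hv y hy2.2
    have e1 : v x (j x) = v y (j y) := by rw [← huv x hx, ← huv y hy, hfxy]
    have e2 := hvx.inj hvy (hj x hx) (hj y hy) e1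
    have hj0 : 1 ≤ j x := by
      by_contra h0
      have h0' : j x = 0 := by omega
      have e3 := huv x hx
      rw [h0', hvx.1] at e3
      have hub : u (f x) ∈ lvl (Bp (Del G (insert b F)) σ) a (f x) :=
        mem_lvl.2 (hu.2.2.2 _ (hf x hx))
      have := BD_lvl haF' hub
      rw [e3] at this
      simp at this
    have hadj : ∀ z, z ∈ nb G w ∩ lvl (Bp (Del G (insert a F)) σ) b ℓ →
        (Bp (Del G (insert a F)) σ).Adj z w := by
      intro z hz
      have hz2 := Finset.mem_inter.1 hz
      refine ⟨⟨(mem_nb.1 hz2.1).symm, BD_lvl hbF' hz2.2, by simp [hwa0, hwF]⟩, hsd' z hz2.2⟩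
    refine hxy (Geo.unique_below (hG.mono (BD_le σ (insert a F))) (j := j x) (by omega) (hj x hx)
      hvx hvy (by rw [e1, e2]) (not_low hwb) (hadj x hx) (hadj y hy))
  obtain ⟨x, hx, hdis⟩ := hex
  have hx2 := Finset.mem_inter.1 hx
  have hvx := hv x hx2.2
  have P1 := hu.pp.mono_graph (BD_le (G := G) σ (insert b F))
  have P2 := hvx.pp.mono_graph (BD_le (G := G) σ (insert a F))
  have huw : ∀ i ≤ ℓ, u i ≠ w := by
    intro i hi he
    have h1 := hu.2.2.2 i hi
    rcases hi.lt_or_eq with h2 | h2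
    · rw [he] at h1
      exact hwa (Finset.mem_biUnion.2 ⟨i, Finset.mem_range.2 h2, mem_lvl.2 h1⟩)
    · rw [h2, hu.2.1] at he
      exact hsd p hp (by rw [he])
  have hvw : ∀ i ≤ ℓ, v x i ≠ w := by
    intro i hi he
    have h1 := hvx.2.2.2 i hi
    rcases hi.lt_or_eq with h2 | h2
    · rw [he] at h1
      exact hwb (Finset.mem_biUnion.2 ⟨i, Finset.mem_range.2 h2, mem_lvl.2 h1⟩)
    · rw [h2, hvx.2.1] at he
      exact hsd' x hx2.2 (by rw [he])
  have Q1 := P1.append (PP.single hpw.1) (by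
    rintro z ⟨i, hi, rfl⟩ hz
    simp only [Set.mem_insert_iff, Set.mem_singleton_iff] at hz
    rcases hz with hz | hz
    · exact hz
    · exact absurd hz (huw i hi))
  have Q2 := (PP.single (mem_nb.1 hx2.1)).append P2.symm (by
    rintro z hz ⟨i, hi, rfl⟩
    simp only [Set.mem_insert_iff, Set.mem_singleton_iff] at hz
    rcases hz with hz | hz
    · exact absurd hz (hvw i hi)
    · exact hz)
  have Q := Q1.append Q2 (by
    rintro z hz1 hz2
    have hpu : p = u ℓ := hu.2.1.symm
    have hxv : x = v x ℓ := hvx.2.1.symm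
    by_contra hzw
    have h1 : ∃ i ≤ ℓ, z = u i := by
      rcases hz1 with h | h
      · exact h
      · rcases h with h | h
        · exact ⟨ℓ, le_rfl, h.trans hpu⟩
        · exact absurd h hzw
    have h2 : ∃ i ≤ ℓ, z = v x i := by
      rcases hz2 with h | h
      · rcases h with h | h
        · exact absurd h hzw
        · exact ⟨ℓ, le_rfl, Eq.trans h hxv⟩
      · exact h
    obtain ⟨i, hi, h1⟩ := h1
    obtain ⟨j, hj, h2⟩ := h2
    exact hdis i hi j hj (h1.symm.trans h2))
  refine ⟨_, by convert Q using 1; omega, ?_⟩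
  intro z hz
  have hl1 : ∀ i ≤ ℓ, u i ∉ F := fun i hi => by
    have := BD_lvl haF' (mem_lvl.2 (hu.2.2.2 i hi))
    simp at this
    exact this.2
  have hl2 : ∀ i ≤ ℓ, v x i ∉ F := fun i hi => by
    have := BD_lvl hbF' (mem_lvl.2 (hvx.2.2.2 i hi))
    simp at this
    exact this.2
  have hpu : u ℓ = p := hu.2.1
  have hxv : v x ℓ = x := hvx.2.1
  rcases hz with (h | h) | (h | h)
  · obtain ⟨i, hi, rfl⟩ := h
    exact hl1 i hi
  · rcases h with h | h
    · rw [h, ← hpu]; exact hl1 _ le_rfl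
    · rw [h]; exact hwF
  · rcases h with h | h
    · rw [h]; exact hwF
    · rw [h, ← hxv]; exact hl2 _ le_rfl
  · obtain ⟨i, hi, rfl⟩ := h
    exact hl2 i hi
end

open SimpleGraph

section
set_option linter.unusedSectionVars false
set_option linter.unusedDecidableInType false

theorem connect (ℓ k : ℕ) (c K : ℝ) (hc : 0 < c) (hK : 1 ≤ K) : ∃ D0 : ℝ, 1 ≤ D0 ∧ ∀ {V : Type} [Fintype V]
    [DecidableEq V] {G : SimpleGraph V} {D : ℝ} {σ : V → Bool}, MS G ℓ k c D →
    MS2 G ℓ D K σ → D0 ≤ D → (ℓ = 2 ∨ Odd ℓ) → ∀ (a b : V) (F : Finset V), a ∉ F → b ∉ F → a ≠ b →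
    σ a = σ b → F.card ≤ k → ∃ S : Set V, PP G a b (2 * ℓ + 2) S ∧ ∀ z ∈ S, z ∉ F := by
  obtain ⟨α, hαe⟩ : ∃ α, α = min ((c / 4) ^ ℓ / 2) (1 / (9 * K)) := ⟨_, rfl⟩
  have hα : 0 < α := by rw [hαe]; positivity
  have hα1 : α ≤ (c / 4) ^ ℓ / 2 := by rw [hαe]; exact min_le_left _ _
  have hα2 : α ≤ 1 / (9 * K) := by rw [hαe]; exact min_le_right _ _
  obtain ⟨D1, hD1, hPR⟩ := PR ℓ K α hK hα
  refine ⟨max (max D1 (3 * K)) (max (4 / c * (k + 3)) (max ((k + 2 * ℓ * K ^ (ℓ - 1)) / α)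
    (4 / α ^ 2 * (ℓ + 2)))), by simp [hD1], ?_⟩
  intro V _ _ G D σ h h2 hD hl a b F haF hbF hab hσ hF
  simp only [max_le_iff] at hD
  obtain ⟨⟨hDD, hDK⟩, hDc, hDs, hDe⟩ := hD
  have hDge1 : 1 ≤ D := hD1.trans hDD
  have hPR' := hPR h h2 hc hDD hl
  have hne := h.ne
  have hN : (0:ℝ) < Fintype.card V := by exact_mod_cast Fintype.card_pos
  have hl2 := h.two
  obtain ⟨s, hs⟩ : ∃ s, s = if Even ℓ then σ a else !(σ a) := ⟨_, rfl⟩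
  obtain ⟨Pa, hPa⟩ : ∃ Pa, Pa = lvl (Bp (Del G (insert b F)) σ) a ℓ := ⟨_, rfl⟩
  obtain ⟨Pb, hPb⟩ : ∃ Pb, Pb = lvl (Bp (Del G (insert a F)) σ) b ℓ := ⟨_, rfl⟩
  have hsPa : Pa ⊆ side σ s := by
    intro x hx
    rw [hPa] at hx
    have := side_lvl _ hx
    rw [mem_side, hs]
    by_cases he : Even ℓ
    · rw [if_pos he, this.2 he]
    · rw [if_neg he]
      exact Bool.eq_not_of_ne (fun h => he (this.1 h.symm))
  have hsPb : Pb ⊆ side σ s := by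
    intro x hx
    rw [hPb] at hx
    have := side_lvl _ hx
    rw [mem_side, hs, hσ]
    by_cases he : Even ℓ
    · rw [if_pos he, this.2 he]
    · rw [if_neg he]
      exact Bool.eq_not_of_ne (fun h => he (this.1 h.symm))
  have haF' : a ∉ insert b F := by simp [hab, haF]
  have hbF' : b ∉ insert a F := by simp [hab.symm, hbF]
  have hDc' : (k:ℝ) + 3 ≤ c / 4 * D := by
    have := mul_le_mul_of_nonneg_left hDc (by positivity : 0 ≤ c / 4)
    have e : c / 4 * (4 / c * ((k:ℝ) + 3)) = k + 3 := by field_simp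
    linarith
  have hcPa : α * Fintype.card V ≤ Pa.card := by
    rw [hPa]
    refine le_trans ?_ (BD_big h h2 hc hDge1 hDc' ((Finset.card_insert_le _ _).trans (by omega)) haF')
    gcongr
  have hcPb : α * Fintype.card V ≤ Pb.card := by
    rw [hPb]
    refine le_trans ?_ (BD_big h h2 hc hDge1 hDc' ((Finset.card_insert_le _ _).trans (by omega)) hbF')
    gcongr
  obtain ⟨L, hL⟩ : ∃ L, L = (side σ (!s)).filter (fun w => (nb G w ∩ Pb).card < ℓ + 2) := ⟨_, rfl⟩
  have hLc : (L.card : ℝ) < α * Fintype.card V := by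
    by_contra hge
    push Not at hge
    have h1 := hPR' s Pb L hsPb (by rw [hL]; exact Finset.filter_subset _ _) hcPb hge
    have h3 : ∑ x ∈ Pb, ∑ y ∈ L, AM G x y = ∑ y ∈ L, ((nb G y ∩ Pb).card : ℝ) := by
      refine (Finset.sum_comm (s := Pb) (t := L) (f := fun x y => AM G x y)).trans ?_
      refine Finset.sum_congr rfl fun y _ => ?_
      rw [← sum_AM_inter]
      exact Finset.sum_congr rfl fun x _ => AM_symm _ _
    have h4 : ∑ y ∈ L, ((nb G y ∩ Pb).card : ℝ) ≤ ∑ y ∈ L, ((ℓ:ℝ) + 1) := by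
      refine Finset.sum_le_sum fun y hy => ?_
      rw [hL, Finset.mem_filter] at hy
      have : (nb G y ∩ Pb).card ≤ ℓ + 1 := by omega
      exact_mod_cast this
    rw [Finset.sum_const, nsmul_eq_mul] at h4
    have h5 : (L.card : ℝ) ≤ Fintype.card V := by exact_mod_cast Finset.card_le_univ _
    have h6 : (ℓ:ℝ) + 2 ≤ α ^ 2 / 4 * D := by
      have := mul_le_mul_of_nonneg_left hDe (by positivity : 0 ≤ α ^ 2 / 4)
      have e : α ^ 2 / 4 * (4 / α ^ 2 * ((ℓ:ℝ) + 2)) = ℓ + 2 := by field_simp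
      linarith
    rw [h3] at h1
    have h7 := h1.trans h4
    have h8 : (L.card : ℝ) * (ℓ + 1) ≤ Fintype.card V * (ℓ + 1) := by gcongr
    have h9 : ((ℓ:ℝ) + 2) * Fintype.card V ≤ α ^ 2 / 4 * D * Fintype.card V := by gcongr
    nlinarith
  obtain ⟨Z, hZ⟩ : ∃ Z, Z = F ∪ ((Finset.range ℓ).biUnion (lvl (Bp (Del G (insert b F)) σ) a) ∪
    (Finset.range ℓ).biUnion (lvl (Bp (Del G (insert a F)) σ) b)) := ⟨_, rfl⟩
  have hZc : (Z.card : ℝ) ≤ α * Fintype.card V := by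
    have hKD : 1 ≤ K * D := by nlinarith
    have l1 := low_levels h.ecf hKD h2.maxdeg (BD_le σ (insert b F)) a
    have l2 := low_levels h.ecf hKD h2.maxdeg (BD_le σ (insert a F)) b
    have l3 : (Z.card : ℝ) ≤ F.card + (((Finset.range ℓ).biUnion (lvl (Bp (Del G (insert b F)) σ) a)).card +
        ((Finset.range ℓ).biUnion (lvl (Bp (Del G (insert a F)) σ) b)).card) := by
      rw [hZ]
      exact_mod_cast (Finset.card_union_le _ _).trans (Nat.add_le_add_left (Finset.card_union_le _ _) _)
    have l4 : (F.card : ℝ) ≤ k := by exact_mod_cast hF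
    have e1 : D ^ ℓ = D ^ (ℓ - 1) * D := by rw [← pow_succ]; congr 1; omega
    have hp1 : 1 ≤ D ^ (ℓ - 1) := one_le_pow₀ hDge1
    have l5 : D ^ ℓ ≤ Fintype.card V := by
      have := h2.card
      nlinarith
    rw [div_le_iff₀ hα] at hDs
    have l6 : ((k:ℝ) + 2 * ℓ * K ^ (ℓ - 1)) * D ^ (ℓ - 1) ≤ α * D ^ ℓ := by
      rw [e1]
      have := mul_le_mul_of_nonneg_right hDs (by positivity : 0 ≤ D ^ (ℓ - 1))
      linarith
    have l7 : α * D ^ ℓ ≤ α * Fintype.card V := mul_le_mul_of_nonneg_left l5 hα.le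
    rw [mul_pow] at l1 l2
    have l8 : (k:ℝ) ≤ k * D ^ (ℓ - 1) := le_mul_of_one_le_right (by positivity) hp1
    nlinarith
  -- T
  obtain ⟨T, hT⟩ : ∃ T, T = side σ (!s) \ (L ∪ Z) := ⟨_, rfl⟩
  have hTc : α * Fintype.card V ≤ T.card := by
    have h1 := side_ge h h2 hDK (!s)
    have h3 := Finset.le_card_sdiff (L ∪ Z) (side σ (!s))
    rw [← hT] at h3
    have h4 := Finset.card_union_le L Z
    have h5 : (side σ (!s)).card ≤ T.card + (L.card + Z.card) := by omega
    have h6 : ((side σ (!s)).card : ℝ) ≤ T.card + (L.card + Z.card) := by exact_mod_cast h5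
    have h7 : 3 * α ≤ 1 / (3 * K) := by
      have : 1 / (3 * K) = 3 * (1 / (9 * K)) := by field_simp; norm_num
      rw [this]; linarith
    have h8 := mul_le_mul_of_nonneg_right h7 hN.le
    linarith
  have hfin := hPR' s Pa T hsPa (by rw [hT]; exact Finset.sdiff_subset) hcPa hTc
  have hpos : 0 < ∑ x ∈ Pa, ∑ y ∈ T, AM G x y := lt_of_lt_of_le (by positivity) hfin
  have hpw : ∃ p ∈ Pa, ∃ w ∈ T, G.Adj p w := by
    by_contra hno
    push Not at hno
    refine hpos.ne' (Finset.sum_eq_zero fun x hx => Finset.sum_eq_zero fun y hy => ?_)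
    simp [AM, hno x hx y hy]
  obtain ⟨p, hp, w, hw, hadj⟩ := hpw
  rw [hT, Finset.mem_sdiff, Finset.mem_union, not_or] at hw
  obtain ⟨hws, hwL, hwZ⟩ := hw
  rw [hZ, Finset.mem_union, Finset.mem_union, not_or, not_or] at hwZ
  obtain ⟨hwF, hwa, hwb⟩ := hwZ
  have hne' : ∀ x ∈ side σ s, σ x ≠ σ w := by
    intro x hx
    rw [mem_side] at hx hws
    rw [hx, hws]
    cases s <;> simp
  have hmany : ℓ + 2 ≤ (nb G w ∩ Pb).card := by
    by_contra hlt
    refine hwL ?_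
    rw [hL, Finset.mem_filter]
    exact ⟨hws, by omega⟩
  rw [hPb] at hmany
  exact join_trees h.ecf (by omega) haF hbF hab (hPa ▸ hp) ⟨hadj, hne' p (hsPa hp)⟩ hwF hwa hwb
    (fun x hx => hne' x (hsPa (hPa ▸ hx))) (fun x hx => hne' x (hsPb (hPb ▸ hx))) hmany

theorem bip_big (ℓ k : ℕ) (c K : ℝ) (hc : 0 < c) (hK : 1 ≤ K) (hl : ℓ = 2 ∨ Odd ℓ) (hk : 2 * ℓ + 3 ≤ k)
    (hko : Odd k) : ∃ D0 : ℝ, 1 ≤ D0 ∧ ∀ {V : Type} [Fintype V]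
    [DecidableEq V] {G : SimpleGraph V} {D : ℝ} {σ : V → Bool}, MS G ℓ k c D →
    MS2 G ℓ D K σ → D0 ≤ D → ∀ x y, G.Adj x y → σ x ≠ σ y := by
  obtain ⟨D1, hD1, hcon⟩ := connect ℓ k c K hc hK
  refine ⟨max D1 (2 / c * (k + 3)), by simp [hD1], ?_⟩
  intro V _ _ G D σ h h2 hD x y hxy hσ
  simp only [max_le_iff] at hD
  obtain ⟨hDD, hDc⟩ := hD
  have hDc' : (k:ℝ) + 3 ≤ c * D / 2 := by
    have := mul_le_mul_of_nonneg_left hDc (by positivity : 0 ≤ c / 2)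
    have e : c / 2 * (2 / c * ((k:ℝ) + 3)) = k + 3 := by field_simp
    linarith
  have hU : ∀ z ∈ Finset.univ.erase y, k ≤ (nb (Bp G σ) z ∩ Finset.univ.erase y).card := by
    intro z _
    have e1 : nb (Bp G σ) z ∩ Finset.univ.erase y = (nb (Bp G σ) z).erase y := by
      ext u; simp; tauto
    rw [e1]
    have e2 := Finset.pred_card_le_card_erase (s := nb (Bp G σ) z) (a := y)
    have e3 : (k:ℝ) + 3 ≤ (nb (Bp G σ) z).card := by linarith [h.mindeg z, h2.loc z]
    have e4 : k + 3 ≤ (nb (Bp G σ) z).card := by exact_mod_cast e3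
    omega
  obtain ⟨z, hz, S, hSU, hSc, hxS, hzS, hPP⟩ := greedy (G := Bp G σ) hU (c := x)
    (by simp [hxy.ne]) (k - (2 * ℓ + 3)) (by omega)
  have heven : Even (k - (2 * ℓ + 3)) := by
    obtain ⟨m, hm⟩ := hko
    exact ⟨m - ℓ - 1, by omega⟩
  have hσz : σ x = σ z := by
    obtain ⟨p, -, hp, -⟩ := hPP
    have := (Bpc G σ).even_length_iff_congr p
    rw [hp] at this
    have h3 := this.1 heven
    change (σ x = true ↔ σ z = true) at h3
    revert h3
    cases σ x <;> cases σ z <;> simp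
  have hyS : y ∉ S := fun hy => by
    have := hSU hy
    simp at this
  have hzy : z ≠ y := by rintro rfl; exact hyS hzS
  obtain ⟨T, hT, hTF⟩ := hcon h h2 hDD hl z y (S.erase z) (by simp) (by simp [hyS]) hzy
    (hσz.symm.trans hσ) ((Finset.card_erase_le).trans (by omega))
  have hfull := (hPP.mono_graph (Bp_le σ)).append hT (by
    intro u hu huT
    by_contra hne
    exact hTF u huT (by simp [hne]; exact hu))
  have := hfull.cycle (by omega) hxy.symm
  refine h.nock ?_
  convert this using 1
  omega
end

open SimpleGraph

section
set_option linter.unusedSectionVars false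
set_option linter.unusedDecidableInType false

theorem half_lvl {V : Type} [Fintype V] [DecidableEq V] {G : SimpleGraph V} {c D K : ℝ} {σ : V → Bool}
    (h : MS G 2 5 c D) (h2 : MS2 G 2 D K σ) (hmin : ∀ v, 0.72 * D ≤ ((nb G v).card : ℝ))
    (hD : 1000 * K ≤ D) (hDb : 100000000 ≤ D)
    (hPR : ∀ (b : Bool) (S T : Finset V),
      S ⊆ side σ b → T ⊆ side σ (!b) → 0.001 * Fintype.card V ≤ (S.card : ℝ) →
      0.001 * Fintype.card V ≤ (T.card : ℝ) →
      0.001 ^ 2 / 4 * D * Fintype.card V ≤ ∑ x ∈ S, ∑ y ∈ T, AM G x y) (x : V) :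
    0.516 * D ^ 2 ≤ ((lvl G x 2 ∩ side σ (σ x)).card : ℝ) := by
  have hK := h2.K1
  have hne := h.ne
  have hN : (0:ℝ) < Fintype.card V := by exact_mod_cast Fintype.card_pos
  have hcard := h.card
  have hb : 0.1 * D ^ 2 ≤ ((lvl G x 2 ∩ side σ (σ x)).card : ℝ) := by
    have h1 := lvl_card_ge (h.ecf.mono (Bp_le σ)) (δ := 0.36 * D - 2) (by linarith) x
      (fun i _ z _ => by linarith [hmin z, h2.loc z]) 1 le_rfl
    have h3 : 0.36 * D ≤ (nb (Bp G σ) x).card := by linarith [hmin x, h2.loc x]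
    have h4 : lvl (Bp G σ) x 2 ⊆ (lvl G x 2 ∩ side σ (σ x)) ∪ nb G x := by
      intro z hz
      have hs := (side_lvl _ hz).2 (by decide)
      obtain ⟨u, hu, huz⟩ := exists_parent (i := 1) (mem_lvl.1 hz)
      have hu' := edist_eq_one_iff_adj.1 hu
      have hxz : x ≠ z := by
        rintro rfl
        have := mem_lvl.1 hz
        simp at this
      rw [Finset.mem_union, Finset.mem_inter, mem_lvl, mem_side, mem_nb]
      by_cases hadj : G.Adj x z
      · exact Or.inr hadj
      · left
        refine ⟨?_, hs.symm⟩
        obtain ⟨j, hj, hj2, -⟩ := edist_adj_le (i := 1) (edist_eq_one_iff_adj.2 hu'.1) huz.1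
        have : j ≠ 0 := by
          rintro rfl
          rw [Nat.cast_zero, edist_eq_zero_iff] at hj
          exact hxz hj
        have h1 : j ≠ 1 := by
          rintro rfl
          rw [Nat.cast_one, edist_eq_one_iff_adj] at hj
          exact hadj hj
        rw [hj]
        congr 1
        omega
    have h5 := (Finset.card_le_card h4).trans (Finset.card_union_le _ _)
    have h6 : ((lvl (Bp G σ) x 2).card : ℝ) ≤ (lvl G x 2 ∩ side σ (σ x)).card + (nb G x).card := by
      exact_mod_cast h5
    have h7 := h2.maxdeg x
    rw [pow_one] at h1
    have h8 : 0.36 * D * (0.36 * D - 2) ≤ (nb (Bp G σ) x).card * (0.36 * D - 2) :=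
      mul_le_mul_of_nonneg_right h3 (by linarith)
    have h9 : ((lvl (Bp G σ) x (1+1)).card : ℝ) = (lvl (Bp G σ) x 2).card := rfl
    nlinarith
  have hQ : ((lvl G x 2 ∩ side σ (!(σ x))).card : ℝ) < 0.001 * Fintype.card V := by
    by_contra hge
    push Not at hge
    have h1 := hPR (σ x) (lvl G x 2 ∩ side σ (σ x)) (lvl G x 2 ∩ side σ (!(σ x)))
      Finset.inter_subset_right Finset.inter_subset_right (by nlinarith) hge
    have h3 := few_edges h.ecf h.two h.hk h.nock x
    have h4 : ∑ u ∈ lvl G x 2 ∩ side σ (σ x), ∑ y ∈ lvl G x 2 ∩ side σ (!(σ x)), AM G u y ≤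
        E2 G (lvl G x 2) := by
      rw [E2]
      refine (Finset.sum_le_sum_of_subset_of_nonneg Finset.inter_subset_left ?_).trans
        (Finset.sum_le_sum fun u _ => Finset.sum_le_sum_of_subset_of_nonneg Finset.inter_subset_left ?_)
      · intro u _ _
        exact Finset.sum_nonneg fun _ _ => AM_nonneg _ _
      · intro y _ _
        exact AM_nonneg _ _
    have h5 := (h1.trans h4).trans h3
    push_cast at h5
    nlinarith
  have htot := lvl_card_ge h.ecf (δ := 0.72 * D - 2) (by linarith) x
      (fun i _ z _ => by linarith [hmin z]) 1 le_rfl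
  rw [pow_one] at htot
  have h8 : 0.72 * D * (0.72 * D - 2) ≤ (nb G x).card * (0.72 * D - 2) :=
    mul_le_mul_of_nonneg_right (hmin x) (by linarith)
  have h9 : ((lvl G x (1+1)).card : ℝ) ≤ (lvl G x 2 ∩ side σ (σ x)).card +
      (lvl G x 2 ∩ side σ (!(σ x))).card := by
    have : lvl G x 2 ⊆ (lvl G x 2 ∩ side σ (σ x)) ∪ (lvl G x 2 ∩ side σ (!(σ x))) := by
      intro z hz
      rw [Finset.mem_union, Finset.mem_inter, Finset.mem_inter, mem_side, mem_side]
      by_cases h : σ z = σ x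
      · exact Or.inl ⟨hz, h⟩
      · exact Or.inr ⟨hz, Bool.eq_not_of_ne h⟩
    exact_mod_cast (Finset.card_le_card this).trans (Finset.card_union_le _ _)
  nlinarith

theorem side_le {V : Type} [Fintype V] [DecidableEq V] {G : SimpleGraph V} {k : ℕ} {c D K : ℝ} {σ : V → Bool}
    (h : MS G 2 k c D) (h2 : MS2 G 2 D K σ) (hD : 100000 * K ≤ D) (b : Bool) :
    ((side σ b).card : ℝ) ≤ 1.01 * D ^ 2 := by
  have hK := h2.K1
  have h1 := balance h h2 (by linarith) (by linarith)
  have h3 := card_side σ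
  have h4 := h.card
  have hD0 : 0 < D := by linarith
  have h5 : 12 * K * D ^ 3 < 0.0004 * D ^ 4 := by
    have : 0 < D ^ 3 := by positivity
    have e : D ^ 4 = D ^ 3 * D := by ring
    rw [e]
    nlinarith
  by_contra hlt
  push Not at hlt
  have hd : 0 < D ^ 2 := by positivity
  have e4 : 0.0004 * D ^ 4 = (0.02 * D ^ 2) ^ 2 := by ring
  rw [e4] at h5
  have h6 := abs_lt_of_sq_lt_sq (lt_of_le_of_lt h1 h5) (by positivity)
  rw [abs_lt] at h6
  cases b <;> linarith [h6.1, h6.2]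

theorem bip_small (c K : ℝ) (hc : 0 < c) (hK : 1 ≤ K) : ∃ D0 : ℝ, 1 ≤ D0 ∧ ∀ {V : Type} [Fintype V]
    [DecidableEq V] {G : SimpleGraph V} {D : ℝ} {σ : V → Bool}, MS G 2 5 c D →
    MS2 G 2 D K σ → D0 ≤ D → (∀ v, 0.72 * D ≤ ((nb G v).card : ℝ)) → ∀ x y, G.Adj x y → σ x ≠ σ y := by
  obtain ⟨D1, hD1, hPR⟩ := PR 2 K 0.001 hK (by norm_num)
  refine ⟨max D1 (max (100000 * K) 100000000), by simp [hD1], ?_⟩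
  intro V _ _ G D σ h h2 hD hmin x y hxy hσ
  simp only [max_le_iff] at hD
  obtain ⟨hDD, hDK, hDb⟩ := hD
  have hPR' := hPR h h2 hc hDD (Or.inl rfl)
  have hx := half_lvl h h2 hmin (by linarith) hDb hPR' x
  have hy := half_lvl h h2 hmin (by linarith) hDb hPR' y
  have hs := side_le h h2 hDK (σ x)
  rw [← hσ] at hy
  obtain ⟨P, hP⟩ : ∃ P, P = lvl G x 2 ∩ side σ (σ x) := ⟨_, rfl⟩
  obtain ⟨Q, hQ⟩ : ∃ Q, Q = lvl G y 2 ∩ side σ (σ x) := ⟨_, rfl⟩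
  rw [← hP] at hx
  rw [← hQ] at hy
  have hinter : K * D < ((P ∩ Q).card : ℝ) := by
    have h1 : P ∪ Q ⊆ side σ (σ x) := by
      rw [hP, hQ]
      exact Finset.union_subset Finset.inter_subset_right Finset.inter_subset_right
    have h3 := Finset.card_union_add_card_inter P Q
    have h4 := Finset.card_le_card h1
    have h5 : P.card + Q.card ≤ (side σ (σ x)).card + (P ∩ Q).card := by omega
    have h6 : (P.card : ℝ) + Q.card ≤ (side σ (σ x)).card + (P ∩ Q).card := by exact_mod_cast h5
    nlinarith
  have hz : ∃ z ∈ P ∩ Q, ∀ w, G.Adj x w → G.Adj y w → ¬ G.Adj w z := by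
    by_cases hw : ∃ w, G.Adj x w ∧ G.Adj y w
    · obtain ⟨w, hw1, hw2⟩ := hw
      have : ∃ z ∈ P ∩ Q, z ∉ nb G w := by
        by_contra hno
        push Not at hno
        have h1 : (P ∩ Q).card ≤ (nb G w).card := Finset.card_le_card hno
        have h3 : ((P ∩ Q).card : ℝ) ≤ (nb G w).card := by exact_mod_cast h1
        linarith [h2.maxdeg w]
      obtain ⟨z, hz, hzw⟩ := this
      refine ⟨z, hz, fun w' h1 h3 => ?_⟩
      have : w' = w := unique_nbr h.ecf (v := x) (w := y) (i := 1) le_rfl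
        (edist_eq_one_iff_adj.2 h1) (edist_eq_one_iff_adj.2 hw1)
        (by rw [edist_eq_one_iff_adj.2 hxy]; simp) h3.symm hw2.symm
      rw [this]
      rwa [mem_nb] at hzw
    · push Not at hw
      have : (P ∩ Q).Nonempty := by
        rw [← Finset.card_pos]
        have : (0:ℝ) < (P ∩ Q).card := by nlinarith
        exact_mod_cast this
      obtain ⟨z, hz⟩ := this
      exact ⟨z, hz, fun w h1 h3 => absurd h3 (hw w h1)⟩
  obtain ⟨z, hz, hzw⟩ := hz
  rw [Finset.mem_inter, hP, hQ, Finset.mem_inter, Finset.mem_inter, mem_lvl, mem_lvl] at hz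
  obtain ⟨⟨hzx, -⟩, hzy, -⟩ := hz
  obtain ⟨u, hu, huz⟩ := exists_parent (i := 1) hzx
  obtain ⟨v, hv, hvz⟩ := exists_parent (i := 1) hzy
  have hxu := edist_eq_one_iff_adj.1 hu
  have hyv := edist_eq_one_iff_adj.1 hv
  have hne2 : ∀ a, G.edist a z = (2:ℕ) → a ≠ z ∧ ¬ G.Adj a z := by
    intro a ha
    constructor
    · rintro rfl
      simp at ha
    · intro h
      rw [edist_eq_one_iff_adj.2 h] at ha
      exact absurd ha (by norm_num)
  obtain ⟨hxz, hxz2⟩ := hne2 x hzx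
  obtain ⟨hyz, hyz2⟩ := hne2 y hzy
  have huv : u ≠ v := by
    rintro rfl
    exact hzw u hxu hyv huz
  have huy : u ≠ y := by rintro rfl; exact hyz2 huz
  have hvx : v ≠ x := by rintro rfl; exact hxz2 hvz
  have Q1 := (PP.single hxu).append (PP.single huz) (by
    intro a ha hb
    simp only [Set.mem_insert_iff, Set.mem_singleton_iff] at ha hb
    rcases ha with rfl | rfl
    · rcases hb with hb | hb
      · exact hb
      · exact absurd hb hxz
    · rfl)
  have Q2 := (PP.single hvz.symm).append (PP.single hyv.symm) (by
    intro a ha hb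
    simp only [Set.mem_insert_iff, Set.mem_singleton_iff] at ha hb
    rcases ha with rfl | rfl
    · rcases hb with hb | hb
      · exact hb
      · exact absurd hb.symm hyz
    · rfl)
  have Q := Q1.append Q2 (by
    intro a ha hb
    simp only [Set.mem_union, Set.mem_insert_iff, Set.mem_singleton_iff] at ha hb
    have h1 := hxy.ne
    grind)
  exact h.nock (Q.cycle (by norm_num) hxy.symm)
end

open SimpleGraph

section
set_option linter.unusedSectionVars false
set_option linter.unusedDecidableInType false

theorem moore_strict {V : Type*} [Fintype V] [DecidableEq V] {G : SimpleGraph V} [Nonempty V] {ℓ : ℕ}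
    (hl : 1 ≤ ℓ) (hG : EvenCycleFree G ℓ) (c : G.Coloring Bool) {D : ℝ}
    (hD : 4 ≤ D) (h : D * Fintype.card V < ∑ v, ((nb G v).card : ℝ)) :
    2 * ∑ i ∈ Finset.range (ℓ + 1), (D - 1) ^ i < Fintype.card V := by
  have hN : (0:ℝ) < Fintype.card V := by exact_mod_cast Fintype.card_pos
  obtain ⟨S, hS⟩ : ∃ S, S = ∑ v, ((nb G v).card : ℝ) := ⟨_, rfl⟩
  rw [← hS] at h
  have hd : D < S / Fintype.card V := by rwa [lt_div_iff₀ hN]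
  have hm := moore' hG c (D := S / Fintype.card V) (by linarith)
    (by rw [← hS, div_mul_cancel₀ _ hN.ne'])
  refine lt_of_lt_of_le ?_ hm
  have : ∑ i ∈ Finset.range (ℓ + 1), (D - 1) ^ i <
      ∑ i ∈ Finset.range (ℓ + 1), (S / Fintype.card V - 1) ^ i := by
    refine Finset.sum_lt_sum (fun i _ => ?_) ⟨1, by simp; omega, by simpa using hd⟩
    exact pow_le_pow_left₀ (by linarith) (by linarith) i
  linarith

theorem geom_le_pow_succ (q : ℝ) (hq : 0 ≤ q) (ℓ : ℕ) : ∑ i ∈ Finset.range (ℓ + 1), q ^ i ≤ (q + 1) ^ ℓ := by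
  induction ℓ with
  | zero => simp
  | succ l ih =>
    rw [geom_sum_succ, pow_succ]
    have : (1:ℝ) ≤ (q + 1) ^ l := one_le_pow₀ (by linarith)
    nlinarith

theorem core_big (ℓ k : ℕ) (hl : ℓ = 2 ∨ Odd ℓ) (hl2 : 2 ≤ ℓ) (hk : 2 * ℓ + 3 ≤ k) (hko : Odd k) :
    ∃ Q0 : ℕ, ∀ n q : ℕ, Q0 ≤ q → n = 2 * ∑ i ∈ Finset.range (ℓ + 1), q ^ i →
      ∀ G : SimpleGraph (Fin n), EvenCycleFree G ℓ → ¬ HasCycleLength G k →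
        ∑ v, ((nb G v).card : ℝ) ≤ ((q:ℝ) + 1) * n := by
  obtain ⟨K', D1, hD1, hms⟩ := MS.ms2 ℓ k (1 / 2) (by norm_num)
  set K := max K' 1 with hKdef
  have hK : 1 ≤ K := le_max_right _ _
  obtain ⟨D2, hD2, hbip⟩ := bip_big ℓ k (1 / 2) K (by norm_num) hK hl hk hko
  obtain ⟨Q, hQ⟩ := exists_nat_ge (max D1 (max D2 4))
  refine ⟨Q, fun n q hq hn G hG hnk => ?_⟩
  by_contra! hcon
  have hq' : max D1 (max D2 4) ≤ q := hQ.trans (by exact_mod_cast hq)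
  simp only [max_le_iff] at hq'
  obtain ⟨h1, h2, h3⟩ := hq'
  have hnR : (n:ℝ) = 2 * ∑ i ∈ Finset.range (ℓ + 1), (q:ℝ) ^ i := by rw [hn]; push_cast; rfl
  have hn0 : 0 < n := by
    rw [hn, Finset.sum_range_succ']; simp
  have : Nonempty (Fin n) := ⟨⟨0, hn0⟩⟩
  obtain ⟨U, -, hUne, hE, hdeg⟩ := exists_maximizer (G := G) Finset.univ Finset.univ_nonempty
    (fun m => ((q:ℝ) + 1) * m)
  have hE' : ((q:ℝ) + 1) * U.card < E2 G U := by
    rw [E2_univ, Finset.card_univ, Fintype.card_fin] at hE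
    linarith
  have hpos : (0:ℝ) < U.card := by exact_mod_cast hUne.card_pos
  have hU2 : 1 < U.card := by
    by_contra hh
    rw [E2_le_single (by omega)] at hE'
    nlinarith
  have hmin : ∀ x ∈ U, 1 / 2 * ((q:ℝ) + 1) ≤ (nb G x ∩ U).card := by
    intro x hx
    have h1 := hdeg x hx (by rw [← Finset.card_pos, Finset.card_erase_of_mem hx]; omega)
    rw [Nat.cast_sub (by omega)] at h1
    push_cast at h1; linarith
  have : Nonempty {x // x ∈ U} := hUne.to_subtype
  have hUn : (U.card : ℝ) ≤ n := by
    have := Finset.card_le_univ U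
    rw [Fintype.card_fin] at this
    exact_mod_cast this
  have hMS : MS (ind G U) ℓ k (1 / 2) ((q:ℝ) + 1) :=
    { ecf := ind_ecf hG
      nock := fun h => hnk (ind_cycle h)
      two := hl2
      hk := by omega
      mindeg := fun v => by rw [ind_nb]; exact hmin v v.2
      avg := by rw [ind_E2, Fintype.card_coe]; exact hE'.le
      card := by
        rw [Fintype.card_coe]
        have := geom_le_pow_succ q (by positivity) ℓ
        linarith
      ne := inferInstance }
  obtain ⟨σ, hσ⟩ := hms _ _ _ hMS (by linarith)
  have hKK : K = K' := max_eq_left hσ.K1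
  rw [← hKK] at hσ
  have hb := hbip hMS hσ (by linarith)
  have hm := moore_strict (by omega) (ind_ecf (U := U) hG) (Coloring.mk σ (fun {a b} hab => hb a b hab))
    (D := (q:ℝ) + 1) (by linarith) (by rw [ind_E2, Fintype.card_coe]; exact hE')
  rw [Fintype.card_coe, add_sub_cancel_right] at hm
  linarith

set_option maxHeartbeats 1000000 in
theorem core_small :
    ∃ Q0 : ℕ, ∀ n q : ℕ, Q0 ≤ q → n = 2 * ∑ i ∈ Finset.range (2 + 1), q ^ i →
      ∀ G : SimpleGraph (Fin n), EvenCycleFree G 2 → ¬ HasCycleLength G 5 →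
        ∑ v, ((nb G v).card : ℝ) ≤ ((q:ℝ) + 1) * n := by
  obtain ⟨K', D1, hD1, hms⟩ := MS.ms2 2 5 0.27 (by norm_num)
  set K := max K' 1 with hKdef
  have hK : 1 ≤ K := le_max_right _ _
  obtain ⟨D2, hD2, hbip⟩ := bip_small 0.27 K (by norm_num) hK
  obtain ⟨Q, hQ⟩ := exists_nat_ge (max (2 * D1) (max (2 * D2) (500 * K)))
  refine ⟨Q, fun n q hq hn G hG hnk => ?_⟩
  by_contra! hcon
  have hq' : max (2 * D1) (max (2 * D2) (500 * K)) ≤ q := hQ.trans (by exact_mod_cast hq)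
  simp only [max_le_iff] at hq'
  obtain ⟨h1, h2, h3⟩ := hq'
  obtain ⟨p, hp⟩ : ∃ p : ℝ, p = (q:ℝ) + 1 := ⟨_, rfl⟩
  rw [← hp] at hcon
  have hpq : (q:ℝ) = p - 1 := by linarith
  rw [hpq] at h1 h2 h3
  have hnR : (n:ℝ) = 2 * (p ^ 2 - p + 1) := by
    rw [hn]; push_cast
    simp only [Finset.sum_range_succ, Finset.sum_range_zero]
    rw [hpq]; ring
  have hp500 : 500 ≤ p := by linarith
  have hnpos : (450:ℝ) ≤ n := by rw [hnR]; nlinarith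
  have hnp2 : (n:ℝ) ≤ 2 * p ^ 2 := by rw [hnR]; nlinarith
  have hn0 : 0 < n := by
    have : (0:ℝ) < n := by linarith
    exact_mod_cast this
  have : Nonempty (Fin n) := ⟨⟨0, hn0⟩⟩
  obtain ⟨U, -, hUne, hE, hdeg⟩ := exists_maximizer (G := G) Finset.univ Finset.univ_nonempty
    (fun m => p * m * (0.55 + 0.45 * (m / n)))
  have hUn : (U.card : ℝ) ≤ n := by
    have := Finset.card_le_univ U
    rw [Fintype.card_fin] at this
    exact_mod_cast this
  have hpos : (0:ℝ) < U.card := by exact_mod_cast hUne.card_pos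
  obtain ⟨s, hs⟩ : ∃ s : ℝ, s = U.card / n := ⟨_, rfl⟩
  have hsn : (U.card : ℝ) = s * n := by
    rw [hs, div_mul_cancel₀ _ (by linarith)]
  have hs0 : 0 < s := by rw [hs]; apply div_pos hpos; linarith
  have hs1 : s ≤ 1 := by rw [hs]; apply div_le_one_of_le₀ hUn; linarith
  obtain ⟨D, hD⟩ : ∃ D : ℝ, D = p * (0.55 + 0.45 * s) := ⟨_, rfl⟩
  have hDp : D ≤ p := by rw [hD]; nlinarith
  have hDp2 : 0.55 * p ≤ D := by rw [hD]; nlinarith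
  have hE' : D * U.card < E2 G U := by
    rw [E2_univ, Finset.card_univ, Fintype.card_fin] at hE
    simp only [← hs] at hE
    rw [div_self (by linarith : (n:ℝ) ≠ 0)] at hE
    rw [hD]
    linarith
  have hU2 : 1 < U.card := by
    by_contra hh
    rw [E2_le_single (by omega)] at hE'
    nlinarith
  have hmin : ∀ x ∈ U, p * (0.55 + 0.45 * (2 * s - 1 / n)) ≤ 2 * (nb G x ∩ U).card := by
    intro x hx
    have h1 := hdeg x hx (by rw [← Finset.card_pos, Finset.card_erase_of_mem hx]; omega)
    rw [Nat.cast_sub (by omega)] at h1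
    refine le_trans (le_of_eq ?_) h1
    rw [hs]
    have : (n:ℝ) ≠ 0 := by linarith
    push_cast
    field_simp
    ring
  have hsn1 : 1 / n ≤ s := by
    rw [hs]; gcongr; exact_mod_cast hU2.le
  have hn450 : 1 / (n:ℝ) ≤ 1 / 450 := by
    apply one_div_le_one_div_of_le <;> linarith
  have : Nonempty {x // x ∈ U} := hUne.to_subtype
  have hcardle : (U.card : ℝ) ≤ 2 * D ^ 2 := by
    have e : 2 * D ^ 2 - s * (2 * p ^ 2) = 2 * p ^ 2 * ((1 - s) * (0.3025 - 0.2025 * s)) := by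
      rw [hD]; ring
    have : 0 ≤ 2 * p ^ 2 * ((1 - s) * (0.3025 - 0.2025 * s)) := by
      apply mul_nonneg (by positivity) (mul_nonneg (by linarith) (by linarith))
    have : s * n ≤ s * (2 * p ^ 2) := by gcongr
    linarith
  have hMS : MS (ind G U) 2 5 0.27 D :=
    { ecf := ind_ecf hG
      nock := fun h => hnk (ind_cycle h)
      two := le_rfl
      hk := by omega
      mindeg := fun v => by
        rw [ind_nb]
        have := hmin v v.2
        nlinarith
      avg := by rw [ind_E2, Fintype.card_coe]; exact hE'.le
      card := by
        rw [Fintype.card_coe]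
        exact hcardle
      ne := inferInstance }
  obtain ⟨σ, hσ'⟩ := hms _ _ _ hMS (by linarith)
  have hKK : K = K' := max_eq_left hσ'.K1
  rw [← hKK] at hσ'
  have hc := hσ'.card
  rw [Fintype.card_coe, hsn] at hc
  have hs99 : 0.99 ≤ s := by
    by_contra! hlt
    have e : 2 * D ^ 2 - s * (2 * p ^ 2) = 2 * p ^ 2 * ((1 - s) * (0.3025 - 0.2025 * s)) := by
      rw [hD]; ring
    have h5 : 0.01 * 0.1 ≤ (1 - s) * (0.3025 - 0.2025 * s) := by
      apply mul_le_mul <;> linarith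
    have h6 : s * n ≤ s * (2 * p ^ 2) := by gcongr
    have h7 : K * D ^ (2 - 1) ≤ K * p := by
      norm_num; gcongr
    have h8 : 2 * p ^ 2 * (0.01 * 0.1) ≤ 2 * p ^ 2 * ((1 - s) * (0.3025 - 0.2025 * s)) := by gcongr
    have h9 : K * p < 2 * p ^ 2 * (0.01 * 0.1) := by
      have : K * p < p / 500 * p := mul_lt_mul_of_pos_right (by linarith) (by linarith)
      linarith
    linarith
  have hmin2 : ∀ v, 0.72 * D ≤ ((nb (ind G U) v).card : ℝ) := by
    intro v
    rw [ind_nb]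
    have := hmin v v.2
    nlinarith
  have hb := hbip hMS hσ' (by linarith) hmin2
  have hm := moore_strict (by omega) (ind_ecf (U := U) hG) (Coloring.mk σ (fun {a b} hab => hb a b hab))
    (D := D) (by linarith) (by rw [ind_E2, Fintype.card_coe]; exact hE')
  rw [Fintype.card_coe, hsn, hnR] at hm
  simp only [Finset.sum_range_succ, Finset.sum_range_zero] at hm
  have e : (D - 1) ^ 2 + (D - 1) + 1 - s * (p ^ 2 - p + 1) =
      (1 - s) * (p ^ 2 * (0.3025 - 0.2025 * s) - 0.55 * p + 1) := by
    rw [hD]; ring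
  have : 0 ≤ (1 - s) * (p ^ 2 * (0.3025 - 0.2025 * s) - 0.55 * p + 1) := by
    apply mul_nonneg (by linarith)
    have : p ^ 2 * 0.1 ≤ p ^ 2 * (0.3025 - 0.2025 * s) := by gcongr; linarith
    nlinarith
  linarith

theorem two_edges {n : ℕ} (G : SimpleGraph (Fin n)) :
    2 * G.edgeSet.ncard = ∑ v, (nb G v).card := by
  classical
  have h := G.sum_degrees_eq_twice_card_edges
  have h2 : G.edgeSet.ncard = G.edgeFinset.card := by
    rw [← coe_edgeFinset, Set.ncard_coe_finset]
  rw [h2, ← h]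
  refine Finset.sum_congr rfl fun v _ => ?_
  rw [← card_neighborFinset_eq_degree]
  congr 1
  ext w
  simp [mem_nb]

theorem nbset_ncard {n : ℕ} (G : SimpleGraph (Fin n)) (v : Fin n) :
    (G.neighborSet v).ncard = (nb G v).card := by
  rw [← Set.ncard_coe_finset]
  congr 1
  ext w
  simp [mem_nb]

theorem no_odd {V : Type*} {G : SimpleGraph V} (h : G.Colorable 2) {k : ℕ} (hk : Odd k) :
    ¬ HasCycleLength G k := by
  rintro ⟨v, w, -, hl⟩
  have := two_colorable_iff_forall_loop_even.1 h v w
  rw [hl] at this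
  exact (Nat.not_even_iff_odd.2 hk) this
end

theorem exact_value_even_cycles (ℓ k : ℕ) (hℓ : ℓ = 2 ∨ ℓ = 3 ∨ ℓ = 5)
    (hk : Odd k) (hk2 : 2 * ℓ + 2 < k ∨ (ℓ = 2 ∧ k = 5)) :
    ∃ N : ℕ, ∀ n : ℕ, N < n → ∀ q : ℕ, 0 < q →
      n = 2 * ∑ i ∈ Finset.range (ℓ + 1), q ^ i →
      (∃ G : SimpleGraph (Fin n), G.Colorable 2 ∧
        (∀ v, (G.neighborSet v).ncard = q + 1) ∧ EvenCycleFree G ℓ) →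
      exTuran n ℓ k = zZar n ℓ ∧ 2 * zZar n ℓ = (q + 1) * n := by
  have hcore : ∃ Q0 : ℕ, ∀ n q : ℕ, Q0 ≤ q → n = 2 * ∑ i ∈ Finset.range (ℓ + 1), q ^ i →
      ∀ G : SimpleGraph (Fin n), EvenCycleFree G ℓ → ¬ HasCycleLength G k →
        ∑ v, ((nb G v).card : ℝ) ≤ ((q:ℝ) + 1) * n := by
    rcases hk2 with hk2 | ⟨rfl, rfl⟩
    · refine core_big ℓ k ?_ (by omega) (by omega) hk
      rcases hℓ with rfl | rfl | rfl
      · exact Or.inl rfl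
      · exact Or.inr (by decide)
      · exact Or.inr (by decide)
    · exact core_small
  obtain ⟨Q0, hQ0⟩ := hcore
  refine ⟨2 * ∑ i ∈ Finset.range (ℓ + 1), Q0 ^ i, fun n hn q hq hnq hG => ?_⟩
  obtain ⟨G, hGc, hGr, hGe⟩ := hG
  have hqQ : Q0 ≤ q := by
    by_contra! hlt
    have : ∑ i ∈ Finset.range (ℓ + 1), q ^ i ≤ ∑ i ∈ Finset.range (ℓ + 1), Q0 ^ i :=
      Finset.sum_le_sum fun i _ => Nat.pow_le_pow_left hlt.le i
    omega
  have hub : ∀ H : SimpleGraph (Fin n), EvenCycleFree H ℓ → ¬ HasCycleLength H k →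
      2 * H.edgeSet.ncard ≤ (q + 1) * n := by
    intro H h1 h2
    have := hQ0 n q hqQ hnq H h1 h2
    rw [two_edges]
    exact_mod_cast this
  have hGcount : 2 * G.edgeSet.ncard = (q + 1) * n := by
    rw [two_edges]
    simp only [← nbset_ncard, hGr]
    simp [mul_comm]
  have hmax1 : exTuran n ℓ k = G.edgeSet.ncard := by
    apply IsGreatest.csSup_eq
    refine ⟨⟨G, hGe, no_odd hGc hk, rfl⟩, ?_⟩
    rintro e ⟨H, h1, h2, rfl⟩
    have := hub H h1 h2
    omega
  have hmax2 : zZar n ℓ = G.edgeSet.ncard := by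
    apply IsGreatest.csSup_eq
    refine ⟨⟨G, hGe, hGc, rfl⟩, ?_⟩
    rintro e ⟨H, h1, h2, rfl⟩
    have := hub H h1 (no_odd h2 hk)
    omega
  exact ⟨by rw [hmax1, hmax2], by rw [hmax2, hGcount]⟩
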